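/- If G is a graph in obs(P1) that is not isomorphic to any of the 33 graphs in O, then either the complete bipartite graph K(2,3) is not a minor of G, or G is triconnected. -/

import Mathlib

open SimpleGraph

/-- `H` is a minor of `G` (branch-set definition): there is a family of connected, nonempty,
pairwise disjoint branch sets in `G`, indexed by the vertices of `H`, such that vertices
adjacent in `H` have an edge of `G` between their branch sets. -/
def IsMinorOf {W V : Type} (H : SimpleGraph W) (G : SimpleGraph V) : Prop :=
  ∃ f : W → Set V,
    (∀ w, (G.induce (f w)).Connected) ∧
    (∀ ⦃w w' : W⦄, w ≠ w' → Disjoint (f w) (f w')) ∧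
    (∀ ⦃w w' : W⦄, H.Adj w w' → ∃ a ∈ f w, ∃ b ∈ f w', G.Adj a b)

/-- A pseudoforest: every connected component contains at most one cycle, i.e. any two
cycles lying in the same connected component have the same edge set. -/
def Pseudoforest {V : Type} (G : SimpleGraph V) : Prop :=
  ∀ ⦃u v : V⦄ (c : G.Walk u u) (c' : G.Walk v v),
    c.IsCycle → c'.IsCycle → G.Reachable u v → ∀ e, e ∈ c.edges ↔ e ∈ c'.edges

/-- An apex-pseudoforest: removing at most one vertex yields a pseudoforest. -/
def ApexPseudoforest {V : Type} (G : SimpleGraph V) : Prop :=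
  ∃ s : Set V, s.Subsingleton ∧ Pseudoforest (G.induce sᶜ)

/-- `G` is a minor-obstruction for the class of apex-pseudoforests: `G` is not an
apex-pseudoforest but every proper minor of `G` is. -/
def ObsApexPseudoforest {V : Type} (G : SimpleGraph V) : Prop :=
  ¬ ApexPseudoforest G ∧
    ∀ (W : Type) [Finite W] (H : SimpleGraph W),
      IsMinorOf H G → IsEmpty (H ≃g G) → ApexPseudoforest H

/-- `G` is `k`-connected: between any two distinct vertices `u ≠ v` there exist `k`
pairwise distinct `(u,v)`-paths, any two of which share no vertices other than `u,v`. -/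
def KConnected {V : Type} (k : ℕ) (G : SimpleGraph V) : Prop :=
  ∀ ⦃u v : V⦄, u ≠ v → ∃ P : Fin k → G.Walk u v,
    Function.Injective P ∧ (∀ i, (P i).IsPath) ∧
      ∀ i j, i ≠ j → ∀ x, x ∈ (P i).support → x ∈ (P j).support → x = u ∨ x = v

/-- The simple graph on `Fin n` with the given list of (0-indexed) edges. -/
def mkGraph (n : ℕ) (E : List (ℕ × ℕ)) : SimpleGraph (Fin n) :=
  SimpleGraph.fromRel fun a b => ((a : ℕ), (b : ℕ)) ∈ E

/-- Obstruction 1: two disjoint diamonds. -/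
def O1 : SimpleGraph (Fin 8) :=
  mkGraph 8 [(0,1),(0,2),(0,3),(1,2),(1,3),(4,5),(4,6),(4,7),(5,6),(5,7)]
/-- Obstruction 2: two disjoint butterflies. -/
def O2 : SimpleGraph (Fin 10) :=
  mkGraph 10 [(0,1),(0,2),(1,2),(0,3),(0,4),(3,4),(5,6),(5,7),(6,7),(5,8),(5,9),(8,9)]
/-- Obstruction 3: a diamond plus a butterfly. -/
def O3 : SimpleGraph (Fin 9) :=
  mkGraph 9 [(0,1),(0,2),(0,3),(1,2),(1,3),(4,5),(4,6),(5,6),(4,7),(4,8),(7,8)]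
def O4 : SimpleGraph (Fin 8) :=
  mkGraph 8 [(0,1),(0,2),(1,2),(2,3),(2,4),(3,4),(3,5),(4,5),(5,6),(5,7),(6,7)]
def O5 : SimpleGraph (Fin 8) :=
  mkGraph 8 [(0,1),(0,2),(1,2),(2,3),(2,4),(3,4),(3,5),(4,6),(5,6),(5,7),(6,7)]
def O6 : SimpleGraph (Fin 8) :=
  mkGraph 8 [(0,1),(0,2),(1,2),(2,3),(2,4),(3,4),(3,5),(4,5),(3,6),(5,6),(4,7),(5,7)]
def O7 : SimpleGraph (Fin 7) :=
  mkGraph 7 [(0,1),(0,6),(1,6),(2,3),(2,4),(2,5),(3,4),(3,5),(4,6),(5,6)]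
def O8 : SimpleGraph (Fin 7) :=
  mkGraph 7 [(0,1),(0,2),(1,2),(2,3),(2,4),(2,5),(3,4),(3,5),(4,5),(4,6),(5,6)]
def O9 : SimpleGraph (Fin 9) :=
  mkGraph 9 [(0,1),(0,2),(1,2),(2,3),(2,4),(3,4),(3,5),(4,5),(2,6),(4,6),(2,7),(3,7),(3,8),(4,8)]
def O10 : SimpleGraph (Fin 9) :=
  mkGraph 9 [(0,1),(1,2),(2,3),(3,0),(0,4),(1,4),(1,5),(2,5),(2,6),(3,6),(0,7),(0,8),(7,8)]
def O11 : SimpleGraph (Fin 9) :=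
  mkGraph 9 [(0,1),(0,2),(1,2),(3,4),(3,5),(4,5),(6,7),(6,8),(7,8),(2,3),(1,8),(4,8)]
def O12 : SimpleGraph (Fin 9) :=
  mkGraph 9 [(0,1),(0,2),(1,2),(3,4),(3,5),(4,5),(6,7),(6,8),(7,8),(2,3),(2,7),(3,6)]
def O13 : SimpleGraph (Fin 9) :=
  mkGraph 9 [(0,1),(0,2),(1,2),(3,4),(3,5),(4,5),(6,7),(6,8),(7,8),(2,3),(2,8),(3,8)]
def O14 : SimpleGraph (Fin 8) :=
  mkGraph 8 [(0,1),(0,2),(1,2),(1,4),(2,3),(2,4),(3,4),(3,5),(4,5),(1,6),(1,7),(6,7)]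
def O15 : SimpleGraph (Fin 9) :=
  mkGraph 9 [(0,1),(0,2),(1,2),(2,3),(2,4),(3,4),(4,5),(4,6),(5,6),(6,7),(6,8),(7,8),(2,6)]
def O16 : SimpleGraph (Fin 6) :=
  mkGraph 6 [(0,2),(0,3),(0,4),(0,5),(1,2),(1,3),(1,4),(1,5),(2,3),(4,5)]
def O17 : SimpleGraph (Fin 6) :=
  mkGraph 6 [(0,1),(1,3),(3,2),(2,0),(4,0),(4,1),(4,2),(4,3),(5,0),(5,1)]
def O18 : SimpleGraph (Fin 8) :=
  mkGraph 8 [(0,1),(1,2),(2,3),(3,0),(4,0),(4,1),(5,1),(5,2),(6,2),(6,3),(7,3),(7,0)]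
def O19 : SimpleGraph (Fin 7) :=
  mkGraph 7 [(0,2),(0,3),(1,2),(1,3),(2,3),(0,4),(4,1),(5,0),(5,4),(6,4),(6,1)]
def O20 : SimpleGraph (Fin 6) :=
  mkGraph 6 [(1,2),(1,4),(1,5),(2,4),(2,5),(4,5),(0,1),(0,4),(2,3),(3,5)]
def O21 : SimpleGraph (Fin 7) :=
  mkGraph 7 [(0,1),(0,3),(0,4),(1,3),(1,4),(3,5),(4,5),(1,2),(2,4),(3,6),(5,6)]
def O22 : SimpleGraph (Fin 8) :=
  mkGraph 8 [(0,1),(0,3),(1,4),(3,4),(1,2),(2,4),(7,0),(7,3),(5,7),(5,0),(6,7),(6,3)]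
def O23 : SimpleGraph (Fin 7) :=
  mkGraph 7 [(2,3),(2,4),(2,6),(3,4),(3,6),(4,6),(5,3),(5,4),(0,2),(0,3),(1,2),(1,4)]
def O24 : SimpleGraph (Fin 7) :=
  mkGraph 7 [(0,1),(0,2),(1,2),(1,3),(2,4),(3,5),(3,6),(4,5),(4,6),(5,6)]
def O25 : SimpleGraph (Fin 8) :=
  mkGraph 8 [(0,1),(0,3),(1,3),(1,2),(1,5),(2,5),(1,7),(2,7),(3,4),(4,5),(3,5),(3,6),(5,6)]
def O26 : SimpleGraph (Fin 9) :=
  mkGraph 9 [(2,3),(2,4),(3,4),(5,3),(5,4),(8,3),(8,4),(0,2),(0,3),(7,2),(7,3),(1,2),(1,4),(6,2),(6,4)]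
def O27 : SimpleGraph (Fin 8) :=
  mkGraph 8 [(0,2),(1,2),(0,3),(2,3),(1,6),(2,6),(3,4),(6,7),(4,5),(5,7),(3,7),(4,7)]
def O28 : SimpleGraph (Fin 7) :=
  mkGraph 7 [(0,1),(0,2),(1,2),(1,3),(1,5),(3,5),(3,4),(3,6),(4,6),(2,5),(5,6)]
def O29 : SimpleGraph (Fin 9) :=
  mkGraph 9 [(0,1),(0,2),(1,2),(3,4),(3,5),(4,5),(6,7),(6,8),(7,8),(2,3),(1,7),(4,6)]
def O30 : SimpleGraph (Fin 8) :=
  mkGraph 8 [(0,1),(0,2),(1,2),(3,4),(3,5),(4,5),(6,7),(1,6),(4,6),(0,7),(5,7)]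
/-- Obstruction 31: the prism. -/
def O31 : SimpleGraph (Fin 6) :=
  mkGraph 6 [(0,1),(0,2),(1,2),(3,4),(3,5),(4,5),(0,3),(1,4),(2,5)]
/-- Obstruction 32: `K₃,₃`. -/
def O32 : SimpleGraph (Fin 6) :=
  mkGraph 6 [(0,3),(0,4),(0,5),(1,3),(1,4),(1,5),(2,3),(2,4),(2,5)]
/-- Obstruction 33: `K₅` minus one edge. -/
def O33 : SimpleGraph (Fin 5) :=
  mkGraph 5 [(0,1),(0,2),(0,3),(0,4),(1,2),(1,3),(1,4),(2,3),(2,4)]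

/-- The list `O` of the 33 obstructions. -/
def OList : List ((n : ℕ) × SimpleGraph (Fin n)) :=
  [⟨8, O1⟩, ⟨10, O2⟩, ⟨9, O3⟩, ⟨8, O4⟩, ⟨8, O5⟩, ⟨8, O6⟩, ⟨7, O7⟩, ⟨7, O8⟩, ⟨9, O9⟩,
   ⟨9, O10⟩, ⟨9, O11⟩, ⟨9, O12⟩, ⟨9, O13⟩, ⟨8, O14⟩, ⟨9, O15⟩, ⟨6, O16⟩, ⟨6, O17⟩,
   ⟨8, O18⟩, ⟨7, O19⟩, ⟨6, O20⟩, ⟨7, O21⟩, ⟨8, O22⟩, ⟨7, O23⟩, ⟨7, O24⟩, ⟨8, O25⟩,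
   ⟨9, O26⟩, ⟨8, O27⟩, ⟨7, O28⟩, ⟨9, O29⟩, ⟨8, O30⟩, ⟨6, O31⟩, ⟨6, O32⟩, ⟨5, O33⟩]

/-- `G` is isomorphic to one of the 33 graphs in `O`. -/
def InO {V : Type} (G : SimpleGraph V) : Prop :=
  ∃ H ∈ OList, Nonempty (G ≃g H.2)

/-- `Cn R S`: the set `S` is nonempty and connected for the relation `R`, in the sense that
every proper nonempty part of `S` is joined to its complement in `S`. -/
def Cn {α : Type} (R : α → α → Prop) (S : Set α) : Prop :=
  S.Nonempty ∧ ∀ A ⊆ S, A.Nonempty → A ≠ S → ∃ a ∈ A, ∃ b ∈ S \ A, R a b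

theorem cn_singleton {α : Type} (R : α → α → Prop) (a : α) : Cn R {a} := by
  refine ⟨⟨a, rfl⟩, fun A hA hne hn => absurd ?_ hn⟩
  exact (Set.Nonempty.subset_singleton_iff hne).1 hA

theorem Cn.mono {α : Type} {R R' : α → α → Prop} {S : Set α} (h : Cn R S)
    (hR : ∀ a ∈ S, ∀ b ∈ S, R a b → R' a b) : Cn R' S := by
  refine ⟨h.1, fun A hA hne hn => ?_⟩
  obtain ⟨a, ha, b, hb, hab⟩ := h.2 A hA hne hn
  exact ⟨a, ha, b, hb, hR a (hA ha) b hb.1 hab⟩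

/-- A union of connected sets along a connected index set is connected. -/
theorem Cn.biUnion {α β : Type} {R : α → α → Prop} {R' : β → β → Prop} {S : Set α}
    (h : Cn R S) (g : α → Set β) (hg : ∀ a ∈ S, Cn R' (g a))
    (hR : ∀ a ∈ S, ∀ b ∈ S, R a b → ∃ x ∈ g a, ∃ y ∈ g b, x = y ∨ R' x y) :
    Cn R' (⋃ a ∈ S, g a) := by
  obtain ⟨a₀, ha₀⟩ := h.1
  refine ⟨?_, fun A hA hne hn => ?_⟩
  · obtain ⟨x, hx⟩ := (hg a₀ ha₀).1
    exact ⟨x, Set.mem_biUnion ha₀ hx⟩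
  by_cases hsplit : ∃ a ∈ S, (A ∩ g a).Nonempty ∧ A ∩ g a ≠ g a
  · obtain ⟨a, ha, h1, h2⟩ := hsplit
    obtain ⟨x, hx, y, hy, hxy⟩ := (hg a ha).2 (A ∩ g a) Set.inter_subset_right h1 h2
    exact ⟨x, hx.1, y, ⟨Set.mem_biUnion ha hy.1, fun hyA => hy.2 ⟨hyA, hy.1⟩⟩, hxy⟩
  · push Not at hsplit
    have key : ∀ a ∈ S, ∀ x ∈ g a, x ∈ A → g a ⊆ A := by
      intro a ha x hx hxA
      have := hsplit a ha ⟨x, hxA, hx⟩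
      exact fun y hy => (this.symm ▸ hy : y ∈ A ∩ g a).1
    obtain ⟨a, ha, b, hb, hab⟩ := h.2 {a ∈ S | g a ⊆ A} (fun a ha => ha.1) (by
      obtain ⟨x, hx⟩ := hne
      obtain ⟨a, ha, hxa⟩ := Set.mem_iUnion₂.1 (hA hx)
      exact ⟨a, ha, key a ha x hxa hx⟩) (by
      intro he
      refine hn (Set.Subset.antisymm hA ?_)
      refine Set.iUnion₂_subset fun a ha => ?_
      rw [← he] at ha
      exact ha.2)
    obtain ⟨x, hx, y, hy, hxy⟩ := hR a ha.1 b hb.1 hab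
    have hyA : y ∉ A := fun hyA => hb.2 ⟨hb.1, key b hb.1 y hy hyA⟩
    refine ⟨x, ha.2 hx, y, ⟨Set.mem_biUnion hb.1 hy, hyA⟩, ?_⟩
    rcases hxy with rfl | hxy
    · exact absurd (ha.2 hx) hyA
    · exact hxy

theorem Cn.image {α β : Type} {R : α → α → Prop} {R' : β → β → Prop} {S : Set α}
    (h : Cn R S) (g : α → β) (hR : ∀ a ∈ S, ∀ b ∈ S, R a b → g a = g b ∨ R' (g a) (g b)) :
    Cn R' (g '' S) := by
  have := h.biUnion (R' := R') (fun a => {g a}) (fun a _ => cn_singleton _ _) (by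
    intro a ha b hb hab
    exact ⟨g a, rfl, g b, rfl, hR a ha b hb hab⟩)
  convert this using 1
  ext z
  simp [eq_comm]

theorem Cn.union {α : Type} {R : α → α → Prop} {S T : Set α} (hR : ∀ a b, R a b → R b a)
    (hS : Cn R S) (hT : Cn R T)
    (h : ∃ x ∈ S, ∃ y ∈ T, x = y ∨ R x y) : Cn R (S ∪ T) := by
  have h2 : Cn (fun a b : Bool => a ≠ b) Set.univ := by
    refine ⟨⟨true, trivial⟩, fun A _ hne hn => ?_⟩
    obtain ⟨a, ha⟩ := hne
    obtain ⟨b, hb⟩ := (Set.ne_univ_iff_exists_notMem A).1 hn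
    exact ⟨a, ha, b, ⟨trivial, hb⟩, fun e => hb (e ▸ ha)⟩
  obtain ⟨x, hx, y, hy, hxy⟩ := h
  have := h2.biUnion (R' := R) (fun b => if b then S else T) (by
    intro b _; cases b <;> simpa) (by
    intro a _ b _ hab
    cases a <;> cases b <;> simp at hab ⊢
    · exact ⟨y, hy, x, hx, hxy.imp Eq.symm (hR _ _)⟩
    · exact ⟨x, hx, y, hy, hxy⟩)
  convert this using 1
  ext z
  simp [or_comm]

theorem connected_induce_iff_cn {V : Type} (G : SimpleGraph V) (S : Set V) :
    (G.induce S).Connected ↔ Cn G.Adj S := by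
  constructor
  · intro h
    obtain ⟨x⟩ := h.nonempty
    refine ⟨⟨x.1, x.2⟩, fun A hA hne hn => ?_⟩
    obtain ⟨a, ha⟩ := hne
    obtain ⟨b, hb, hbA⟩ : ∃ b ∈ S, b ∉ A := by
      by_contra! hc
      exact hn (Set.Subset.antisymm hA hc)
    obtain ⟨p⟩ := h.preconnected ⟨a, hA ha⟩ ⟨b, hb⟩
    obtain ⟨d, -, h1, h2⟩ := p.exists_boundary_dart {x : S | x.1 ∈ A} ha hbA
    exact ⟨d.fst.1, h1, d.snd.1, ⟨d.snd.2, h2⟩, d.adj⟩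
  · intro h
    obtain ⟨x, hx⟩ := h.1
    have : Nonempty S := ⟨⟨x, hx⟩⟩
    refine ⟨fun u v => ?_⟩
    by_contra hv
    obtain ⟨a, ha, b, hb, hab⟩ := h.2 {y | ∃ hy : y ∈ S, (G.induce S).Reachable u ⟨y, hy⟩}
      (fun y hy => hy.1) ⟨u.1, u.2, SimpleGraph.Reachable.refl _⟩ (by
        intro he
        obtain ⟨_, hvr⟩ := he.ge v.2
        exact hv hvr)
    obtain ⟨haS, har⟩ := ha
    refine hb.2 ⟨hb.1, har.trans (SimpleGraph.Adj.reachable ?_)⟩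
    exact hab

/-- `H` has a minor model in `G` with all bags inside `s`. -/
def MinorIn {W V : Type} (H : SimpleGraph W) (G : SimpleGraph V) (s : Set V) : Prop :=
  ∃ f : W → Set V, (∀ w, Cn G.Adj (f w)) ∧ (∀ w, f w ⊆ s) ∧
    (∀ ⦃w w' : W⦄, w ≠ w' → Disjoint (f w) (f w')) ∧
    (∀ ⦃w w' : W⦄, H.Adj w w' → ∃ a ∈ f w, ∃ b ∈ f w', G.Adj a b)

theorem isMinorOf_iff {W V : Type} (H : SimpleGraph W) (G : SimpleGraph V) :
    IsMinorOf H G ↔ MinorIn H G Set.univ := by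
  simp [IsMinorOf, MinorIn, connected_induce_iff_cn]

theorem MinorIn.trans {W V X : Type} {H : SimpleGraph W} {G : SimpleGraph V}
    {K : SimpleGraph X} {s : Set V} {t : Set X} (h : MinorIn H G s)
    (g : V → Set X) (hg : ∀ v ∈ s, Cn K.Adj (g v)) (hgt : ∀ v ∈ s, g v ⊆ t)
    (hd : ∀ v ∈ s, ∀ v' ∈ s, v ≠ v' → Disjoint (g v) (g v'))
    (ha : ∀ v ∈ s, ∀ v' ∈ s, G.Adj v v' → ∃ a ∈ g v, ∃ b ∈ g v', K.Adj a b) :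
    MinorIn H K t := by
  obtain ⟨f, f1, f2, f3, f4⟩ := h
  refine ⟨fun w => ⋃ v ∈ f w, g v, ?_, ?_, ?_, ?_⟩
  · intro w
    refine (f1 w).biUnion g (fun a h => hg a (f2 w h)) fun a h b h' hab => ?_
    obtain ⟨x, hx, y, hy, hxy⟩ := ha a (f2 w h) b (f2 w h') hab
    exact ⟨x, hx, y, hy, Or.inr hxy⟩
  · intro w
    exact Set.iUnion₂_subset fun v hv => hgt v (f2 w hv)
  · intro w w' hw
    rw [Set.disjoint_left]
    rintro x hx hx'
    obtain ⟨v, hv, hxv⟩ := Set.mem_iUnion₂.1 hx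
    obtain ⟨v', hv', hxv'⟩ := Set.mem_iUnion₂.1 hx'
    have hne : v ≠ v' := by
      rintro rfl
      exact Set.disjoint_left.1 (f3 hw) hv hv'
    exact Set.disjoint_left.1 (hd v (f2 w hv) v' (f2 w' hv') hne) hxv hxv'
  · intro w w' hw
    obtain ⟨a, haf, b, hbf, hab⟩ := f4 hw
    obtain ⟨x, hx, y, hy, hxy⟩ := ha a (f2 w haf) b (f2 w' hbf) hab
    exact ⟨x, Set.mem_biUnion haf hx, y, Set.mem_biUnion hbf hy, hxy⟩

theorem MinorIn.of_hom {W V : Type} {H : SimpleGraph W} {G : SimpleGraph V} {s : Set V}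
    (φ : W → V) (hinj : Function.Injective φ) (hs : ∀ w, φ w ∈ s)
    (ha : ∀ ⦃w w'⦄, H.Adj w w' → G.Adj (φ w) (φ w')) : MinorIn H G s :=
  ⟨fun w => {φ w}, fun w => cn_singleton _ _, by simpa using hs,
    fun w w' h => by simpa using fun e => h (hinj e),
    fun w w' h => ⟨_, rfl, _, rfl, ha h⟩⟩

/-- Nodes of the realization of a multigraph with loops on vertices `ℕ`: the vertices, and extra
nodes subdividing parallel edges or completing loops to pendant triangles. -/
inductive Node : Type
  | base (v : ℕ)
  | ext (c : Bool) (e : Sym2 ℕ) (n : ℕ)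
  deriving DecidableEq

open Node

/-- The generating relation of the realization of the multigraph `r`. -/
def nodeRel (r : Sym2 ℕ → ℕ) : Node → Node → Prop
  | base u, base v => 0 < r s(u, v)
  | base u, ext _ e _ => u ∈ e
  | ext _ e n, ext _ e' n' => e = e' ∧ n = n'
  | ext _ _ _, base _ => False

/-- The realization of the multigraph `r` as a simple graph (on all potential nodes). -/
def realize (r : Sym2 ℕ → ℕ) : SimpleGraph Node := SimpleGraph.fromRel (nodeRel r)

/-- The nodes that are present in the realization of the multigraph `r` on vertex set `U`. -/
def validNodes (U : Finset ℕ) (r : Sym2 ℕ → ℕ) : Set Node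
  | base v => v ∈ U
  | ext c e n => (∀ u ∈ e, u ∈ U) ∧ n < r e ∧ (¬ e.IsDiag → c = false ∧ n + 1 < r e)

/-- `H` is a minor of the realization of `(U, r)`. -/
def Has {W : Type} (H : SimpleGraph W) (U : Finset ℕ) (r : Sym2 ℕ → ℕ) : Prop :=
  MinorIn H (realize r) (validNodes U r)

/-- Adjacency in the multigraph `r`. -/
def Jn (r : Sym2 ℕ → ℕ) (a b : ℕ) : Prop := 0 < r s(a, b)

theorem Jn.symm {r : Sym2 ℕ → ℕ} {a b : ℕ} (h : Jn r a b) : Jn r b a := by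
  unfold Jn at *; rwa [Sym2.eq_swap]

/-- Connectedness of a finite set of vertices of a multigraph. -/
abbrev Conn (r : Sym2 ℕ → ℕ) (S : Finset ℕ) : Prop := Cn (Jn r) (S : Set ℕ)

@[simp] theorem realize_base_base {r : Sym2 ℕ → ℕ} {u v : ℕ} :
    (realize r).Adj (base u) (base v) ↔ u ≠ v ∧ 0 < r s(u, v) := by
  simp [realize, nodeRel, Sym2.eq_swap (a := v)]

@[simp] theorem realize_base_ext {r : Sym2 ℕ → ℕ} {u : ℕ} {c e n} :
    (realize r).Adj (base u) (ext c e n) ↔ u ∈ e := by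
  simp [realize, nodeRel]

@[simp] theorem realize_ext_base {r : Sym2 ℕ → ℕ} {u : ℕ} {c e n} :
    (realize r).Adj (ext c e n) (base u) ↔ u ∈ e := by
  simp [realize, nodeRel]

@[simp] theorem realize_ext_ext {r : Sym2 ℕ → ℕ} {c e n c' e' n'} :
    (realize r).Adj (ext c e n) (ext c' e' n') ↔ c ≠ c' ∧ e = e' ∧ n = n' := by
  simp [realize, nodeRel]
  constructor
  · rintro ⟨h1, ⟨rfl, rfl⟩ | ⟨rfl, rfl⟩⟩ <;> simp_all
  · rintro ⟨h1, rfl, rfl⟩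
    simp [h1]

theorem Cn.base {r : Sym2 ℕ → ℕ} {S : Set ℕ} (h : Cn (Jn r) S) :
    Cn (realize r).Adj (Node.base '' S) :=
  h.image _ fun a _ b _ hab => by
    by_cases e : a = b
    · exact Or.inl (e ▸ rfl)
    · exact Or.inr (realize_base_base.2 ⟨e, hab⟩)

/-- Minors of multigraphs given by connected bags, an edge of multiplicity `m` being mapped to an
edge of multiplicity at least `m`. -/
theorem Has.of_bags {W : Type} {H : SimpleGraph W} {U U' : Finset ℕ} {r r' : Sym2 ℕ → ℕ}
    (h : Has H U' r') (f : ℕ → Set ℕ) (hc : ∀ v ∈ U', Cn (Jn r) (f v))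
    (hU : ∀ v ∈ U', f v ⊆ U) (hd : ∀ v ∈ U', ∀ v' ∈ U', v ≠ v' → Disjoint (f v) (f v'))
    (he : ∀ i ∈ U', ∀ j ∈ U', i ≠ j → 0 < r' s(i, j) →
      ∃ a ∈ f i, ∃ b ∈ f j, r' s(i, j) ≤ r s(a, b))
    (hl : ∀ i ∈ U', 0 < r' s(i, i) → ∃ a ∈ f i, r' s(i, i) ≤ r s(a, a)) :
    Has H U r := by
  have key : ∀ e : Sym2 ℕ, (∀ u ∈ e, u ∈ U') → 0 < r' e → ∃ e₁ : Sym2 ℕ,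
      (e₁.IsDiag ↔ e.IsDiag) ∧ (∀ a ∈ e₁, ∃ u ∈ e, a ∈ f u) ∧ (∀ u ∈ e, ∃ a ∈ e₁, a ∈ f u) ∧
        r' e ≤ r e₁ := by
    intro e
    induction e using Sym2.ind with
    | _ i j =>
      intro hu hr
      have hi := hu i (by simp)
      have hj := hu j (by simp)
      by_cases hij : i = j
      · subst hij
        obtain ⟨a, ha, har⟩ := hl i hi hr
        exact ⟨s(a, a), by simp, by simpa using ha, by simpa using ha, har⟩
      · obtain ⟨a, ha, b, hb, hab⟩ := he i hi j hj hij hr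
        refine ⟨s(a, b), ?_, ?_, ?_, hab⟩
        · have : a ≠ b := by
            rintro rfl
            exact Set.disjoint_left.1 (hd i hi j hj hij) ha hb
          simp [this, hij]
        · simp [ha, hb]
        · simp [ha, hb]
  choose! g g1 g2 g3 g4 using key
  refine MinorIn.trans h (fun
    | base v => base '' f v
    | ext c e n => {ext c (g e) n}) ?_ ?_ ?_ ?_
  · rintro (v | ⟨c, e, n⟩) hv
    · exact (hc v hv).base
    · exact cn_singleton _ _
  · rintro (v | ⟨c, e, n⟩) hv
    · rintro _ ⟨a, ha, rfl⟩
      exact hU v hv ha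
    · rw [Set.singleton_subset_iff]
      obtain ⟨h1, h2, h3⟩ := hv
      have hp : 0 < r' e := by omega
      refine ⟨fun a ha => ?_, lt_of_lt_of_le h2 (g4 e h1 hp), fun hd => ?_⟩
      · obtain ⟨u, hu, hau⟩ := g2 e h1 hp a ha
        exact hU u (h1 u hu) hau
      · obtain ⟨h4, h5⟩ := h3 (mt (g1 e h1 hp).2 hd)
        exact ⟨h4, lt_of_lt_of_le h5 (g4 e h1 hp)⟩
  · rintro (v | ⟨c, e, n⟩) hv (v' | ⟨c', e', n'⟩) hv' hne
    · have hvv : v ≠ v' := fun h => hne (h ▸ rfl)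
      rw [Set.disjoint_left]
      rintro _ ⟨a, ha, rfl⟩ ⟨b, hb, hba⟩
      cases hba
      exact Set.disjoint_left.1 (hd v hv v' hv' hvv) ha hb
    · simp
    · simp
    · obtain ⟨h1, h2, h3⟩ := hv
      obtain ⟨h1', h2', h3'⟩ := hv'
      rw [Set.disjoint_singleton]
      intro heq
      simp only [ext.injEq] at heq
      obtain ⟨rfl, hg, rfl⟩ := heq
      refine hne ?_
      have hp : 0 < r' e := by omega
      have hp' : 0 < r' e' := by omega
      have sub : ∀ e e' : Sym2 ℕ, (∀ u ∈ e, u ∈ U') → (∀ u ∈ e', u ∈ U') → 0 < r' e →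
          0 < r' e' → g e = g e' → ∀ u ∈ e, u ∈ e' := by
        intro e e' h1 h1' hp hp' hg u hu
        obtain ⟨a, ha, hau⟩ := g3 e h1 hp u hu
        rw [hg] at ha
        obtain ⟨u', hu', hau'⟩ := g2 e' h1' hp' a ha
        by_cases huu : u = u'
        · rwa [huu]
        · exact (Set.disjoint_left.1 (hd u (h1 u hu) u' (h1' u' hu') huu) hau hau').elim
      have : e = e' := by
        refine Sym2.ext fun u => ⟨sub e e' h1 h1' hp hp' hg u, sub e' e h1' h1 hp' hp hg.symm u⟩
      rw [this]
  · rintro (v | ⟨c, e, n⟩) hv (v' | ⟨c', e', n'⟩) hv' hadj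
    · rw [realize_base_base] at hadj
      obtain ⟨a, ha, b, hb, hab⟩ := he v hv v' hv' hadj.1 hadj.2
      refine ⟨base a, ⟨a, ha, rfl⟩, base b, ⟨b, hb, rfl⟩, realize_base_base.2 ⟨?_, by omega⟩⟩
      rintro rfl
      exact Set.disjoint_left.1 (hd v hv v' hv' hadj.1) ha hb
    · rw [realize_base_ext] at hadj
      obtain ⟨h1, h2, h3⟩ := hv'
      obtain ⟨a, ha, hav⟩ := g3 e' h1 (by omega) v hadj
      exact ⟨base a, ⟨a, hav, rfl⟩, _, rfl, realize_base_ext.2 ha⟩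
    · rw [realize_ext_base] at hadj
      obtain ⟨h1, h2, h3⟩ := hv
      obtain ⟨a, ha, hav⟩ := g3 e h1 (by omega) v' hadj
      exact ⟨_, rfl, base a, ⟨a, hav, rfl⟩, realize_ext_base.2 ha⟩
    · rw [realize_ext_ext] at hadj
      obtain ⟨h1, rfl, rfl⟩ := hadj
      exact ⟨_, rfl, _, rfl, realize_ext_ext.2 ⟨h1, rfl, rfl⟩⟩

theorem Has.mono {W : Type} {H : SimpleGraph W} {U U' : Finset ℕ} {r r' : Sym2 ℕ → ℕ}
    (h : Has H U' r') (hU : U' ⊆ U) (hr : ∀ i ∈ U', ∀ j ∈ U', r' s(i, j) ≤ r s(i, j)) :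
    Has H U r :=
  h.of_bags (fun v => {v}) (fun _ _ => cn_singleton _ _) (by simpa using fun v hv => hU hv)
    (fun v _ v' _ hv => by simpa using fun e => hv e)
    (fun i hi j hj _ _ => ⟨i, rfl, j, rfl, hr i hi j hj⟩) (fun i hi _ => ⟨i, rfl, hr i hi i hi⟩)

/-- Twice the number of edges (loops included) of the multigraph `r` inside `S`. -/
def E2 (r : Sym2 ℕ → ℕ) (S : Finset ℕ) : ℕ := ∑ i ∈ S, (∑ j ∈ S, r s(i, j) + r s(i, i))

/-- The number of edges (loops counted once) of `r` from `v` to `U`. -/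
def wt (r : Sym2 ℕ → ℕ) (U : Finset ℕ) (v : ℕ) : ℕ := ∑ j ∈ U, r s(v, j)

theorem E2_union {r : Sym2 ℕ → ℕ} {A B : Finset ℕ} (h : Disjoint A B) :
    E2 r (A ∪ B) = E2 r A + E2 r B + 2 * ∑ a ∈ A, ∑ b ∈ B, r s(a, b) := by
  have h1 : ∑ b ∈ B, ∑ a ∈ A, r s(b, a) = ∑ a ∈ A, ∑ b ∈ B, r s(a, b) := by
    rw [Finset.sum_comm]
    simp only [Sym2.eq_swap]
  simp only [E2, Finset.sum_union h, Finset.sum_add_distrib]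
  rw [h1]
  ring

theorem E2_singleton (r : Sym2 ℕ → ℕ) (v : ℕ) : E2 r {v} = 2 * r s(v, v) := by
  simp [E2]; ring

theorem E2_insert {r : Sym2 ℕ → ℕ} {S : Finset ℕ} {v : ℕ} (h : v ∉ S) :
    E2 r (insert v S) = E2 r S + 2 * (r s(v, v) + wt r S v) := by
  rw [Finset.insert_eq, E2_union (by simpa using h), E2_singleton]
  simp [wt]; ring

theorem wt_erase {r : Sym2 ℕ → ℕ} {U : Finset ℕ} {v u : ℕ} (h : u ∈ U) :
    wt r U v = wt r (U.erase u) v + r s(v, u) :=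
  (Finset.sum_erase_add U _ h).symm

theorem E2_erase {r : Sym2 ℕ → ℕ} {U : Finset ℕ} {v : ℕ} (h : v ∈ U) :
    E2 r U = E2 r (U.erase v) + 2 * wt r U v := by
  conv_lhs => rw [← Finset.insert_erase h]
  rw [E2_insert (by simp), wt_erase h]
  ring

theorem le_wt {r : Sym2 ℕ → ℕ} {U : Finset ℕ} {v u : ℕ} (h : u ∈ U) : r s(v, u) ≤ wt r U v :=
  Finset.single_le_sum (f := fun j => r s(v, j)) (fun _ _ => Nat.zero_le _) h

theorem E2_mono {r : Sym2 ℕ → ℕ} {S T : Finset ℕ} (h : S ⊆ T) : E2 r S ≤ E2 r T := by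
  rw [← Finset.union_sdiff_of_subset h, E2_union Finset.disjoint_sdiff]
  omega

theorem E2_congr {r r' : Sym2 ℕ → ℕ} {S : Finset ℕ}
    (h : ∀ i ∈ S, ∀ j ∈ S, r s(i, j) = r' s(i, j)) : E2 r S = E2 r' S :=
  Finset.sum_congr rfl fun i hi => by
    rw [h i hi i hi, Finset.sum_congr rfl (h i hi)]

theorem Conn.insert_vertex {r : Sym2 ℕ → ℕ} {S : Finset ℕ} (h : Conn r S) {a b : ℕ} (ha : a ∈ S)
    (hab : Jn r a b) : Conn r (insert b S) := by
  have := Cn.union (fun _ _ => Jn.symm) h (cn_singleton (Jn r) b) ⟨a, ha, b, rfl, Or.inr hab⟩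
  simpa [Conn, Set.union_singleton] using this

theorem Conn.union {r : Sym2 ℕ → ℕ} {S T : Finset ℕ} (hS : Conn r S) (hT : Conn r T)
    (h : ∃ x ∈ S, ∃ y ∈ T, x = y ∨ Jn r x y) : Conn r (S ∪ T) := by
  rw [Conn, Finset.coe_union]
  exact Cn.union (fun _ _ => Jn.symm) hS hT h

theorem Conn.nonempty {r : Sym2 ℕ → ℕ} {S : Finset ℕ} (hS : Conn r S) : S.Nonempty := by
  simpa using hS.1

theorem conn_singleton (r : Sym2 ℕ → ℕ) (v : ℕ) : Conn r {v} := by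
  simpa [Conn] using cn_singleton (Jn r) v

theorem Conn.cut {r : Sym2 ℕ → ℕ} {S A : Finset ℕ} (hS : Conn r S) (hA : A ⊆ S)
    (hne : A.Nonempty) (hn : A ≠ S) : ∃ a ∈ A, ∃ b ∈ S, b ∉ A ∧ Jn r a b := by
  obtain ⟨a, ha, b, hb, hab⟩ := hS.2 A (by simpa using hA) (by simpa using hne) (by simpa using hn)
  exact ⟨a, by simpa using ha, b, by simpa using hb.1, by simpa using hb.2, hab⟩

theorem conn_of_cut {r : Sym2 ℕ → ℕ} {S : Finset ℕ} (hS : S.Nonempty)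
    (h : ∀ A ⊆ S, A.Nonempty → A ≠ S → ∃ a ∈ A, ∃ b ∈ S, b ∉ A ∧ Jn r a b) : Conn r S := by
  classical
  refine ⟨by simpa using hS, fun A hA hne hn => ?_⟩
  have hfin : A.Finite := S.finite_toSet.subset hA
  obtain ⟨A, rfl⟩ := hfin.exists_finset_coe
  obtain ⟨a, ha, b, hb, hbA, hab⟩ := h A (by simpa using hA) (by simpa using hne) (by simpa using hn)
  exact ⟨a, by simpa using ha, b, by simp [hb, hbA], hab⟩

/-- A connectedness criterion testing only the cuts whose chosen side avoids a vertex. -/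
theorem conn_of_cut_avoiding {r : Sym2 ℕ → ℕ} {S : Finset ℕ} (c : ℕ) (hc : c ∈ S)
    (h : ∀ A ⊆ S, A.Nonempty → c ∉ A → ∃ a ∈ A, ∃ b ∈ S, b ∉ A ∧ Jn r a b) : Conn r S := by
  refine conn_of_cut ⟨c, hc⟩ fun A hA hne hn => ?_
  by_cases hcA : c ∈ A
  · obtain ⟨a, ha, b, hb, hba, hab⟩ := h (S \ A) Finset.sdiff_subset
      (Finset.sdiff_nonempty.2 fun hs => hn (Finset.Subset.antisymm hA hs)) (by simp [hcA])
    simp only [Finset.mem_sdiff, not_and, not_not] at ha hba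
    exact ⟨b, hba hb, a, ha.1, ha.2, hab.symm⟩
  · exact h A hA hne hcA

/-- Growing a connected set inside a larger connected set. -/
theorem Conn.grow {r : Sym2 ℕ → ℕ} {K : Finset ℕ} (hK : Conn r K) (P : Finset ℕ → Prop)
    {S : Finset ℕ} (hSK : S ⊆ K) (hS : S.Nonempty) (h0 : P S)
    (step : ∀ A ⊆ K, A.Nonempty → P A → ∀ a ∈ A, ∀ b ∈ K, b ∉ A → Jn r a b → P (insert b A)) :
    P K := by
  induction hn : (K \ S).card generalizing S with
  | zero =>
    rw [Finset.card_eq_zero, Finset.sdiff_eq_empty_iff_subset] at hn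
    rwa [← Finset.Subset.antisymm hSK hn]
  | succ n ih =>
    have hne : S ≠ K := by
      rintro rfl
      simp at hn
    obtain ⟨a, ha, b, hb, hbS, hab⟩ := hK.cut hSK hS hne
    refine ih (Finset.insert_subset hb hSK) ⟨a, by simp [ha]⟩ (step S hSK hS h0 a ha b hb hbS hab) ?_
    rw [Finset.sdiff_insert, Finset.card_erase_of_mem (by simp [hb, hbS]), hn]
    rfl

theorem Conn.excess_mono {r : Sym2 ℕ → ℕ} {S K : Finset ℕ} (hK : Conn r K) (hSK : S ⊆ K)
    (hS : S.Nonempty) : E2 r S + 2 * K.card ≤ E2 r K + 2 * S.card := by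
  refine hK.grow (fun A => E2 r S + 2 * A.card ≤ E2 r A + 2 * S.card) hSK hS le_rfl ?_
  intro A _ _ hA a ha b _ hb hab
  rw [E2_insert hb, Finset.card_insert_of_notMem hb]
  have : r s(b, a) ≤ wt r A b := le_wt ha
  have h2 : 0 < r s(b, a) := hab.symm
  omega

theorem Conn.le_excess {r : Sym2 ℕ → ℕ} {K : Finset ℕ} (hK : Conn r K) :
    2 * K.card ≤ E2 r K + 2 := by
  obtain ⟨v, hv⟩ := hK.nonempty
  have := hK.excess_mono (Finset.singleton_subset_iff.2 hv) (by simp)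
  simp at this
  omega

/-- A connected set spanning more edges than vertices. -/
def Bic (r : Sym2 ℕ → ℕ) (S : Finset ℕ) : Prop := Conn r S ∧ 2 * S.card < E2 r S

/-- Every vertex is avoided by some connected set spanning more edges than vertices. -/
def NonP (U : Finset ℕ) (r : Sym2 ℕ → ℕ) : Prop :=
  U.Nonempty ∧ ∀ v ∈ U, ∃ S ⊆ U, v ∉ S ∧ Bic r S

/-- Contraction of `y` into `x`, keeping the larger multiplicity. -/
def contr (r : Sym2 ℕ → ℕ) (x y : ℕ) (e : Sym2 ℕ) : ℕ :=
  max (r e) (r (e.map fun v => if v = x then y else v))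

theorem Has.contract {W : Type} {H : SimpleGraph W} {U : Finset ℕ} {r : Sym2 ℕ → ℕ} {x y : ℕ}
    (hx : x ∈ U) (hy : y ∈ U) (hxy : Jn r x y) (h : Has H (U.erase y) (contr r x y)) :
    Has H U r := by
  refine h.of_bags (fun v => if v = x then {x, y} else {v}) ?_ ?_ ?_ ?_ ?_
  · intro v _
    split_ifs
    · have := (conn_singleton r x).insert_vertex (Finset.mem_singleton_self x) hxy
      rw [Set.pair_comm]
      simpa [Conn] using this
    · exact cn_singleton _ _
  · intro v hv
    split_ifs
    · simp [Set.insert_subset_iff, hx, hy]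
    · simpa using (Finset.mem_erase.1 hv).2
  · intro v hv v' hv' hne
    rw [Finset.mem_erase] at hv hv'
    rw [Set.disjoint_left]
    split_ifs <;> simp <;> grind
  · intro i hi j hj hij h0
    simp only [contr, Sym2.map_mk] at h0 ⊢
    rcases le_total (r s(if i = x then y else i, if j = x then y else j)) (r s(i, j)) with h | h
    · rw [max_eq_left h]
      exact ⟨i, by split_ifs with e <;> simp [e], j, by split_ifs with e <;> simp [e], le_rfl⟩
    · rw [max_eq_right h]
      exact ⟨_, by split_ifs <;> simp, _, by split_ifs <;> simp, le_rfl⟩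
  · intro i hi h0
    simp only [contr, Sym2.map_mk] at h0 ⊢
    rcases le_total (r s(if i = x then y else i, if i = x then y else i)) (r s(i, i)) with h | h
    · rw [max_eq_left h]
      exact ⟨i, by split_ifs with e <;> simp [e], le_rfl⟩
    · rw [max_eq_right h]
      exact ⟨_, by split_ifs <;> simp, le_rfl⟩

/-- Suppressing a vertex `v` joined to `y` and `z`. -/
theorem Has.suppress {W : Type} {H : SimpleGraph W} {U : Finset ℕ} {r : Sym2 ℕ → ℕ} {v y z : ℕ}
    (hv : v ∈ U) (hy : y ∈ U) (hz : z ∈ U) (hvy : Jn r v y) (hvz : Jn r v z) (hyz : y ≠ z)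
    (hyv : y ≠ v) (hzv : z ≠ v)
    (h : Has H (U.erase v) (Function.update r s(y, z) (r s(y, z) + 1))) : Has H U r := by
  by_cases h0 : r s(y, z) = 0
  · refine h.of_bags (fun u => if u = y then {y, v} else {u}) ?_ ?_ ?_ ?_ ?_
    · intro u _
      split_ifs
      · have := (conn_singleton r y).insert_vertex (Finset.mem_singleton_self y) hvy.symm
        rw [Set.pair_comm]
        simpa [Conn] using this
      · exact cn_singleton _ _
    · intro u hu
      split_ifs
      · simp [Set.insert_subset_iff, hy, hv]
      · simpa using (Finset.mem_erase.1 hu).2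
    · intro u hu u' hu' hne
      rw [Finset.mem_erase] at hu hu'
      rw [Set.disjoint_left]
      split_ifs <;> simp <;> grind
    · intro i hi j hj hij hr
      by_cases he : s(i, j) = s(y, z)
      · rw [he, Function.update_self, h0]
        rw [Sym2.eq_iff] at he
        rcases he with ⟨rfl, rfl⟩ | ⟨rfl, rfl⟩
        · exact ⟨v, by simp, j, by simp [hyz.symm], hvz⟩
        · exact ⟨i, by simp [hij], v, by simp, hvz.symm⟩
      · rw [Function.update_of_ne he]
        exact ⟨i, by split_ifs with e <;> simp [e], j, by split_ifs with e <;> simp [e], le_rfl⟩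
    · intro i hi hr
      have he : s(i, i) ≠ s(y, z) := by
        rw [Ne, Sym2.eq_iff]; grind
      rw [Function.update_of_ne he]
      exact ⟨i, by split_ifs with e <;> simp [e], le_rfl⟩
  · have hnd : ¬ (s(y, z) : Sym2 ℕ).IsDiag := by simpa using hyz
    refine MinorIn.trans h (fun
      | base u => {base u}
      | ext c e n => if e = s(y, z) ∧ n = r s(y, z) - 1 then {base v} else {ext c e n})
      ?_ ?_ ?_ ?_
    · rintro (u | ⟨c, e, n⟩) hu
      · exact cn_singleton _ _
      · dsimp only
        split_ifs <;> exact cn_singleton _ _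
    · rintro (u | ⟨c, e, n⟩) hu
      · exact Set.singleton_subset_iff.2 (Finset.mem_erase.1 hu).2
      · obtain ⟨h1, h2, h3⟩ := hu
        dsimp only
        split_ifs with hh
        · exact Set.singleton_subset_iff.2 hv
        · rw [Set.singleton_subset_iff]
          refine ⟨fun a ha => (Finset.mem_erase.1 (h1 a ha)).2, ?_⟩
          by_cases he : e = s(y, z)
          · subst he
            simp only [Function.update_self, true_and] at h2 h3 hh
            have := h3 hnd
            exact ⟨by omega, fun _ => ⟨this.1, by omega⟩⟩
          · rw [Function.update_of_ne he] at h2 h3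
            exact ⟨h2, h3⟩
    · rintro (u | ⟨c, e, n⟩) hu (u' | ⟨c', e', n'⟩) hu' hne
      · simpa using hne
      · have : u ≠ v := (Finset.mem_erase.1 hu).1
        dsimp only
        split_ifs <;> simp [this]
      · have : u' ≠ v := (Finset.mem_erase.1 hu').1
        dsimp only
        split_ifs <;> simp [this.symm]
      · have h3 := hu.2.2
        have h3' := hu'.2.2
        dsimp only
        split_ifs with h1 h2 h2
        · exfalso
          rw [h1.1] at h3
          rw [h2.1] at h3'
          apply hne
          rw [h1.1, h1.2, h2.1, h2.2, (h3 hnd).1, (h3' hnd).1]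
        · simp
        · simp
        · simpa using hne
    · rintro (u | ⟨c, e, n⟩) hu (u' | ⟨c', e', n'⟩) hu' hadj
      · rw [realize_base_base] at hadj
        refine ⟨_, rfl, _, rfl, realize_base_base.2 ⟨hadj.1, ?_⟩⟩
        by_cases he : s(u, u') = s(y, z)
        · rw [he]; omega
        · rw [Function.update_of_ne he] at hadj
          exact hadj.2
      · rw [realize_base_ext] at hadj
        refine ⟨_, rfl, ?_⟩
        dsimp only
        split_ifs with h1
        · refine ⟨_, rfl, realize_base_base.2 ⟨(Finset.mem_erase.1 hu).1, ?_⟩⟩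
          rw [h1.1, Sym2.mem_iff] at hadj
          rcases hadj with rfl | rfl
          · exact hvy.symm
          · exact hvz.symm
        · exact ⟨_, rfl, realize_base_ext.2 hadj⟩
      · rw [realize_ext_base] at hadj
        dsimp only
        split_ifs with h1
        · refine ⟨_, rfl, _, rfl, realize_base_base.2 ⟨(Finset.mem_erase.1 hu').1.symm, ?_⟩⟩
          rw [h1.1, Sym2.mem_iff] at hadj
          rcases hadj with rfl | rfl
          · exact hvy
          · exact hvz
        · exact ⟨_, rfl, _, rfl, realize_ext_base.2 hadj⟩
      · have h3 := hu.2.2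
        have h3' := hu'.2.2
        rw [realize_ext_ext] at hadj
        obtain ⟨hc, rfl, rfl⟩ := hadj
        have hne : e ≠ s(y, z) := by
          rintro rfl
          exact hc ((h3 hnd).1.trans (h3' hnd).1.symm)
        simp only [hne, false_and, if_false]
        exact ⟨_, rfl, _, rfl, realize_ext_ext.2 ⟨hc, rfl, rfl⟩⟩

/-- Any two vertices of a connected set are separated by a partition into two connected parts. -/
theorem Conn.split {r : Sym2 ℕ → ℕ} {S : Finset ℕ} (hS : Conn r S) {a b : ℕ} (ha : a ∈ S)
    (hb : b ∈ S) (hab : a ≠ b) : ∃ X Y : Finset ℕ, X ∪ Y = S ∧ Disjoint X Y ∧ a ∈ X ∧ b ∈ Y ∧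
      Conn r X ∧ Conn r Y := by
  refine hS.grow (S := {a, b}) (fun A => ∃ X Y : Finset ℕ, X ∪ Y = A ∧ Disjoint X Y ∧ a ∈ X ∧
    b ∈ Y ∧ Conn r X ∧ Conn r Y) (by simp [Finset.insert_subset_iff, ha, hb]) (by simp) ?_ ?_
  · exact ⟨{a}, {b}, rfl, by simpa using hab, by simp, by simp, conn_singleton r a,
      conn_singleton r b⟩
  · rintro _ - - ⟨X, Y, rfl, hd, haX, hbY, hX, hY⟩ u hu w _ hw huw
    rw [Finset.mem_union, not_or] at hw
    rw [Finset.mem_union] at hu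
    rcases hu with hu | hu
    · exact ⟨insert w X, Y, by rw [Finset.insert_union], by simp [hd, hw.2], by simp [haX], hbY,
        hX.insert_vertex hu huw, hY⟩
    · exact ⟨X, insert w Y, by rw [Finset.union_insert], by simp [hd, hw.1], haX, by simp [hbY],
        hX, hY.insert_vertex hu huw⟩

/-- A connected set with at least two elements has a removable vertex other than a given one. -/
theorem Conn.exists_removable {r : Sym2 ℕ → ℕ} {S : Finset ℕ} (hS : Conn r S) {c : ℕ} (hc : c ∈ S)
    (h2 : S ≠ {c}) : ∃ z ∈ S, z ≠ c ∧ Conn r (S.erase z) := by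
  have := hS.grow (S := {c}) (fun A => c ∈ A ∧ Conn r A ∧
    (A ≠ {c} → ∃ z ∈ A, z ≠ c ∧ Conn r (A.erase z))) (by simpa using hc) (by simp)
    ⟨by simp, conn_singleton r c, by simp⟩ (by
      rintro A - - ⟨hcA, hA, -⟩ a ha b _ hb hab
      refine ⟨by simp [hcA], hA.insert_vertex ha hab, fun _ => ⟨b, by simp, ?_, ?_⟩⟩
      · rintro rfl; exact hb hcA
      · rwa [Finset.erase_insert hb])
  exact this.2.2 h2

/-- A model of a triangle rooted at `c` in the realization of `(U, r)`. -/
def Tri (r : Sym2 ℕ → ℕ) (U : Finset ℕ) (c : ℕ) : Prop :=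
  ∃ X Y Z : Set Node, (Cn (realize r).Adj X ∧ Cn (realize r).Adj Y ∧ Cn (realize r).Adj Z) ∧
    (X ⊆ validNodes U r ∧ Y ⊆ validNodes U r ∧ Z ⊆ validNodes U r) ∧ base c ∈ X ∧
    (Disjoint X Y ∧ Disjoint X Z ∧ Disjoint Y Z) ∧
    (∃ x ∈ X, ∃ y ∈ Y, (realize r).Adj x y) ∧ (∃ x ∈ X, ∃ z ∈ Z, (realize r).Adj x z) ∧
    (∃ y ∈ Y, ∃ z ∈ Z, (realize r).Adj y z)

theorem validNodes_mono {r : Sym2 ℕ → ℕ} {U U' : Finset ℕ} (h : U ⊆ U') :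
    validNodes U r ⊆ validNodes U' r := by
  rintro (u | ⟨c, e, n⟩) hu
  · exact h hu
  · exact ⟨fun a ha => h (hu.1 a ha), hu.2⟩

theorem Tri.mono {r : Sym2 ℕ → ℕ} {U U' : Finset ℕ} {c : ℕ} (h : Tri r U c) (hU : U ⊆ U') :
    Tri r U' c := by
  obtain ⟨X, Y, Z, h1, h2, h3⟩ := h
  exact ⟨X, Y, Z, h1, ⟨h2.1.trans (validNodes_mono hU), h2.2.1.trans (validNodes_mono hU),
    h2.2.2.trans (validNodes_mono hU)⟩, h3⟩

theorem base_image_subset {r : Sym2 ℕ → ℕ} {U : Finset ℕ} {X : Finset ℕ} (h : X ⊆ U) :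
    base '' (X : Set ℕ) ⊆ validNodes U r := by
  rintro _ ⟨a, ha, rfl⟩
  exact h ha

theorem valid_ext_loop {r : Sym2 ℕ → ℕ} {U : Finset ℕ} {a n : ℕ} (c : Bool) (ha : a ∈ U)
    (h : n < r s(a, a)) : ext c s(a, a) n ∈ validNodes U r :=
  ⟨by simpa using ha, h, by simp⟩

theorem valid_ext_edge {r : Sym2 ℕ → ℕ} {U : Finset ℕ} {a b n : ℕ} (ha : a ∈ U) (hb : b ∈ U)
    (h : n + 1 < r s(a, b)) : ext false s(a, b) n ∈ validNodes U r :=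
  ⟨by simp [ha, hb], by omega, fun _ => ⟨rfl, h⟩⟩

/-- A connected multigraph with a cycle has a triangle minor rooted at any vertex. -/
theorem Conn.tri {r : Sym2 ℕ → ℕ} {R : Finset ℕ} (hR : Conn r R) {c : ℕ} (hc : c ∈ R)
    (h : 2 * R.card < E2 r R + 2) : Tri r R c := by
  induction hn : R.card generalizing R with
  | zero => simp_all
  | succ n ih =>
    by_cases hloop : ∃ a ∈ R, 0 < r s(a, a)
    · obtain ⟨a, ha, har⟩ := hloop
      refine ⟨base '' (R : Set ℕ), {ext false s(a, a) 0}, {ext true s(a, a) 0},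
        ⟨hR.base, cn_singleton _ _, cn_singleton _ _⟩, ⟨base_image_subset le_rfl,
        Set.singleton_subset_iff.2 (valid_ext_loop _ ha har),
        Set.singleton_subset_iff.2 (valid_ext_loop _ ha har)⟩, ⟨c, hc, rfl⟩, by simp,
        ⟨base a, ⟨a, ha, rfl⟩, _, rfl, by simp⟩, ⟨base a, ⟨a, ha, rfl⟩, _, rfl, by simp⟩,
        ⟨_, rfl, _, rfl, by simp⟩⟩
    push Not at hloop
    have hne : R ≠ {c} := by
      rintro rfl
      have := hloop c (by simp)
      rw [E2_singleton] at h
      simp at h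
      omega
    obtain ⟨z, hz, hzc, hRz⟩ := hR.exists_removable hc hne
    have hE := E2_erase (r := r) hz
    have hl := hloop z hz
    have hw := wt_erase (r := r) (v := z) hz
    have hcard := Finset.card_erase_of_mem hz
    have hcz : c ∈ R.erase z := by simp [hc, hzc.symm]
    by_cases h2 : wt r (R.erase z) z ≤ 1
    · exact (ih hRz hcz (by omega) (by omega)).mono (Finset.erase_subset _ _)
    obtain ⟨a, ha, haz⟩ : ∃ a ∈ R.erase z, 0 < r s(z, a) := by
      by_contra! hcon
      have : wt r (R.erase z) z = 0 := Finset.sum_eq_zero fun j hj => by have := hcon j hj; omega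
      omega
    have haR := (Finset.mem_erase.1 ha)
    by_cases hdbl : 2 ≤ r s(z, a)
    · refine ⟨base '' ((R.erase z : Finset ℕ) : Set ℕ), {base z}, {ext false s(z, a) 0},
        ⟨hRz.base, cn_singleton _ _, cn_singleton _ _⟩,
        ⟨base_image_subset (Finset.erase_subset _ _), Set.singleton_subset_iff.2 hz,
        Set.singleton_subset_iff.2 (valid_ext_edge hz haR.2 (by omega))⟩, ⟨c, hcz, rfl⟩, ?_,
        ⟨base a, ⟨a, ha, rfl⟩, _, rfl, ?_⟩, ⟨base a, ⟨a, ha, rfl⟩, _, rfl, by simp⟩,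
        ⟨_, rfl, _, rfl, by simp⟩⟩
      · simp
      · rw [realize_base_base, Sym2.eq_swap]
        exact ⟨haR.1, haz⟩
    obtain ⟨b, hb, hbz⟩ : ∃ b ∈ (R.erase z).erase a, 0 < r s(z, b) := by
      by_contra! hcon
      have : wt r ((R.erase z).erase a) z = 0 :=
        Finset.sum_eq_zero fun j hj => by have := hcon j hj; omega
      rw [wt_erase ha, this] at h2
      omega
    have key : ∀ a ∈ R.erase z, ∀ b ∈ R.erase z, 0 < r s(z, a) → 0 < r s(z, b) →
        ∀ X Y : Finset ℕ, X ∪ Y = R.erase z → Disjoint X Y → a ∈ X → b ∈ Y → Conn r X →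
        Conn r Y → c ∈ X → Tri r R c := by
      intro a ha b hb haz hbz X Y hXY hd haX hbY hX hY hcX
      have hXR : X ⊆ R.erase z := hXY ▸ Finset.subset_union_left
      have hYR : Y ⊆ R.erase z := hXY ▸ Finset.subset_union_right
      have haz' : a ≠ z := (Finset.mem_erase.1 ha).1
      have hbz' : b ≠ z := (Finset.mem_erase.1 hb).1
      obtain ⟨x, hx, y, hy, hyX, hxy⟩ := hRz.cut hXR ⟨a, haX⟩ (by
        rintro rfl
        exact Finset.disjoint_left.1 hd hb hbY)
      have hyY : y ∈ Y := by
        rw [← hXY, Finset.mem_union] at hy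
        exact hy.resolve_left hyX
      refine ⟨base '' (X : Set ℕ), base '' (Y : Set ℕ), {base z},
        ⟨hX.base, hY.base, cn_singleton _ _⟩,
        ⟨base_image_subset (hXR.trans (Finset.erase_subset _ _)),
        base_image_subset (hYR.trans (Finset.erase_subset _ _)), Set.singleton_subset_iff.2 hz⟩,
        ⟨c, hcX, rfl⟩, ⟨?_, ?_, ?_⟩, ⟨base x, ⟨x, hx, rfl⟩, base y, ⟨y, hyY, rfl⟩, ?_⟩,
        ⟨base a, ⟨a, haX, rfl⟩, _, rfl, ?_⟩, ⟨base b, ⟨b, hbY, rfl⟩, _, rfl, ?_⟩⟩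
      · rw [Set.disjoint_left]
        rintro _ ⟨p, hp, rfl⟩ ⟨q, hq, hpq⟩
        cases hpq
        exact Finset.disjoint_left.1 hd hp hq
      · simpa using fun hzX => by simpa using hXR hzX
      · simpa using fun hzY => by simpa using hYR hzY
      · exact realize_base_base.2 ⟨fun e => hyX (e ▸ hx), hxy⟩
      · exact realize_base_base.2 ⟨haz', Jn.symm haz⟩
      · exact realize_base_base.2 ⟨hbz', Jn.symm hbz⟩
    have hba := Finset.mem_erase.1 hb
    obtain ⟨X, Y, hXY, hd, haX, hbY, hX, hY⟩ := hRz.split ha hba.2 hba.1.symm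
    have hcXY : c ∈ X ∪ Y := hXY ▸ hcz
    rcases Finset.mem_union.1 hcXY with hcX | hcY
    · exact key a ha b hba.2 haz hbz X Y hXY hd haX hbY hX hY hcX
    · exact key b hba.2 a ha hbz haz Y X (by rw [Finset.union_comm, hXY]) hd.symm hbY haX hY hX hcY

/-- Replacing a part of the multigraph attached at `c` and containing a rooted triangle
by a loop at `c`. -/
theorem Has.loop {W : Type} {H : SimpleGraph W} {U R : Finset ℕ} {r : Sym2 ℕ → ℕ} {c : ℕ}
    (hR : R ⊆ U) (ht : Tri r R c)
    (h : Has H (insert c (U \ R)) (Function.update r s(c, c) 1)) : Has H U r := by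
  obtain ⟨X, Y, Z, ⟨hX, hY, hZ⟩, ⟨hXR, hYR, hZR⟩, hcX, ⟨hXY, hXZ, hYZ⟩, aXY, aXZ, aYZ⟩ := ht
  let g : Node → Set Node := fun
      | base u => if u = c then X else {base u}
      | ext k e n => if e = s(c, c) then (if k then Z else Y) else {ext k e n}
  have gb : ∀ u, g (base u) = if u = c then X else {base u} := fun u => rfl
  have ge : ∀ k e n, g (ext k e n) = if e = s(c, c) then (if k then Z else Y) else {ext k e n} :=
    fun k e n => rfl
  have ext_notin : ∀ {k e n}, ext k e n ∈ validNodes (insert c (U \ R)) (Function.update r s(c, c) 1) →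
      e ≠ s(c, c) → ext k e n ∉ validNodes R r := by
    intro k e n hv he hv'
    induction e using Sym2.ind with
    | _ i j =>
      have hi := hv.1 i (by simp)
      have hj := hv.1 j (by simp)
      have hi' := hv'.1 i (by simp)
      have hj' := hv'.1 j (by simp)
      simp [hi'] at hi
      simp [hj'] at hj
      exact he (by rw [hi, hj])
  have base_notin : ∀ {u}, base u ∈ validNodes (insert c (U \ R)) (Function.update r s(c, c) 1) →
      u ≠ c → base u ∉ validNodes R r := by
    intro u hv hu hv'
    have h1 : u ∈ insert c (U \ R) := hv
    have h2 : u ∈ R := hv'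
    simp [hu, h2] at h1
  have hn0 : ∀ {k n}, ext k s(c, c) n ∈ validNodes (insert c (U \ R)) (Function.update r s(c, c) 1) →
      n = 0 := by
    intro k n hv
    have := hv.2.1
    rw [Function.update_self] at this
    omega
  have aXY' : ∀ k, ∃ x ∈ X, ∃ y ∈ (if k = true then Z else Y), (realize r).Adj x y := by
    rintro (_ | _) <;> simpa
  have dX : ∀ k, Disjoint X (if k = true then Z else Y) := by
    rintro (_ | _) <;> simpa
  have sR : ∀ k, (if k = true then Z else Y) ⊆ validNodes R r := by
    rintro (_ | _) <;> simpa
  have swap : ∀ {A B : Set Node}, (∃ a ∈ A, ∃ b ∈ B, (realize r).Adj a b) →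
      ∃ b ∈ B, ∃ a ∈ A, (realize r).Adj b a := fun ⟨a, ha, b, hb, hab⟩ => ⟨b, hb, a, ha, hab.symm⟩
  refine MinorIn.trans h g ?_ ?_ ?_ ?_
  · rintro (u | ⟨k, e, n⟩) hu
    · rw [gb]; split_ifs
      · exact hX
      · exact cn_singleton _ _
    · rw [ge]; split_ifs
      · exact hZ
      · exact hY
      · exact cn_singleton _ _
  · rintro (u | ⟨k, e, n⟩) hu
    · rw [gb]; split_ifs with h1
      · exact hXR.trans (validNodes_mono hR)
      · have h2 : u ∈ insert c (U \ R) := hu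
        simp [h1] at h2
        exact Set.singleton_subset_iff.2 h2.1
    · rw [ge]; split_ifs with h1 h2
      · exact hZR.trans (validNodes_mono hR)
      · exact hYR.trans (validNodes_mono hR)
      · rw [Set.singleton_subset_iff]
        obtain ⟨h3, h4, h5⟩ := hu
        rw [Function.update_of_ne h1] at h4 h5
        refine ⟨fun a ha => ?_, h4, h5⟩
        have := h3 a ha
        rw [Finset.mem_insert, Finset.mem_sdiff] at this
        rcases this with rfl | this
        · have : base a ∈ validNodes R r := hXR hcX
          exact hR this
        · exact this.1
  · have hbe : ∀ u k e n, base u ∈ validNodes (insert c (U \ R)) (Function.update r s(c, c) 1) →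
        ext k e n ∈ validNodes (insert c (U \ R)) (Function.update r s(c, c) 1) →
        Disjoint (g (base u)) (g (ext k e n)) := by
      intro u k e n hu hv
      rw [gb, ge]
      by_cases h1 : u = c <;> by_cases h2 : e = s(c, c) <;> simp only [h1, h2, if_true, if_false]
      · exact dX k
      · rw [Set.disjoint_singleton_right]
        exact fun hx => ext_notin hv h2 (hXR hx)
      · rw [Set.disjoint_singleton_left]
        exact fun hx => base_notin hu h1 (sR k hx)
      · simp
    rintro (u | ⟨k, e, n⟩) hu (u' | ⟨k', e', n'⟩) hu' hne
    · rw [gb, gb]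
      by_cases h1 : u = c <;> by_cases h2 : u' = c <;> simp only [h1, h2, if_true, if_false]
      · exact absurd (by rw [h1, h2]) hne
      · rw [Set.disjoint_singleton_right]
        exact fun hx => base_notin hu' h2 (hXR hx)
      · rw [Set.disjoint_singleton_left]
        exact fun hx => base_notin hu h1 (hXR hx)
      · simpa using hne
    · exact hbe u k' e' n' hu hu'
    · exact (hbe u' k e n hu' hu).symm
    · rw [ge, ge]
      by_cases h1 : e = s(c, c) <;> by_cases h2 : e' = s(c, c) <;>
        simp only [h1, h2, if_true, if_false]
      · subst h1 h2
        have := hn0 hu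
        have := hn0 hu'
        subst_vars
        cases k <;> cases k' <;> simp at hne ⊢
        · exact hYZ
        · exact hYZ.symm
      · rw [Set.disjoint_singleton_right]
        exact fun hx => ext_notin hu' h2 (sR k hx)
      · rw [Set.disjoint_singleton_left]
        exact fun hx => ext_notin hu h1 (sR k' hx)
      · simpa using hne
  · have hbb : ∀ u u', u ≠ u' → 0 < r s(u, u') → ∃ a ∈ g (base u), ∃ b ∈ g (base u'),
        (realize r).Adj a b := by
      intro u u' hne hr
      refine ⟨base u, ?_, base u', ?_, realize_base_base.2 ⟨hne, hr⟩⟩ <;> rw [gb] <;>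
        split_ifs with h1
      · rwa [h1]
      · rfl
      · rwa [h1]
      · rfl
    have hbe : ∀ u k e n, u ∈ e → ∃ a ∈ g (base u), ∃ b ∈ g (ext k e n), (realize r).Adj a b := by
      intro u k e n hue
      rw [gb, ge]
      by_cases h2 : e = s(c, c)
      · have h1 : u = c := by simpa [h2] using hue
        simp only [h1, h2, if_true]
        exact aXY' k
      · simp only [h2, if_false]
        refine ⟨base u, ?_, _, rfl, realize_base_ext.2 hue⟩
        split_ifs with h1
        · rwa [h1]
        · rfl
    rintro (u | ⟨k, e, n⟩) hu (u' | ⟨k', e', n'⟩) hu' hadj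
    · rw [realize_base_base] at hadj
      refine hbb u u' hadj.1 ?_
      have : s(u, u') ≠ s(c, c) := by
        rw [Ne, Sym2.eq_iff]; have := hadj.1; grind
      rw [Function.update_of_ne this] at hadj
      exact hadj.2
    · rw [realize_base_ext] at hadj
      exact hbe u k' e' n' hadj
    · rw [realize_ext_base] at hadj
      exact swap (hbe u' k e n hadj)
    · rw [realize_ext_ext] at hadj
      obtain ⟨hk, rfl, rfl⟩ := hadj
      rw [ge, ge]
      by_cases h1 : e = s(c, c)
      · simp only [h1, if_true]
        cases k <;> cases k' <;> simp at hk ⊢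
        · exact aYZ
        · exact swap aYZ
      · simp only [h1, if_false]
        exact ⟨_, rfl, _, rfl, realize_ext_ext.2 ⟨hk, rfl, rfl⟩⟩

/-- The diamond. -/
def diamond : SimpleGraph (Fin 4) := mkGraph 4 [(0,1),(0,2),(0,3),(1,2),(1,3)]

/-- The butterfly. -/
def butterfly : SimpleGraph (Fin 5) := mkGraph 5 [(0,1),(0,2),(1,2),(0,3),(0,4),(3,4)]

theorem minorIn_mkGraph {V : Type} {n : ℕ} {E : List (ℕ × ℕ)} {G : SimpleGraph V} {s : Set V}
    (f : Fin n → Set V) (hc : ∀ w, Cn G.Adj (f w)) (hs : ∀ w, f w ⊆ s)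
    (hd : ∀ w w', w < w' → Disjoint (f w) (f w'))
    (ha : ∀ w w' : Fin n, ((w : ℕ), (w' : ℕ)) ∈ E → ∃ a ∈ f w, ∃ b ∈ f w', G.Adj a b) :
    MinorIn (mkGraph n E) G s := by
  refine ⟨f, hc, hs, fun w w' h => ?_, fun w w' h => ?_⟩
  · rcases lt_or_gt_of_ne h with h | h
    · exact hd _ _ h
    · exact (hd _ _ h).symm
  · rw [mkGraph, SimpleGraph.fromRel_adj] at h
    rcases h.2 with h | h
    · exact ha _ _ h
    · obtain ⟨a, h1, b, h2, h3⟩ := ha _ _ h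
      exact ⟨b, h2, a, h1, h3.symm⟩

/-- Two petals at a connected center give a butterfly. -/
theorem butterfly_of_bags {V : Type} {G : SimpleGraph V} {s : Set V} {C X Y P Q : Set V}
    (hc : Cn G.Adj C ∧ Cn G.Adj X ∧ Cn G.Adj Y ∧ Cn G.Adj P ∧ Cn G.Adj Q)
    (hs : C ⊆ s ∧ X ⊆ s ∧ Y ⊆ s ∧ P ⊆ s ∧ Q ⊆ s)
    (hd : (Disjoint C X ∧ Disjoint C Y ∧ Disjoint C P ∧ Disjoint C Q) ∧
      (Disjoint X Y ∧ Disjoint X P ∧ Disjoint X Q) ∧ (Disjoint Y P ∧ Disjoint Y Q) ∧ Disjoint P Q)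
    (h1 : ∃ a ∈ C, ∃ b ∈ X, G.Adj a b) (h2 : ∃ a ∈ C, ∃ b ∈ Y, G.Adj a b)
    (h3 : ∃ a ∈ X, ∃ b ∈ Y, G.Adj a b) (h4 : ∃ a ∈ C, ∃ b ∈ P, G.Adj a b)
    (h5 : ∃ a ∈ C, ∃ b ∈ Q, G.Adj a b) (h6 : ∃ a ∈ P, ∃ b ∈ Q, G.Adj a b) :
    MinorIn butterfly G s := by
  refine minorIn_mkGraph ![C, X, Y, P, Q] ?_ ?_ ?_ ?_
  · simpa [Fin.forall_fin_succ] using hc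
  · simpa [Fin.forall_fin_succ] using hs
  · intro w w' h
    obtain ⟨⟨a1, a2, a3, a4⟩, ⟨a5, a6, a7⟩, ⟨a8, a9⟩, a10⟩ := hd
    fin_cases w <;> fin_cases w' <;> simp at h ⊢ <;> assumption
  · intro w w' h
    fin_cases w <;> fin_cases w' <;> simp at h ⊢ <;> assumption

theorem Tri.butterfly {r r' : Sym2 ℕ → ℕ} {R S : Finset ℕ} {c : ℕ} (h : Tri r' R c)
    (hr : ∀ e, r' e ≤ r e) (hRS : R ⊆ S) {p q : Node} (hp : p ∈ validNodes S r)
    (hq : q ∈ validNodes S r) (hp' : p ∉ validNodes R r') (hq' : q ∉ validNodes R r')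
    (hcp : (realize r).Adj (base c) p) (hcq : (realize r).Adj (base c) q)
    (hpq : (realize r).Adj p q) : MinorIn butterfly (realize r) (validNodes S r) := by
  obtain ⟨X, Y, Z, ⟨hX, hY, hZ⟩, ⟨hXR, hYR, hZR⟩, hcX, ⟨hXY, hXZ, hYZ⟩, aXY, aXZ, aYZ⟩ := h
  have le : ∀ a b, (realize r').Adj a b → (realize r).Adj a b := by
    rintro (a | ⟨k, e, n⟩) (b | ⟨k', e', n'⟩) h
    · rw [realize_base_base] at h ⊢
      exact ⟨h.1, lt_of_lt_of_le h.2 (hr _)⟩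
    · simpa using h
    · simpa using h
    · simpa using h
  have lv : validNodes R r' ⊆ validNodes S r := by
    rintro (u | ⟨k, e, n⟩) hu
    · exact hRS hu
    · exact ⟨fun a ha => hRS (hu.1 a ha), lt_of_lt_of_le hu.2.1 (hr _), fun hd =>
        ⟨(hu.2.2 hd).1, lt_of_lt_of_le (hu.2.2 hd).2 (hr _)⟩⟩
  have lc : ∀ {A}, Cn (realize r').Adj A → Cn (realize r).Adj A :=
    fun h => h.mono fun a _ b _ => le a b
  have la : ∀ {A B : Set Node}, (∃ a ∈ A, ∃ b ∈ B, (realize r').Adj a b) →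
      ∃ a ∈ A, ∃ b ∈ B, (realize r).Adj a b :=
    fun ⟨a, ha, b, hb, hab⟩ => ⟨a, ha, b, hb, le _ _ hab⟩
  refine butterfly_of_bags (C := X) (X := Y) (Y := Z) (P := {p}) (Q := {q})
    ⟨lc hX, lc hY, lc hZ, cn_singleton _ _, cn_singleton _ _⟩
    ⟨hXR.trans lv, hYR.trans lv, hZR.trans lv, by simpa, by simpa⟩ ⟨⟨hXY, hXZ, ?_, ?_⟩,
    ⟨hYZ, ?_, ?_⟩, ⟨?_, ?_⟩, by simpa using hpq.ne⟩ (la aXY) (la aXZ) (la aYZ)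
    ⟨_, hcX, p, rfl, hcp⟩ ⟨_, hcX, q, rfl, hcq⟩ ⟨p, rfl, q, rfl, hpq⟩ <;>
    rw [Set.disjoint_singleton_right]
  · exact fun h => hp' (hXR h)
  · exact fun h => hq' (hXR h)
  · exact fun h => hp' (hYR h)
  · exact fun h => hq' (hYR h)
  · exact fun h => hp' (hZR h)
  · exact fun h => hq' (hZR h)

theorem E2_update_loop {r : Sym2 ℕ → ℕ} {S : Finset ℕ} {z : ℕ} (hz : z ∈ S) (m : ℕ) :
    E2 (Function.update r s(z, z) m) S + 2 * r s(z, z) = E2 r S + 2 * m := by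
  have h : ∀ i j, i ≠ z → s(i, j) ≠ s(z, z) := by
    intro i j hi h
    rw [Sym2.eq_iff] at h
    grind
  have h1 : E2 (Function.update r s(z, z) m) (S.erase z) = E2 r (S.erase z) :=
    E2_congr fun i hi j _ => Function.update_of_ne (h i j (Finset.ne_of_mem_erase hi)) _ _
  have h2 : wt (Function.update r s(z, z) m) (S.erase z) z = wt r (S.erase z) z :=
    Finset.sum_congr rfl fun i hi => by
      have := Finset.ne_of_mem_erase hi
      exact Function.update_of_ne (by rw [Ne, Sym2.eq_iff]; grind) _ _
  rw [E2_erase hz, E2_erase hz, wt_erase hz, wt_erase hz, h1, h2, Function.update_self]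
  ring

theorem E2_update_edge {r : Sym2 ℕ → ℕ} {S : Finset ℕ} {y z : ℕ} (hy : y ∈ S) (hz : z ∈ S)
    (hyz : y ≠ z) (m : ℕ) :
    E2 (Function.update r s(y, z) m) S + 2 * r s(y, z) = E2 r S + 2 * m := by
  have h1 : E2 (Function.update r s(y, z) m) (S.erase z) = E2 r (S.erase z) :=
    E2_congr fun i hi j hj => Function.update_of_ne (by
      have := Finset.ne_of_mem_erase hi
      have := Finset.ne_of_mem_erase hj
      rw [Ne, Sym2.eq_iff]; grind) _ _
  have h2 : wt (Function.update r s(y, z) m) (S.erase y) z = wt r (S.erase y) z :=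
    Finset.sum_congr rfl fun i hi => Function.update_of_ne (by
      have := Finset.ne_of_mem_erase hi
      rw [Ne, Sym2.eq_iff]; grind) _ _
  rw [E2_erase hz, E2_erase hz, wt_erase hy, wt_erase hy, h1, h2, Sym2.eq_swap (a := z),
    Function.update_self]
  ring

theorem has_diamond_of_triple {r : Sym2 ℕ → ℕ} {S : Finset ℕ} {z a : ℕ} (hz : z ∈ S) (ha : a ∈ S)
    (hza : z ≠ a) (h : 3 ≤ r s(z, a)) : Has diamond S r := by
  have h0 := valid_ext_edge (r := r) (n := 0) hz ha (by omega)
  have h1 := valid_ext_edge (r := r) (n := 1) hz ha (by omega)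
  have hzv : base z ∈ validNodes S r := hz
  have hav : base a ∈ validNodes S r := ha
  refine MinorIn.of_hom ![base z, base a, ext false s(z, a) 0, ext false s(z, a) 1] ?_ ?_ ?_
  · intro i j hij
    have hza' := hza.symm
    fin_cases i <;> fin_cases j <;> first | rfl | (exact absurd hij (by simp [hza, hza']))
  · simp [Fin.forall_fin_succ, h0, h1, hzv, hav]
  · intro i j hij
    fin_cases i <;> fin_cases j <;> simp [diamond, mkGraph] at hij ⊢ <;>
      first | exact ⟨hza, by omega⟩ | exact ⟨hza.symm, by rw [Sym2.eq_swap]; omega⟩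

theorem Conn.diamond_or_butterfly {r : Sym2 ℕ → ℕ} {S : Finset ℕ} (hS : Conn r S)
    (h : 2 * S.card < E2 r S) : Has diamond S r ∨ Has butterfly S r := by
  induction hn : S.card + E2 r S using Nat.strong_induction_on generalizing S r with
  | _ n ih =>
  subst hn
  by_cases hloop : ∃ z ∈ S, 0 < r s(z, z)
  · obtain ⟨z, hz, hr⟩ := hloop
    right
    have hE := E2_update_loop (r := r) hz (r s(z, z) - 1)
    have hc : Conn (Function.update r s(z, z) (r s(z, z) - 1)) S := by
      refine conn_of_cut ⟨z, hz⟩ fun A hA hne hn => ?_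
      obtain ⟨a, ha, b, hb, hbA, hab⟩ := hS.cut hA hne hn
      refine ⟨a, ha, b, hb, hbA, ?_⟩
      rw [Jn, Function.update_of_ne]
      · exact hab
      · rw [Ne, Sym2.eq_iff]; grind
    have hnot : ∀ k, ext k s(z, z) (r s(z, z) - 1) ∉
        validNodes S (Function.update r s(z, z) (r s(z, z) - 1)) := by
      intro k hk
      have := hk.2.1
      simp at this
    refine (hc.tri hz (by omega)).butterfly (fun e => ?_) le_rfl
      (p := ext false s(z, z) (r s(z, z) - 1)) (q := ext true s(z, z) (r s(z, z) - 1))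
      (valid_ext_loop _ hz (by omega)) (valid_ext_loop _ hz (by omega)) (hnot _) (hnot _)
      (by simp) (by simp) (by simp)
    by_cases he : e = s(z, z)
    · subst he; simp
    · rw [Function.update_of_ne he]
  push Not at hloop
  -- reduction at a removable vertex of small weight
  have low : ∀ z ∈ S, Conn r (S.erase z) → wt r (S.erase z) z ≤ 2 →
      Has diamond S r ∨ Has butterfly S r := by
    intro z hz hc hw
    have hE := E2_erase (r := r) hz
    have hw' := wt_erase (r := r) (v := z) hz
    have hl := hloop z hz
    have hcard := Finset.card_erase_of_mem hz
    have hpos := Finset.card_pos.2 ⟨z, hz⟩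
    by_cases hw1 : wt r (S.erase z) z ≤ 1
    · exact (ih _ (by omega) hc (by omega) rfl).imp
        (fun h => h.mono (Finset.erase_subset _ _) fun _ _ _ _ => le_rfl)
        (fun h => h.mono (Finset.erase_subset _ _) fun _ _ _ _ => le_rfl)
    obtain ⟨a, ha, haz⟩ : ∃ a ∈ S.erase z, 0 < r s(z, a) := by
      by_contra! hcon
      have : wt r (S.erase z) z = 0 := Finset.sum_eq_zero fun j hj => by have := hcon j hj; omega
      omega
    have haS := Finset.mem_erase.1 ha
    by_cases hdbl : 2 ≤ r s(z, a)
    · right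
      refine (hc.tri ha (by omega)).butterfly (fun _ => le_rfl) (Finset.erase_subset _ _)
        (p := base z) (q := ext false s(z, a) 0) hz (valid_ext_edge hz haS.2 (by omega)) ?_ ?_
        ?_ (by simp) (by simp)
      · intro h
        have : z ∈ S.erase z := h
        simp at this
      · intro h
        have := h.1 z (by simp)
        simp at this
      · rw [realize_base_base, Sym2.eq_swap]
        exact ⟨haS.1, haz⟩
    obtain ⟨b, hb, hbz⟩ : ∃ b ∈ (S.erase z).erase a, 0 < r s(z, b) := by
      by_contra! hcon
      have : wt r ((S.erase z).erase a) z = 0 :=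
        Finset.sum_eq_zero fun j hj => by have := hcon j hj; omega
      rw [wt_erase ha, this] at hw1
      omega
    have hba := Finset.mem_erase.1 hb
    have hbS := Finset.mem_erase.1 hba.2
    have hE' := E2_update_edge (r := r) ha hba.2 hba.1.symm (r s(a, b) + 1)
    have hc' : Conn (Function.update r s(a, b) (r s(a, b) + 1)) (S.erase z) :=
      hc.mono fun x _ y _ hxy => by
        by_cases he : s(x, y) = s(a, b)
        · rw [Jn, he, Function.update_self]; omega
        · rwa [Jn, Function.update_of_ne he]
    exact (ih _ (by omega) hc' (by omega) rfl).imp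
      (Has.suppress hz haS.2 hbS.2 haz hbz hba.1.symm haS.1 hbS.1)
      (Has.suppress hz haS.2 hbS.2 haz hbz hba.1.symm haS.1 hbS.1)
  obtain ⟨c, hc⟩ := hS.nonempty
  have hne : ∀ c, S ≠ {c} := by
    rintro c rfl
    have := hloop c (by simp)
    rw [E2_singleton] at h
    omega
  obtain ⟨z, hz, -, hSz⟩ := hS.exists_removable hc (hne c)
  have hE := E2_erase (r := r) hz
  have hw' := wt_erase (r := r) (v := z) hz
  have hl := hloop z hz
  have hcard := Finset.card_erase_of_mem hz
  have hpos := Finset.card_pos.2 ⟨z, hz⟩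
  by_cases hw : wt r (S.erase z) z ≤ 2
  · exact low z hz hSz hw
  obtain ⟨a, ha, haz⟩ : ∃ a ∈ S.erase z, 0 < r s(z, a) := by
    by_contra! hcon
    have : wt r (S.erase z) z = 0 := Finset.sum_eq_zero fun j hj => by have := hcon j hj; omega
    omega
  have haS := Finset.mem_erase.1 ha
  by_cases hbig : 2 * S.card + 2 < E2 r S
  · have hE' := E2_update_edge (r := r) hz haS.2 haS.1.symm (r s(z, a) - 1)
    have hle : ∀ i j, Function.update r s(z, a) (r s(z, a) - 1) s(i, j) ≤ r s(i, j) := by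
      intro i j
      by_cases he : s(i, j) = s(z, a)
      · rw [he]; simp
      · rw [Function.update_of_ne he]
    have hw2 : ∃ b ∈ S.erase z, 0 < Function.update r s(z, a) (r s(z, a) - 1) s(z, b) := by
      by_cases hdbl : 2 ≤ r s(z, a)
      · exact ⟨a, ha, by rw [Function.update_self]; omega⟩
      by_contra! hcon
      have : wt r ((S.erase z).erase a) z = 0 :=
        Finset.sum_eq_zero fun j hj => by
          have hj' := Finset.mem_erase.1 hj
          have := hcon j hj'.2
          rw [Function.update_of_ne] at this
          · omega
          · rw [Ne, Sym2.eq_iff]; grind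
      rw [wt_erase ha, this] at hw
      omega
    obtain ⟨b, hb, hbz⟩ := hw2
    have hc1 : Conn (Function.update r s(z, a) (r s(z, a) - 1)) (S.erase z) :=
      hSz.mono fun x hx y hy hxy => by
        rwa [Jn, Function.update_of_ne]
        have h1 := Finset.ne_of_mem_erase hx
        have h2 := Finset.ne_of_mem_erase hy
        rw [Ne, Sym2.eq_iff]; grind
    have hc2 := hc1.insert_vertex hb (Jn.symm hbz)
    rw [Finset.insert_erase hz] at hc2
    exact (ih _ (by omega) hc2 (by omega) rfl).imp
      (fun h => h.mono le_rfl fun i _ j _ => hle i j)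
      (fun h => h.mono le_rfl fun i _ j _ => hle i j)
  have htree := hSz.le_excess
  have hw3 : wt r (S.erase z) z = 3 := by omega
  by_cases hone : S.erase z = {a}
  · left
    have h3 : r s(z, a) = 3 := by
      rw [hone] at hw3
      simpa [wt] using hw3
    exact has_diamond_of_triple hz haS.2 haS.1.symm h3.ge
  obtain ⟨l₁, hl₁, -, hc₁⟩ := hSz.exists_removable ha hone
  have hone₁ : S.erase z ≠ {l₁} := by
    intro he
    rw [he] at hc₁
    simpa using hc₁.nonempty
  obtain ⟨l₂, hl₂, hl₁₂, hc₂⟩ := hSz.exists_removable hl₁ hone₁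
  have leaf : ∀ l ∈ S.erase z, Conn r ((S.erase z).erase l) → r s(z, l) ≤ 1 →
      Has diamond S r ∨ Has butterfly S r := by
    intro l hlS hcl hrl
    have hlS' := Finset.mem_erase.1 hlS
    have hEl := E2_erase (r := r) hlS
    have hll := wt_erase (r := r) (v := l) hlS
    have hl0 := hloop l hlS'.2
    have hcard' := Finset.card_erase_of_mem hlS
    have hpos' := Finset.card_pos.2 ⟨l, hlS⟩
    have := hcl.le_excess
    have hzl : z ∈ S.erase l := Finset.mem_erase.2 ⟨hlS'.1.symm, hz⟩
    refine low l hlS'.2 ?_ ?_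
    · obtain ⟨b, hb, hbz⟩ : ∃ b ∈ (S.erase z).erase l, 0 < r s(z, b) := by
        by_contra! hcon
        have : wt r ((S.erase z).erase l) z = 0 :=
          Finset.sum_eq_zero fun j hj => by have := hcon j hj; omega
        rw [wt_erase hlS, this] at hw3
        omega
      have := hcl.insert_vertex hb (Jn.symm hbz)
      rwa [Finset.erase_right_comm, Finset.insert_erase hzl] at this
    · rw [wt_erase hzl, Finset.erase_right_comm, Sym2.eq_swap]
      omega
  by_cases h1 : r s(z, l₁) ≤ 1
  · exact leaf l₁ hl₁ hc₁ h1
  · refine leaf l₂ hl₂ hc₂ ?_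
    have h2 := wt_erase (r := r) (v := z) hl₁
    have h3 : r s(z, l₂) ≤ wt r ((S.erase z).erase l₁) z :=
      le_wt (Finset.mem_erase.2 ⟨hl₁₂, hl₂⟩)
    omega

theorem MinorIn.append {V : Type} {m n : ℕ} {E F : List (ℕ × ℕ)} {G : SimpleGraph V}
    {s t u : Set V} (h : MinorIn (mkGraph m E) G s) (h' : MinorIn (mkGraph n F) G t)
    (hst : Disjoint s t) (hu : s ∪ t ⊆ u) (hE : ∀ p ∈ E, p.1 < m ∧ p.2 < m) :
    MinorIn (mkGraph (m + n) (E ++ F.map fun p => (m + p.1, m + p.2))) G u := by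
  obtain ⟨f, f1, f2, f3, f4⟩ := h
  obtain ⟨g, g1, g2, g3, g4⟩ := h'
  have hd : ∀ i j, Disjoint (f i) (g j) := fun i j => Set.disjoint_of_subset (f2 i) (g2 j) hst
  refine ⟨Fin.append f g, fun w => ?_, fun w => ?_, fun w w' hw => ?_, fun w w' hw => ?_⟩
  · refine Fin.addCases (fun i => ?_) (fun i => ?_) w <;> simp [f1, g1]
  · refine Fin.addCases (fun i => ?_) (fun i => ?_) w <;> simp only [Fin.append_left,
      Fin.append_right]
    · exact (f2 i).trans (Set.subset_union_left.trans hu)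
    · exact (g2 i).trans (Set.subset_union_right.trans hu)
  · induction w using Fin.addCases with
    | left i =>
      induction w' using Fin.addCases with
      | left j =>
        simp only [Fin.append_left]
        exact f3 fun e => hw (by rw [e])
      | right j =>
        simp only [Fin.append_left, Fin.append_right]
        exact hd i j
    | right i =>
      induction w' using Fin.addCases with
      | left j =>
        simp only [Fin.append_left, Fin.append_right]
        exact (hd j i).symm
      | right j =>
        simp only [Fin.append_right]
        exact g3 fun e => hw (by rw [e])
  · rw [mkGraph, SimpleGraph.fromRel_adj] at hw
    simp only [List.mem_append, List.mem_map, Prod.mk.injEq, Prod.exists] at hw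
    induction w using Fin.addCases with
    | left i =>
      induction w' using Fin.addCases with
      | left j =>
        simp only [Fin.append_left]
        refine f4 ?_
        rw [mkGraph, SimpleGraph.fromRel_adj]
        refine ⟨fun e => hw.1 (by rw [e]), hw.2.imp ?_ ?_⟩ <;>
        · rintro (h | ⟨a, b, -, h1, h2⟩)
          · simpa using h
          · simp at h1; omega
      | right j =>
        exfalso
        rcases hw.2 with (h | ⟨a, b, -, h1, h2⟩) | (h | ⟨a, b, -, h1, h2⟩)
        · have := (hE _ h).2; simp at this
        · simp at h1; omega
        · have := (hE _ h).1; simp at this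
        · simp at h2; omega
    | right i =>
      induction w' using Fin.addCases with
      | left j =>
        exfalso
        rcases hw.2 with (h | ⟨a, b, -, h1, h2⟩) | (h | ⟨a, b, -, h1, h2⟩)
        · have := (hE _ h).1; simp at this
        · simp at h2; omega
        · have := (hE _ h).2; simp at this
        · simp at h1; omega
      | right j =>
        simp only [Fin.append_right]
        refine g4 ?_
        rw [mkGraph, SimpleGraph.fromRel_adj]
        refine ⟨fun e => hw.1 (by rw [e]), hw.2.imp ?_ ?_⟩
        · rintro (h | ⟨a, b, h, h1, h2⟩)
          · have := (hE _ h).1; simp at this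
          · simp at h1 h2; rwa [← h1, ← h2]
        · rintro (h | ⟨a, b, h, h1, h2⟩)
          · have := (hE _ h).1; simp at this
          · simp at h1 h2; rwa [← h1, ← h2]

theorem disjoint_validNodes {r : Sym2 ℕ → ℕ} {S T : Finset ℕ} (h : Disjoint S T) :
    Disjoint (validNodes S r) (validNodes T r) := by
  rw [Set.disjoint_left]
  rintro (u | ⟨k, e, n⟩) hu hu'
  · exact Finset.disjoint_left.1 h hu hu'
  · induction e using Sym2.ind with
    | _ i j => exact Finset.disjoint_left.1 h (hu.1 i (by simp)) (hu'.1 i (by simp))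

/-- One of the listed obstructions is a minor of the realization of `(U, r)`. -/
def HasO (U : Finset ℕ) (r : Sym2 ℕ → ℕ) : Prop := ∃ p ∈ OList, Has p.2 U r

theorem hasO_of_disjoint {r : Sym2 ℕ → ℕ} {U S T : Finset ℕ} (hS : Bic r S) (hT : Bic r T)
    (hSU : S ⊆ U) (hTU : T ⊆ U) (h : Disjoint S T) : HasO U r := by
  have hd := disjoint_validNodes (r := r) h
  have hu : validNodes S r ∪ validNodes T r ⊆ validNodes U r :=
    Set.union_subset (validNodes_mono hSU) (validNodes_mono hTU)
  have hu' : validNodes T r ∪ validNodes S r ⊆ validNodes U r := by rwa [Set.union_comm]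
  rcases hS.1.diamond_or_butterfly hS.2 with h1 | h1 <;>
    rcases hT.1.diamond_or_butterfly hT.2 with h2 | h2
  · exact ⟨⟨8, O1⟩, by simp [OList], MinorIn.append h1 h2 hd hu (by decide)⟩
  · exact ⟨⟨9, O3⟩, by simp [OList], MinorIn.append h1 h2 hd hu (by decide)⟩
  · exact ⟨⟨9, O3⟩, by simp [OList], MinorIn.append h2 h1 hd.symm hu' (by decide)⟩
  · exact ⟨⟨10, O2⟩, by simp [OList], MinorIn.append h1 h2 hd hu (by decide)⟩

/-- A smallest multigraph violating the apex condition without any of the listed minors. -/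
structure Crit (U : Finset ℕ) (r : Sym2 ℕ → ℕ) : Prop where
  nonP : NonP U r
  not_hasO : ¬ HasO U r
  minimal : ∀ U' r', U'.card + E2 r' U' < U.card + E2 r U → NonP U' r' → HasO U' r'

theorem exists_crit {U : Finset ℕ} {r : Sym2 ℕ → ℕ} (h : NonP U r) (hO : ¬ HasO U r) :
    ∃ U' r', Crit U' r' := by
  induction hn : U.card + E2 r U using Nat.strong_induction_on generalizing U r with
  | _ n ih =>
  subst hn
  by_cases hmin : ∀ U' r', U'.card + E2 r' U' < U.card + E2 r U → NonP U' r' → HasO U' r'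
  · exact ⟨U, r, h, hO, hmin⟩
  · push Not at hmin
    obtain ⟨U', r', h1, h2, h3⟩ := hmin
    exact ih _ h1 h2 h3 rfl

theorem Crit.reduce {U U' : Finset ℕ} {r r' : Sym2 ℕ → ℕ} (h : Crit U r)
    (hlt : U'.card + E2 r' U' < U.card + E2 r U) (hn : NonP U' r')
    (hh : ∀ (n : ℕ) (H : SimpleGraph (Fin n)), Has H U' r' → Has H U r) : False := by
  obtain ⟨p, hp, hp'⟩ := h.minimal U' r' hlt hn
  exact h.not_hasO ⟨p, hp, hh _ _ hp'⟩

theorem Crit.inter {U S T : Finset ℕ} {r : Sym2 ℕ → ℕ} (h : Crit U r) (hS : Bic r S)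
    (hT : Bic r T) (hSU : S ⊆ U) (hTU : T ⊆ U) : ∃ x ∈ S, x ∈ T := by
  by_contra! hc
  exact h.not_hasO (hasO_of_disjoint hS hT hSU hTU (Finset.disjoint_left.2 hc))

/-- A maximal connected subset containing a given one. -/
theorem exists_component (r : Sym2 ℕ → ℕ) {W S : Finset ℕ} (hS : Conn r S) (hSW : S ⊆ W) :
    ∃ C, S ⊆ C ∧ C ⊆ W ∧ Conn r C ∧ ∀ a ∈ C, ∀ b ∈ W, b ∉ C → ¬ Jn r a b := by
  classical
  obtain ⟨C, hC, hmax⟩ := (W.powerset.filter fun C => S ⊆ C ∧ Conn r C).exists_max_image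
    Finset.card ⟨S, by simp [hS, hSW]⟩
  simp only [Finset.mem_filter, Finset.mem_powerset] at hC hmax
  refine ⟨C, hC.2.1, hC.1, hC.2.2, fun a ha b hb hbC hab => ?_⟩
  have := hmax (insert b C) ⟨Finset.insert_subset hb hC.1,
    hC.2.1.trans (Finset.subset_insert _ _), hC.2.2.insert_vertex ha hab⟩
  rw [Finset.card_insert_of_notMem hbC] at this
  omega

theorem Crit.conn {U : Finset ℕ} {r : Sym2 ℕ → ℕ} (h : Crit U r) : Conn r U := by
  obtain ⟨v, hv⟩ := h.nonP.1
  obtain ⟨S, hSU, hvS, hS⟩ := h.nonP.2 v hv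
  obtain ⟨C, hSC, hCU, hC, hmax⟩ := exists_component r hS.1 hSU
  by_cases hCe : C = U
  · rwa [← hCe]
  exfalso
  have hss : C ⊂ U := hCU.ssubset_of_ne hCe
  refine h.reduce (U' := C) (r' := r) ?_ ?_ fun n H hH => hH.mono hCU fun _ _ _ _ => le_rfl
  · have := Finset.card_lt_card hss
    have := E2_mono (r := r) hCU
    omega
  · refine ⟨hC.nonempty, fun u hu => ?_⟩
    obtain ⟨T, hTU, huT, hT⟩ := h.nonP.2 u (hCU hu)
    refine ⟨T, ?_, huT, hT⟩
    obtain ⟨x, hxS, hxT⟩ := h.inter hS hT hSU hTU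
    by_contra hTC
    obtain ⟨a, ha, b, hb, hbn, hab⟩ := hT.1.cut (A := T ∩ C) Finset.inter_subset_left
      ⟨x, by simp [hxT, hSC hxS]⟩ (fun e => hTC (Finset.inter_eq_left.1 e))
    simp only [Finset.mem_inter] at ha hbn
    exact hmax a ha.2 b (hTU hb) (fun hbC => hbn ⟨hb, hbC⟩) hab

theorem even_E2 (r : Sym2 ℕ → ℕ) (S : Finset ℕ) : Even (E2 r S) := by
  induction S using Finset.induction_on with
  | empty => simp [E2]
  | insert a s h ih =>
    rw [E2_insert h]
    exact ih.add (even_two_mul _)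

theorem E2_attach {r : Sym2 ℕ → ℕ} {D R : Finset ℕ} {c : ℕ} (hd : Disjoint D R) (hc : c ∈ R)
    (h : ∀ a ∈ D, ∀ b ∈ R, b ≠ c → r s(a, b) = 0) :
    E2 r (D ∪ R) + 2 * r s(c, c) = E2 r (insert c D) + E2 r R := by
  have h1 : ∑ a ∈ D, ∑ b ∈ R, r s(a, b) = wt r D c := by
    refine Finset.sum_congr rfl fun a ha => ?_
    rw [Finset.sum_eq_single_of_mem c hc fun b hb hbc => h a ha b hb hbc, Sym2.eq_swap]
  rw [E2_union hd, E2_insert (fun hcD => Finset.disjoint_left.1 hd hcD hc), h1]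
  ring

theorem Conn.congr {r r' : Sym2 ℕ → ℕ} {S : Finset ℕ} (h : Conn r S)
    (hr : ∀ a ∈ S, ∀ b ∈ S, a ≠ b → 0 < r s(a, b) → 0 < r' s(a, b)) : Conn r' S := by
  refine conn_of_cut h.nonempty fun A hA hne hn => ?_
  obtain ⟨a, ha, b, hb, hbA, hab⟩ := h.cut hA hne hn
  exact ⟨a, ha, b, hb, hbA, hr a (hA ha) b hb (by rintro rfl; exact hbA ha) hab⟩

theorem Bic.congr {r r' : Sym2 ℕ → ℕ} {S : Finset ℕ} (h : Bic r S)
    (hr : ∀ a ∈ S, ∀ b ∈ S, r s(a, b) = r' s(a, b)) : Bic r' S :=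
  ⟨h.1.congr fun a ha b hb _ hab => by rwa [← hr a ha b hb], by rw [← E2_congr hr]; exact h.2⟩

theorem Crit.conn_erase {U : Finset ℕ} {r : Sym2 ℕ → ℕ} (h : Crit U r) {c : ℕ} (hc : c ∈ U) :
    Conn r (U.erase c) := by
  obtain ⟨S, hSU, hcS, hS⟩ := h.nonP.2 c hc
  obtain ⟨C, hSC, hCU, hC, hmax⟩ := exists_component r hS.1 (W := U.erase c)
    fun x hx => Finset.mem_erase.2 ⟨fun e => hcS (e ▸ hx), hSU hx⟩
  by_cases hCe : C = U.erase c
  · rwa [← hCe]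
  exfalso
  have hcC : c ∉ C := fun hcC => by simpa using hCU hcC
  have hCU' : C ⊆ U := hCU.trans (Finset.erase_subset _ _)
  obtain ⟨b, hb, hbC⟩ : ∃ b ∈ U.erase c, b ∉ C := by
    by_contra! hcon
    exact hCe (Finset.Subset.antisymm hCU hcon)
  rw [Finset.mem_erase] at hb
  have hmax' : ∀ a ∈ C, ∀ b ∈ U, b ∉ C → Jn r a b → b = c := by
    intro a ha b hb hbC hab
    by_contra hbc
    exact hmax a ha b (Finset.mem_erase.2 ⟨hbc, hb⟩) hbC hab
  obtain ⟨R, hR⟩ : ∃ R, R = U \ C := ⟨_, rfl⟩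
  have hRU : R ⊆ U := hR ▸ Finset.sdiff_subset
  have mR : ∀ x, x ∈ R ↔ x ∈ U ∧ x ∉ C := by simp [hR]
  have hcR : c ∈ R := (mR c).2 ⟨hc, hcC⟩
  have hdisj : Disjoint C R := hR ▸ Finset.disjoint_sdiff
  have hRc : Conn r R := by
    refine conn_of_cut_avoiding c hcR fun A hA hne hcA => ?_
    obtain ⟨x, hx, y, hy, hyA, hxy⟩ := h.conn.cut (hA.trans hRU) hne fun e => hcA (e ▸ hc)
    refine ⟨x, hx, y, (mR y).2 ⟨hy, fun hyC => ?_⟩, hyA, hxy⟩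
    have hxR := (mR x).1 (hA hx)
    exact hcA (hmax' y hyC x hxR.1 hxR.2 hxy.symm ▸ hx)
  have hRE : E2 r R ≤ 2 * R.card := by
    by_contra hcon
    obtain ⟨x, hxS, hxR⟩ := h.inter hS ⟨hRc, by omega⟩ hSU hRU
    exact ((mR x).1 hxR).2 (hSC hxS)
  have hUR : U \ R = C := by
    rw [hR, Finset.sdiff_sdiff_eq_self hCU']
  have hCR : C ∪ R = U := by rw [hR, Finset.union_sdiff_of_subset hCU']
  have hzero : ∀ a ∈ C, ∀ b ∈ R, b ≠ c → r s(a, b) = 0 := by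
    intro a ha b hb hbc
    by_contra hcon
    exact hbc (hmax' a ha b ((mR b).1 hb).1 ((mR b).1 hb).2 (Nat.pos_of_ne_zero hcon))
  have hcard : (insert c C).card < U.card := by
    refine Finset.card_lt_card ⟨Finset.insert_subset hc hCU', fun hs => ?_⟩
    have := hs hb.2
    simp [hb.1, hbC] at this
  have hatt := E2_attach hdisj hcR hzero
  rw [hCR] at hatt
  have hR2 : 2 ≤ R.card := by
    rw [← Nat.lt_iff_add_one_le, Finset.one_lt_card]
    exact ⟨c, hcR, b, (mR b).2 ⟨hb.2, hbC⟩, hb.1.symm⟩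
  have hRle := hRc.le_excess
  -- the two cases are treated uniformly
  have main : ∀ r' : Sym2 ℕ → ℕ, (∀ e, e ≠ s(c, c) → r' e = r e) →
      E2 r R + 2 ≤ 2 * R.card + 2 * r' s(c, c) → 2 * r' s(c, c) ≤ E2 r R →
      (∀ (n : ℕ) (H : SimpleGraph (Fin n)), Has H (insert c C) r' → Has H U r) → False := by
    intro r' hr' hX hX' hh
    have hE' : ∀ T, c ∈ T → E2 r' T + 2 * r s(c, c) = E2 r T + 2 * r' s(c, c) := by
      intro T hT
      have : r' = Function.update r s(c, c) (r' s(c, c)) := by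
        funext e
        by_cases he : e = s(c, c)
        · rw [he, Function.update_self]
        · rw [hr' e he, Function.update_of_ne he]
      rw [this, E2_update_loop hT, Function.update_self]
    have hne : ∀ a b, a ≠ c → s(a, b) ≠ s(c, c) := by
      intro a b ha he
      rw [Sym2.eq_iff] at he
      grind
    have hBic : ∀ T, c ∉ T → Bic r T → Bic r' T := fun T hcT hT =>
      hT.congr fun a ha b _ => (hr' _ (hne a b fun e => hcT (e ▸ ha))).symm
    refine h.reduce (U' := insert c C) (r' := r') ?_ ⟨by simp, ?_⟩ hh
    · have := hE' (insert c C) (by simp)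
      omega
    · intro u hu
      by_cases huc : u = c
      · subst huc
        exact ⟨S, hSC.trans (Finset.subset_insert _ _), hcS, hBic S hcS hS⟩
      obtain ⟨T, hTU, huT, hT⟩ := h.nonP.2 u (Finset.insert_subset hc hCU' hu)
      obtain ⟨x, hxS, hxT⟩ := h.inter hS hT hSU hTU
      by_cases hTC : T ⊆ C
      · exact ⟨T, hTC.trans (Finset.subset_insert _ _), huT, hBic T (fun e => hcC (hTC e)) hT⟩
      have hcT : c ∈ T := by
        obtain ⟨a, ha, b, hb, hbn, hab⟩ := hT.1.cut (A := T ∩ C) Finset.inter_subset_left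
          ⟨x, by simp [hxT, hSC hxS]⟩ (fun e => hTC (Finset.inter_eq_left.1 e))
        simp only [Finset.mem_inter] at ha hbn
        exact hmax' a ha.2 b (hTU hb) (fun hbC => hbn ⟨hb, hbC⟩) hab ▸ hb
      have hT' : Conn r (insert c (T ∩ C)) := by
        refine conn_of_cut_avoiding c (by simp) fun A hA hne hcA => ?_
        have hA' : A ⊆ T ∩ C := by
          rwa [Finset.subset_insert_iff_of_notMem hcA] at hA
        obtain ⟨x, hx, y, hy, hyA, hxy⟩ := hT.1.cut (hA'.trans Finset.inter_subset_left) hne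
          fun e => hcA (e ▸ hcT)
        refine ⟨x, hx, y, ?_, hyA, hxy⟩
        rw [Finset.mem_insert, Finset.mem_inter]
        by_cases hyC : y ∈ C
        · exact Or.inr ⟨hy, hyC⟩
        · exact Or.inl (hmax' x (Finset.mem_inter.1 (hA' hx)).2 y (hTU hy) hyC hxy)
      have hdT : Disjoint (T ∩ C) R := Finset.disjoint_of_subset_left Finset.inter_subset_right hdisj
      have hTR : T ∩ C ∪ R = T ∪ R := by
        ext y
        have := mR y
        have := @hTU y
        simp only [Finset.mem_union, Finset.mem_inter]
        tauto
      have h1 := (hT.1.union hRc ⟨c, hcT, c, hcR, Or.inl rfl⟩).excess_mono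
        Finset.subset_union_left ⟨c, hcT⟩
      have h2 := E2_attach hdT hcR fun a ha b hb hbc =>
        hzero a (Finset.mem_inter.1 ha).2 b hb hbc
      rw [hTR] at h2
      have h3 := Finset.card_union_of_disjoint hdT
      rw [hTR] at h3
      have h4 : (insert c (T ∩ C)).card = (T ∩ C).card + 1 :=
        Finset.card_insert_of_notMem (by simp [hcC])
      have h5 := hE' (insert c (T ∩ C)) (by simp)
      have h6 := hT.2
      refine ⟨insert c (T ∩ C), Finset.insert_subset_insert _ Finset.inter_subset_right,
        by simp [huc, huT], hT'.congr fun a ha b hb hab h0 => ?_, by omega⟩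
      rw [hr']
      · exact h0
      · rw [Ne, Sym2.eq_iff]; grind
  by_cases hcyc : 2 * R.card < E2 r R + 2
  · refine main (Function.update r s(c, c) 1) (fun e he => Function.update_of_ne he _ _)
      (by rw [Function.update_self]; omega) (by rw [Function.update_self]; omega)
      fun n H hH => Has.loop hRU (hRc.tri hcR hcyc) (by rwa [hUR])
  · have hl : r s(c, c) = 0 := by
      have h1 := hRc.excess_mono (Finset.singleton_subset_iff.2 hcR) (by simp)
      rw [E2_singleton] at h1
      simp at h1
      omega
    refine main r (fun _ _ => rfl) (by omega) (by omega)
      fun n H hH => hH.mono (Finset.insert_subset hc hCU') fun _ _ _ _ => le_rfl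

theorem Crit.loop_le {U : Finset ℕ} {r : Sym2 ℕ → ℕ} (h : Crit U r) {v : ℕ} (hv : v ∈ U) :
    r s(v, v) ≤ 1 := by
  by_contra hcon
  obtain ⟨S, hSU, hvS, hS⟩ := h.nonP.2 v hv
  obtain ⟨x, hxS, hx⟩ := h.inter hS (T := {v})
    ⟨conn_singleton r v, by rw [E2_singleton]; simp; omega⟩ hSU (by simpa using hv)
  rw [Finset.mem_singleton] at hx
  exact hvS (hx ▸ hxS)

/-- The condition on weights equivalent, for 2-connected multigraphs, to `NonP`. -/
def WtBound (U : Finset ℕ) (r : Sym2 ℕ → ℕ) : Prop := ∀ v ∈ U, 2 * wt r U v + 2 * U.card ≤ E2 r U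

/-- Two-connectedness of the multigraph `r` on `U`. -/
def TwoC (U : Finset ℕ) (r : Sym2 ℕ → ℕ) : Prop := Conn r U ∧ ∀ v ∈ U, Conn r (U.erase v)

theorem TwoC.nonP {U : Finset ℕ} {r : Sym2 ℕ → ℕ} (h : TwoC U r) (hs : WtBound U r) : NonP U r := by
  refine ⟨h.1.nonempty, fun v hv => ⟨U.erase v, Finset.erase_subset _ _, by simp, h.2 v hv, ?_⟩⟩
  have := hs v hv
  have := E2_erase (r := r) hv
  have := Finset.card_erase_of_mem hv
  have := Finset.card_pos.2 ⟨v, hv⟩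
  omega

theorem Crit.twoC {U : Finset ℕ} {r : Sym2 ℕ → ℕ} (h : Crit U r) : TwoC U r :=
  ⟨h.conn, fun _ hv => h.conn_erase hv⟩

theorem Crit.wtBound {U : Finset ℕ} {r : Sym2 ℕ → ℕ} (h : Crit U r) : WtBound U r := by
  intro v hv
  obtain ⟨S, hSU, hvS, hS⟩ := h.nonP.2 v hv
  have h1 := (h.conn_erase hv).excess_mono
    (fun x hx => Finset.mem_erase.2 ⟨fun e => hvS (e ▸ hx), hSU hx⟩) hS.1.nonempty
  have h2 := hS.2
  have h3 := E2_erase (r := r) hv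
  have h4 := Finset.card_erase_of_mem hv
  have h5 := Finset.card_pos.2 ⟨v, hv⟩
  obtain ⟨k, hk⟩ := even_E2 r (U.erase v)
  omega

theorem Crit.two_lt_card {U : Finset ℕ} {r : Sym2 ℕ → ℕ} (h : Crit U r) : 2 < U.card := by
  obtain ⟨v, hv⟩ := h.nonP.1
  obtain ⟨S, hSU, hvS, hS⟩ := h.nonP.2 v hv
  have h1 : 2 ≤ S.card := by
    by_contra hcon
    have : S.card = 1 := by have := Finset.card_pos.2 hS.1.nonempty; omega
    obtain ⟨a, rfl⟩ := Finset.card_eq_one.1 this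
    have := h.loop_le (hSU (Finset.mem_singleton_self a))
    have h2 := hS.2
    rw [E2_singleton] at h2
    simp at h2
    omega
  have h2 : S ⊆ U.erase v := fun x hx => Finset.mem_erase.2 ⟨fun e => hvS (e ▸ hx), hSU hx⟩
  have h3 := Finset.card_le_card h2
  have h4 := Finset.card_erase_of_mem hv
  omega
theorem TwoC.congr {U : Finset ℕ} {r r' : Sym2 ℕ → ℕ} (h : TwoC U r)
    (hr : ∀ a ∈ U, ∀ b ∈ U, a ≠ b → 0 < r s(a, b) → 0 < r' s(a, b)) : TwoC U r' :=
  ⟨h.1.congr hr, fun v hv => (h.2 v hv).congr fun a ha b hb =>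
    hr a (Finset.mem_of_mem_erase ha) b (Finset.mem_of_mem_erase hb)⟩

theorem update_pred_le (r : Sym2 ℕ → ℕ) (e f : Sym2 ℕ) : Function.update r e (r e - 1) f ≤ r f := by
  by_cases h : f = e
  · rw [h, Function.update_self]; omega
  · rw [Function.update_of_ne h]

/-- If a unit of `xy` can be deleted without destroying 2-connectedness, some vertex of maximum
weight avoids it. -/
theorem Crit.exists_max_of_delete {U : Finset ℕ} {r : Sym2 ℕ → ℕ} (h : Crit U r) {x y : ℕ}
    (hx : x ∈ U) (hy : y ∈ U) (hxy : 0 < r s(x, y))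
    (h2 : TwoC U (Function.update r s(x, y) (r s(x, y) - 1))) :
    ∃ v ∈ U, v ≠ x ∧ v ≠ y ∧ E2 r U = 2 * wt r U v + 2 * U.card := by
  by_contra! hcon
  have hE : E2 (Function.update r s(x, y) (r s(x, y) - 1)) U + 2 = E2 r U := by
    by_cases e : x = y
    · subst e
      have := E2_update_loop (r := r) hx (r s(x, x) - 1)
      omega
    · have := E2_update_edge (r := r) hx hy e (r s(x, y) - 1)
      omega
  refine h.reduce (U' := U) (r' := Function.update r s(x, y) (r s(x, y) - 1)) (by omega)
    (h2.nonP fun v hv => ?_)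
    fun n H hH => hH.mono le_rfl fun _ _ _ _ => update_pred_le _ _ _
  have h3 := h.wtBound v hv
  obtain ⟨k, hk⟩ := even_E2 r U
  have hle : wt (Function.update r s(x, y) (r s(x, y) - 1)) U v ≤ wt r U v :=
    Finset.sum_le_sum fun _ _ => update_pred_le _ _ _
  by_cases hv' : v ≠ x ∧ v ≠ y
  · have := hcon v hv hv'.1 hv'.2
    omega
  · suffices wt (Function.update r s(x, y) (r s(x, y) - 1)) U v < wt r U v by omega
    by_cases hvx : v = x
    · subst hvx
      refine Finset.sum_lt_sum (fun _ _ => update_pred_le _ _ _) ⟨y, hy, ?_⟩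
      rw [Function.update_self]; omega
    · obtain rfl : v = y := by tauto
      refine Finset.sum_lt_sum (fun _ _ => update_pred_le _ _ _) ⟨x, hx, ?_⟩
      rw [Sym2.eq_swap (a := v), Function.update_self]; omega

theorem Crit.exists_max_of_two_le {U : Finset ℕ} {r : Sym2 ℕ → ℕ} (h : Crit U r) {x y : ℕ}
    (hx : x ∈ U) (hy : y ∈ U) (hxy : 2 ≤ r s(x, y)) :
    ∃ v ∈ U, v ≠ x ∧ v ≠ y ∧ E2 r U = 2 * wt r U v + 2 * U.card := by
  refine h.exists_max_of_delete hx hy (by omega) (h.twoC.congr fun a _ b _ _ hab => ?_)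
  by_cases he : s(a, b) = s(x, y)
  · rw [he, Function.update_self]; omega
  · rwa [Function.update_of_ne he]

theorem Crit.exists_max_of_loop {U : Finset ℕ} {r : Sym2 ℕ → ℕ} (h : Crit U r) {x : ℕ}
    (hx : x ∈ U) (hxx : 0 < r s(x, x)) :
    ∃ v ∈ U, v ≠ x ∧ E2 r U = 2 * wt r U v + 2 * U.card := by
  obtain ⟨v, h1, h2, -, h3⟩ := h.exists_max_of_delete hx hx hxx (h.twoC.congr fun a _ b _ _ hab => by
    rwa [Function.update_of_ne]
    rw [Ne, Sym2.eq_iff]; grind)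
  exact ⟨v, h1, h2, h3⟩

theorem TwoC.exists_two_nbrs {U : Finset ℕ} {r : Sym2 ℕ → ℕ} (h : TwoC U r) (hU : 2 < U.card)
    {v : ℕ} (hv : v ∈ U) : ∃ y ∈ U, ∃ z ∈ U, y ≠ v ∧ z ≠ v ∧ y ≠ z ∧ Jn r v y ∧ Jn r v z := by
  have one : ∀ S, Conn r S → v ∈ S → S ≠ {v} → ∃ y ∈ S, y ≠ v ∧ Jn r v y := by
    intro S hS hvS hne
    obtain ⟨a, ha, b, hb, hbv, hab⟩ := hS.cut (A := {v}) (by simpa using hvS) (by simp) hne.symm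
    rw [Finset.mem_singleton] at ha hbv
    exact ⟨b, hb, hbv, ha ▸ hab⟩
  obtain ⟨y, hy, hyv, hvy⟩ := one U h.1 hv fun e => by simp [e] at hU
  obtain ⟨z, hz, hzv, hvz⟩ := one (U.erase y) (h.2 y hy) (by simp [hv, hyv.symm]) fun e => by
    have := Finset.card_erase_of_mem hy
    rw [e, Finset.card_singleton] at this
    omega
  rw [Finset.mem_erase] at hz
  exact ⟨y, hy, z, hz.2, hyv, hzv, hz.1.symm, hvy, hvz⟩

theorem wt_eq_add_add {r : Sym2 ℕ → ℕ} {U : Finset ℕ} {y z : ℕ} (hy : y ∈ U) (hz : z ∈ U)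
    (hyz : y ≠ z) (v : ℕ) :
    wt r U v = wt r ((U.erase y).erase z) v + r s(v, y) + r s(v, z) := by
  have := wt_erase (r := r) (v := v) hy
  have := wt_erase (r := r) (v := v) (Finset.mem_erase.2 ⟨hyz.symm, hz⟩)
  omega

theorem Crit.three_le_wt {U : Finset ℕ} {r : Sym2 ℕ → ℕ} (h : Crit U r) {v : ℕ} (hv : v ∈ U) :
    3 ≤ wt r U v := by
  obtain ⟨y, hy, z, hz, hyv, hzv, hyz, hvy, hvz⟩ := h.twoC.exists_two_nbrs h.two_lt_card hv
  by_contra hcon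
  have hw := wt_eq_add_add (r := r) hy hz hyz v
  have hvy' : 0 < r s(v, y) := hvy
  have hvz' : 0 < r s(v, z) := hvz
  have hry : r s(v, y) = 1 := by omega
  have hrz : r s(v, z) = 1 := by omega
  have hr0 : ∀ x ∈ U, x ≠ y → x ≠ z → r s(v, x) = 0 := by
    intro x hx hxy hxz
    have : r s(v, x) ≤ wt r ((U.erase y).erase z) v := le_wt (by simp [hx, hxy, hxz])
    omega
  have hE := E2_erase (r := r) hv
  have hy' : y ∈ U.erase v := Finset.mem_erase.2 ⟨hyv, hy⟩
  have hz' : z ∈ U.erase v := Finset.mem_erase.2 ⟨hzv, hz⟩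
  have hE' := E2_update_edge (r := r) hy' hz' hyz (r s(y, z) + 1)
  have hcard := Finset.card_erase_of_mem hv
  have hpos := Finset.card_pos.2 ⟨v, hv⟩
  have hge : ∀ e, r e ≤ Function.update r s(y, z) (r s(y, z) + 1) e := by
    intro e
    by_cases he : e = s(y, z)
    · rw [he, Function.update_self]; omega
    · rw [Function.update_of_ne he]
  refine h.reduce (U' := U.erase v) (r' := Function.update r s(y, z) (r s(y, z) + 1)) (by omega)
    (TwoC.nonP ⟨?_, fun u hu => ?_⟩ fun u hu => ?_)
    fun n H hH => Has.suppress hv hy hz hvy hvz hyz hyv hzv hH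
  · exact (h.conn_erase hv).mono fun a _ b _ hab => lt_of_lt_of_le hab (hge _)
  · rw [Finset.mem_erase] at hu
    have : ∃ p, (p = y ∨ p = z) ∧ p ≠ u := by
      by_cases e : y = u
      · exact ⟨z, by simp, fun e' => hyz (e.trans e'.symm)⟩
      · exact ⟨y, by simp, e⟩
    obtain ⟨p, hp, hpu⟩ := this
    have hpU : p ∈ U := by rcases hp with rfl | rfl <;> assumption
    have hpv : p ≠ v := by rcases hp with rfl | rfl <;> assumption
    have himg := Cn.image (R' := Jn (Function.update r s(y, z) (r s(y, z) + 1)))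
      (h.conn_erase hu.2) (fun x => if x = v then p else x) (by
        intro a ha b hb hab
        rw [Finset.mem_coe, Finset.mem_erase] at ha hb
        have key : ∀ b ∈ U, b ≠ v → Jn r v b → p = b ∨
            Jn (Function.update r s(y, z) (r s(y, z) + 1)) p b := by
          intro b hb hbv hvb
          have hb' : b = y ∨ b = z := by
            by_contra hc
            have := hr0 b hb (fun e => hc (Or.inl e)) (fun e => hc (Or.inr e))
            have : 0 < r s(v, b) := hvb
            omega
          by_cases e : p = b
          · exact Or.inl e
          · right
            have : s(p, b) = s(y, z) := by
              rw [Sym2.eq_iff]; grind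
            rw [Jn, this, Function.update_self]
            omega
        by_cases hav : a = v <;> by_cases hbv : b = v
        · simp [hav, hbv]
        · simp only [hav, hbv, if_true, if_false]
          exact key b hb.2 hbv (hav ▸ hab)
        · simp only [hav, hbv, if_true, if_false]
          exact (key a ha.2 hav (hbv ▸ hab.symm)).imp Eq.symm Jn.symm
        · simp only [hav, hbv, if_false]
          exact Or.inr (lt_of_lt_of_le hab (hge _)))
    convert himg using 1
    ext x
    simp only [Finset.coe_erase, Set.mem_sdiff, Finset.mem_coe, Set.mem_singleton_iff, Set.mem_image]
    constructor
    · rintro ⟨⟨h1, h2⟩, h3⟩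
      exact ⟨x, ⟨h1, h3⟩, by simp [h2]⟩
    · rintro ⟨x, ⟨h1, h2⟩, rfl⟩
      split_ifs with hxv
      · exact ⟨⟨hpU, hpv⟩, hpu⟩
      · exact ⟨⟨h1, hxv⟩, h2⟩
  · rw [Finset.mem_erase] at hu
    have h1 := h.wtBound u hu.2
    have h2 : wt (Function.update r s(y, z) (r s(y, z) + 1)) (U.erase v) u = wt r U u := by
      have hyzv : ∀ a, a ≠ y → a ≠ z → ∀ b, s(a, b) ≠ s(y, z) := by
        intro a h1 h2 b he
        rw [Sym2.eq_iff] at he; grind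
      rw [wt_erase hv, wt_eq_add_add hy' hz' hyz, wt_eq_add_add (r := r) hy' hz' hyz]
      have h3 : wt (Function.update r s(y, z) (r s(y, z) + 1)) (((U.erase v).erase y).erase z) u =
          wt r (((U.erase v).erase y).erase z) u := by
        refine Finset.sum_congr rfl fun x hx => ?_
        simp only [Finset.mem_erase] at hx
        exact Function.update_of_ne (by rw [Sym2.eq_swap]; exact hyzv x hx.2.1 hx.1 u) _ _
      rw [h3]
      by_cases huy : u = y
      · subst huy
        rw [Function.update_self, Function.update_of_ne, Sym2.eq_swap (a := u) (b := v), hry]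
        · ring
        · rw [Ne, Sym2.eq_iff]; grind
      by_cases huz : u = z
      · subst huz
        rw [Sym2.eq_swap (a := u) (b := y), Function.update_self, Function.update_of_ne,
          Sym2.eq_swap (a := u) (b := v), hrz]
        · ring
        · rw [Ne, Sym2.eq_iff]; grind
      rw [Function.update_of_ne (hyzv u huy huz y), Function.update_of_ne (hyzv u huy huz z),
        Sym2.eq_swap (a := u) (b := v), hr0 u hu.2 huy huz]
      ring
    omega

theorem Crit.not_contract {U : Finset ℕ} {r : Sym2 ℕ → ℕ} (h : Crit U r) {x y : ℕ}
    (hx : x ∈ U) (hy : y ∈ U) (hne : x ≠ y) (hxy : Jn r x y) : ¬ NonP (U.erase y) (contr r x y) := by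
  intro hn
  have hx' : x ∈ U.erase y := Finset.mem_erase.2 ⟨hne, hx⟩
  have h1 : E2 (contr r x y) ((U.erase y).erase x) = E2 r ((U.erase y).erase x) :=
    E2_congr fun i hi j hj => by
      simp [contr, Sym2.map_mk, Finset.ne_of_mem_erase hi, Finset.ne_of_mem_erase hj]
  have h2 : wt (contr r x y) ((U.erase y).erase x) x ≤
      wt r ((U.erase y).erase x) x + wt r ((U.erase y).erase x) y := by
    rw [wt, wt, wt, ← Finset.sum_add_distrib]
    refine Finset.sum_le_sum fun i hi => ?_
    simp [contr, Sym2.map_mk, Finset.ne_of_mem_erase hi]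
  have h3 : contr r x y s(x, x) ≤ r s(x, x) + r s(y, y) := by
    simp [contr, Sym2.map_mk]
  have h4 := E2_erase (r := contr r x y) hx'
  have h5 := E2_erase (r := r) hx'
  have h6 := E2_erase (r := r) hy
  have h7 := wt_erase (r := contr r x y) (v := x) hx'
  have h8 := wt_erase (r := r) (v := x) hx'
  have h9 := wt_eq_add_add (r := r) hy hx hne.symm y
  have h10 := Finset.card_erase_of_mem hy
  have h11 := Finset.card_pos.2 ⟨y, hy⟩
  exact h.reduce (by omega) hn fun n H hH => hH.contract hx hy hxy

/-- A lobe at the edge `uz`: a connected set containing `z` whose only outside neighbours are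
`c` and, through the edge `uz` only, `u`. -/
structure Lobe (U : Finset ℕ) (r : Sym2 ℕ → ℕ) (u z c : ℕ) (K : Finset ℕ) : Prop where
  mem : z ∈ K
  sub : K ⊆ U
  u_notMem : u ∉ K
  c_notMem : c ∉ K
  c_mem : c ∈ U
  c_ne : c ≠ u
  conn : Conn r K
  out : ∀ a ∈ K, ∀ b ∈ U, b ∉ K → Jn r a b → b = c ∨ (b = u ∧ a = z)

theorem TwoC.exists_lobe {U : Finset ℕ} {r : Sym2 ℕ → ℕ} (h : TwoC U r) (hU : 2 < U.card)
    {u z : ℕ} (hu : u ∈ U) (hz : z ∈ U) (huz : u ≠ z)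
    (hn : ¬ TwoC U (Function.update r s(u, z) (r s(u, z) - 1))) : ∃ c K, Lobe U r u z c K := by
  obtain ⟨r', hr'⟩ : ∃ r', r' = Function.update r s(u, z) (r s(u, z) - 1) := ⟨_, rfl⟩
  rw [← hr'] at hn
  have hne : ∀ {a b}, s(a, b) ≠ s(u, z) → 0 < r s(a, b) → 0 < r' s(a, b) := by
    intro a b hab h0
    rwa [hr', Function.update_of_ne hab]
  have keep : ∀ {S}, Conn r S → (u ∉ S ∨ z ∉ S) → Conn r' S := by
    intro S hS hS'
    refine hS.congr fun a ha b hb _ h0 => hne ?_ h0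
    rw [Ne, Sym2.eq_iff]
    rintro (⟨rfl, rfl⟩ | ⟨rfl, rfl⟩) <;> tauto
  have hc1 : Conn r' U := by
    obtain ⟨y, hy, y', hy', hyu, hyu', hyy, huy, huy'⟩ := h.exists_two_nbrs hU hu
    have : ∃ p ∈ U, p ≠ u ∧ p ≠ z ∧ Jn r u p := by
      by_cases e : y = z
      · exact ⟨y', hy', hyu', fun e' => hyy (e.trans e'.symm), huy'⟩
      · exact ⟨y, hy, hyu, e, huy⟩
    obtain ⟨p, hp, hpu, hpz, hup⟩ := this
    have hup' : Jn r' u p := hne (by rw [Ne, Sym2.eq_iff]; grind) hup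
    have := (keep (h.2 u hu) (Or.inl (by simp))).insert_vertex
      (Finset.mem_erase.2 ⟨hpu, hp⟩) hup'.symm
    rwa [Finset.insert_erase hu] at this
  obtain ⟨c, hc, hcn⟩ : ∃ c ∈ U, ¬ Conn r' (U.erase c) := by
    by_contra! hcon
    exact hn ⟨hc1, hcon⟩
  have hcu : c ≠ u := by
    rintro rfl
    exact hcn (keep (h.2 c hc) (Or.inl (by simp)))
  have hcz : c ≠ z := by
    rintro rfl
    exact hcn (keep (h.2 c hc) (Or.inr (by simp)))
  obtain ⟨K, hzK, hKW, hK, hmax⟩ := exists_component r (conn_singleton r z)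
    (W := (U.erase c).erase u) (by simp [hz, hcz.symm, huz.symm])
  have hzK' : z ∈ K := hzK (by simp)
  have huK : u ∉ K := fun hu => by simpa using hKW hu
  refine ⟨c, K, hzK', hKW.trans ((Finset.erase_subset _ _).trans (Finset.erase_subset _ _)),
    huK, fun hc => by simpa using hKW hc, hc, hcu, hK, ?_⟩
  intro a ha b hb hbK hab
  by_contra hcon
  push Not at hcon
  have hbu : b = u := by
    by_contra hbu
    exact hmax a ha b (by simp [hb, hcon.1, hbu]) hbK hab
  subst hbu
  have haz := hcon.2 rfl
  have hQ : Conn r' (insert b K) := by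
    refine (keep hK (Or.inl huK)).insert_vertex ha (hne ?_ hab)
    have := fun e : a = b => huK (e ▸ ha)
    rw [Ne, Sym2.eq_iff]; grind
  have hQU : ∀ x ∈ insert b K, x ∈ U.erase c := by
    intro x hx
    rw [Finset.mem_insert] at hx
    rcases hx with rfl | hx
    · simp [hb, hcu.symm]
    · exact Finset.mem_of_mem_erase (hKW hx)
  refine hcn (conn_of_cut (h.2 c hc).nonempty fun A hA hAne hAn => ?_)
  obtain ⟨x, hx, y, hy, hyA, hxy⟩ := (h.2 c hc).cut hA hAne hAn
  by_cases he : s(x, y) = s(b, z)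
  · have hxy' : x ∈ insert b K ∧ y ∈ insert b K := by
      rw [Sym2.eq_iff] at he
      rcases he with ⟨rfl, rfl⟩ | ⟨rfl, rfl⟩ <;> simp [hzK']
    obtain ⟨p, hp, q, hq, hqn, hpq⟩ := hQ.cut (A := insert b K ∩ A) Finset.inter_subset_left
      ⟨x, Finset.mem_inter.2 ⟨hxy'.1, hx⟩⟩ fun e =>
        hyA (Finset.inter_eq_left.1 e hxy'.2)
    rw [Finset.mem_inter] at hp hqn
    exact ⟨p, hp.2, q, hQU q hq, fun hqA => hqn ⟨hq, hqA⟩, hpq⟩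
  · exact ⟨x, hx, y, hy, hyA, hne he hxy⟩

theorem Lobe.disjoint {U : Finset ℕ} {r : Sym2 ℕ → ℕ} (h : TwoC U r) {u z c z' c' w : ℕ}
    {K K' : Finset ℕ} (hK : Lobe U r u z c K) (hK' : Lobe U r u z' c' K') (hzz : z ≠ z')
    (hw : w ∈ U) (hu : u ∈ U) (hwu : w ≠ u) (huw : Jn r u w) (hwz : w ≠ z) (hwz' : w ≠ z')
    (huz : Jn r u z) (huz' : Jn r u z') : Disjoint K K' ∧ c ∉ K' ∧ c' ∉ K := by
  -- a neighbour of `u` in a lobe is its root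
  have root : ∀ {z c K x}, Lobe U r u z c K → x ∈ K → Jn r u x → x = z := by
    intro z c K x hL hx hux
    rcases hL.out x hx u hu hL.u_notMem hux.symm with e | e
    · exact absurd e.symm hL.c_ne
    · exact e.2
  have closed : ¬ (c ∈ K' ∧ c' ∈ K) := by
    rintro ⟨h1, h2⟩
    obtain ⟨a, ha, b, hb, hbn, hab⟩ := (h.2 u hu).cut (A := K ∪ K') (fun x hx => by
      rw [Finset.mem_union] at hx
      rw [Finset.mem_erase]
      rcases hx with hx | hx
      · exact ⟨fun e => hK.u_notMem (e ▸ hx), hK.sub hx⟩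
      · exact ⟨fun e => hK'.u_notMem (e ▸ hx), hK'.sub hx⟩) ⟨z, by simp [hK.mem]⟩ (fun e => by
      have : w ∈ K ∪ K' := by rw [e]; simp [hw, hwu]
      rw [Finset.mem_union] at this
      rcases this with hx | hx
      · exact hwz (root hK hx huw)
      · exact hwz' (root hK' hx huw))
    rw [Finset.mem_union] at ha hbn
    push Not at hbn
    rw [Finset.mem_erase] at hb
    rcases ha with ha | ha
    · rcases hK.out a ha b hb.2 hbn.1 hab with rfl | e
      · exact hbn.2 h1
      · exact hb.1 e.1
    · rcases hK'.out a ha b hb.2 hbn.2 hab with rfl | e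
      · exact hbn.1 h2
      · exact hb.1 e.1
  have cross : ∀ {z c K z' c' K'}, Lobe U r u z c K → Lobe U r u z' c' K' → z ≠ z' →
      Jn r u z → ∀ x ∈ K, x ∈ K' → c' ∈ K := by
    intro z c K z' c' K' hK hK' hzz huz x hx hx'
    obtain ⟨a, ha, b, hb, hbn, hab⟩ := hK.conn.cut (A := K ∩ K') Finset.inter_subset_left
      ⟨x, by simp [hx, hx']⟩ fun e => hzz (root hK' (Finset.inter_eq_left.1 e hK.mem) huz)
    rw [Finset.mem_inter] at ha hbn
    have hbK' : b ∉ K' := fun h => hbn ⟨hb, h⟩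
    rcases hK'.out a ha.2 b (hK.sub hb) hbK' hab with rfl | e
    · exact hb
    · exact absurd (e.1 ▸ hb) hK.u_notMem
  have hdisj : Disjoint K K' := by
    rw [Finset.disjoint_left]
    intro x hx hy
    exact closed ⟨cross hK' hK hzz.symm huz' x hy hx, cross hK hK' hzz huz x hx hy⟩
  -- a lobe is joined to its second attachment
  have att : ∀ {z c K w}, Lobe U r u z c K → w ∈ U → w ≠ u → w ∉ K →
      ∃ a ∈ K, Jn r a c := by
    intro z c K w hL hw hwu hwK
    obtain ⟨a, ha, b, hb, hbn, hab⟩ := (h.2 u hu).cut (A := K)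
      (fun x hx => Finset.mem_erase.2 ⟨fun e => hL.u_notMem (e ▸ hx), hL.sub hx⟩) ⟨z, hL.mem⟩
      (fun e => hwK (by rw [e]; simp [hw, hwu]))
    rw [Finset.mem_erase] at hb
    rcases hL.out a ha b hb.2 hbn hab with rfl | e
    · exact ⟨a, ha, hab⟩
    · exact absurd e.1 hb.1
  have step : ∀ {z c K z' c' K' w}, Lobe U r u z c K → Lobe U r u z' c' K' → Disjoint K K' →
      w ∈ U → w ≠ u → w ∉ K → c ∈ K' → c' ∈ K := by
    intro z c K z' c' K' w hK hK' hd hw hwu hwK hc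
    obtain ⟨a, ha, hac⟩ := att hK hw hwu hwK
    rcases hK'.out c hc a (hK.sub ha) (Finset.disjoint_left.1 hd ha) hac.symm with rfl | e
    · exact ha
    · exact absurd (e.1 ▸ ha) hK.u_notMem
  have hwK : w ∉ K := fun hx => hwz (root hK hx huw)
  have hwK' : w ∉ K' := fun hx => hwz' (root hK' hx huw)
  exact ⟨hdisj, fun hc => closed ⟨hc, step hK hK' hdisj hw hwu hwK hc⟩,
    fun hc => closed ⟨step hK' hK hdisj.symm hw hwu hwK' hc, hc⟩⟩

theorem exists_three_nbrs {U : Finset ℕ} {r : Sym2 ℕ → ℕ} {u : ℕ} (hw : 3 ≤ wt r U u)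
    (h1 : ∀ x ∈ U, r s(u, x) ≤ 1) : ∃ x ∈ U, ∃ y ∈ U, ∃ z ∈ U, x ≠ y ∧ x ≠ z ∧ y ≠ z ∧
      r s(u, x) = 1 ∧ r s(u, y) = 1 ∧ r s(u, z) = 1 := by
  have : wt r U u = (U.filter fun x => r s(u, x) = 1).card := by
    rw [Finset.card_filter]
    refine Finset.sum_congr rfl fun x hx => ?_
    have := h1 x hx
    split_ifs <;> omega
  rw [this] at hw
  obtain ⟨x, hx, y, hy, z, hz, h⟩ := Finset.two_lt_card.1 hw
  simp only [Finset.mem_filter] at hx hy hz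
  exact ⟨x, hx.1, y, hy.1, z, hz.1, h.1, h.2.1, h.2.2, hx.2, hy.2, hz.2⟩

theorem Crit.flat {U : Finset ℕ} {r : Sym2 ℕ → ℕ} (h : Crit U r) {u : ℕ} (hu : u ∈ U)
    (hM : ∀ v ∈ U, v ≠ u → E2 r U ≠ 2 * wt r U v + 2 * U.card) :
    (∀ x ∈ U, r s(u, x) ≤ 1) ∧ r s(u, u) = 0 ∧
      ∀ z ∈ U, z ≠ u → Jn r u z → ∃ c K, Lobe U r u z c K := by
  refine ⟨fun x hx => ?_, ?_, fun z hz hzu huz => ?_⟩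
  · by_contra hcon
    obtain ⟨v, hv, hvu, -, he⟩ := h.exists_max_of_two_le hu hx (by omega)
    exact hM v hv hvu he
  · by_contra hcon
    obtain ⟨v, hv, hvu, he⟩ := h.exists_max_of_loop hu (by omega)
    exact hM v hv hvu he
  · refine h.twoC.exists_lobe h.two_lt_card hu hz hzu.symm fun h2 => ?_
    obtain ⟨v, hv, hvu, -, he⟩ := h.exists_max_of_delete hu hz huz h2
    exact hM v hv hvu he

theorem Crit.exists_max {U : Finset ℕ} {r : Sym2 ℕ → ℕ} (h : Crit U r) :
    ∃ u ∈ U, E2 r U = 2 * wt r U u + 2 * U.card := by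
  by_contra! hM
  have key : ∀ k u z c K, u ∈ U → Jn r u z → Lobe U r u z c K → K.card = k → False := by
    intro k
    induction k using Nat.strong_induction_on with
    | _ k ih =>
    rintro u z c K hu huz hK rfl
    have hz := hK.sub hK.mem
    have huz' : u ≠ z := fun e => hK.u_notMem (e ▸ hK.mem)
    obtain ⟨f1, f2, f3⟩ := h.flat hz fun v hv _ => hM v hv
    obtain ⟨p, hp, q, hq, w, hw, hpq, hpw, hqw, rp, rq, rw'⟩ :=
      exists_three_nbrs (h.three_le_wt hz) f1
    -- a neighbour of `z` in `K` whose lobe avoids `c` and `u` is a smaller lobe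
    have small : ∀ y ∈ U, y ≠ z → y ≠ u → y ≠ c → Jn r z y → ∀ c' L, Lobe U r z y c' L →
        u ∉ L → c ∉ L → False := by
      intro y hy hyz hyu hyc hzy c' L hL huL hcL
      have hyK : y ∈ K := by
        by_contra hyK
        rcases hK.out z hK.mem y hy hyK hzy with e | e
        · exact hyc e
        · exact hyu e.1
      have hLK : L ⊆ K := by
        by_contra hLK
        obtain ⟨a, ha, b, hb, hbn, hab⟩ := hL.conn.cut (A := L ∩ K) Finset.inter_subset_left
          ⟨y, by simp [hyK, hL.mem]⟩ fun e => hLK (Finset.inter_eq_left.1 e)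
        rw [Finset.mem_inter] at ha hbn
        rcases hK.out a ha.2 b (hL.sub hb) (fun h => hbn ⟨hb, h⟩) hab with rfl | e
        · exact hcL hb
        · exact huL (e.1 ▸ hb)
      exact ih _ (Finset.card_lt_card ⟨hLK, fun hs => hL.u_notMem (hs hK.mem)⟩) z y c' L hz hzy hL rfl
    have nz : ∀ y, r s(z, y) = 1 → y ≠ z := by
      rintro y hy rfl
      omega
    have jn : ∀ y, r s(z, y) = 1 → Jn r z y := fun y hy => by rw [Jn, hy]; exact one_pos
    -- two neighbours of `z` other than `u`
    obtain ⟨a, ha, b, hb, hab, hau, hbu, ra, rb⟩ : ∃ a ∈ U, ∃ b ∈ U, a ≠ b ∧ a ≠ u ∧ b ≠ u ∧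
        r s(z, a) = 1 ∧ r s(z, b) = 1 := by
      by_cases e : p = u
      · exact ⟨q, hq, w, hw, hqw, fun e' => hpq (e.trans e'.symm),
          fun e' => hpw (e.trans e'.symm), rq, rw'⟩
      by_cases e' : q = u
      · exact ⟨p, hp, w, hw, hpw, e, fun e'' => hqw (e'.trans e''.symm), rp, rw'⟩
      · exact ⟨p, hp, q, hq, hpq, e, e', rp, rq⟩
    obtain ⟨ca, La, hLa⟩ := f3 a ha (nz a ra) (jn a ra)
    obtain ⟨cb, Lb, hLb⟩ := f3 b hb (nz b rb) (jn b rb)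
    obtain ⟨cu, Lu, hLu⟩ := f3 u hu huz' huz.symm
    have dab := (hLa.disjoint h.twoC hLb hab hu hz huz' huz.symm hau.symm hbu.symm
      (jn a ra) (jn b rb)).1
    have dau := (hLa.disjoint h.twoC hLu hau hb hz (nz b rb) (jn b rb) hab.symm hbu
      (jn a ra) huz.symm).1
    have dbu := (hLb.disjoint h.twoC hLu hbu ha hz (nz a ra) (jn a ra) hab hau
      (jn b rb) huz.symm).1
    have huLa : u ∉ La := fun hx => Finset.disjoint_left.1 dau hx hLu.mem
    have huLb : u ∉ Lb := fun hx => Finset.disjoint_left.1 dbu hx hLu.mem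
    by_cases hcLa : c ∈ La
    · have hcLb : c ∉ Lb := Finset.disjoint_left.1 dab hcLa
      exact small b hb (nz b rb) hbu (fun e => hcLb (e ▸ hLb.mem)) (jn b rb) cb Lb hLb huLb hcLb
    · exact small a ha (nz a ra) hau (fun e => hcLa (e ▸ hLa.mem)) (jn a ra) ca La hLa huLa hcLa
  obtain ⟨u, hu⟩ := h.nonP.1
  obtain ⟨f1, f2, f3⟩ := h.flat hu fun v hv _ => hM v hv
  obtain ⟨p, hp, -, -, -, -, -, -, -, rp, -, -⟩ := exists_three_nbrs (h.three_le_wt hu) f1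
  have jp : Jn r u p := by rw [Jn, rp]; exact one_pos
  obtain ⟨c, K, hK⟩ := f3 p hp (by rintro rfl; omega) jp
  exact key _ u p c K hu jp hK rfl

theorem Conn.remove {r : Sym2 ℕ → ℕ} {D K : Finset ℕ} {c : ℕ} (hD : Conn r D) (hK : K ⊆ D)
    (hc : c ∈ D) (hcK : c ∉ K) (h : ∀ a ∈ K, ∀ b ∈ D, b ∉ K → Jn r a b → b = c) :
    Conn r (D \ K) ∧ E2 r D = E2 r K + E2 r (D \ K) + 2 * ∑ a ∈ K, r s(a, c) := by
  have hcD : c ∈ D \ K := Finset.mem_sdiff.2 ⟨hc, hcK⟩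
  constructor
  · refine conn_of_cut_avoiding c hcD fun A hA hne hcA => ?_
    obtain ⟨a, ha, b, hb, hbA, hab⟩ := hD.cut (hA.trans Finset.sdiff_subset) hne
      fun e => hcA (e ▸ hc)
    have haD := Finset.mem_sdiff.1 (hA ha)
    refine ⟨a, ha, b, Finset.mem_sdiff.2 ⟨hb, fun hbK => ?_⟩, hbA, hab⟩
    exact hcA (h b hbK a haD.1 haD.2 hab.symm ▸ ha)
  · conv_lhs => rw [← Finset.union_sdiff_of_subset hK, E2_union Finset.disjoint_sdiff]
    congr 2
    refine Finset.sum_congr rfl fun a ha => Finset.sum_eq_single_of_mem c hcD fun b hb hbc => ?_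
    rw [Finset.mem_sdiff] at hb
    by_contra h0
    exact hbc (h a ha b hb.1 hb.2 (Nat.pos_of_ne_zero h0))

theorem Crit.lobe_excess {U : Finset ℕ} {r : Sym2 ℕ → ℕ} (h : Crit U r) {u z c w : ℕ}
    {K : Finset ℕ} (hK : Lobe U r u z c K) (hw : w ∈ U) (hwu : w ≠ u) (hwK : w ∉ K)
    (huz : r s(u, z) = 1) (hu : u ∈ U) :
    2 * K.card + 2 ≤ E2 r K + 2 * ∑ a ∈ K, r s(a, c) := by
  obtain ⟨a, ha, hac⟩ : ∃ a ∈ K, Jn r a c := by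
    obtain ⟨a, ha, b, hb, hbn, hab⟩ := (h.twoC.2 u hu).cut (A := K)
      (fun x hx => Finset.mem_erase.2 ⟨fun e => hK.u_notMem (e ▸ hx), hK.sub hx⟩) ⟨z, hK.mem⟩
      (fun e => hwK (by rw [e]; simp [hw, hwu]))
    rw [Finset.mem_erase] at hb
    rcases hK.out a ha b hb.2 hbn hab with rfl | e
    · exact ⟨a, ha, hab⟩
    · exact absurd e.1 hb.1
  have hA : 0 < ∑ a ∈ K, r s(a, c) :=
    lt_of_lt_of_le hac (Finset.single_le_sum (f := fun a => r s(a, c))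
      (fun _ _ => Nat.zero_le _) ha)
  have hwt : ∀ a ∈ K, wt r U a = wt r K a + r s(a, c) + r s(a, u) := by
    intro a ha
    have h1 : wt r U a = wt r K a + wt r (U \ K) a := by
      unfold wt
      rw [← Finset.sum_sdiff hK.sub, add_comm]
    have hu' : u ∈ U \ K := Finset.mem_sdiff.2 ⟨hu, hK.u_notMem⟩
    have hc' : c ∈ U \ K := Finset.mem_sdiff.2 ⟨hK.c_mem, hK.c_notMem⟩
    have h2 := wt_eq_add_add (r := r) hc' hu' hK.c_ne a
    have h3 : wt r (((U \ K).erase c).erase u) a = 0 := by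
      refine Finset.sum_eq_zero fun b hb => ?_
      simp only [Finset.mem_erase, Finset.mem_sdiff] at hb
      by_contra h0
      rcases hK.out a ha b hb.2.2.1 hb.2.2.2 (Nat.pos_of_ne_zero h0) with e | e
      · exact hb.2.1 e
      · exact hb.1 e.1
    omega
  have hU : ∑ a ∈ K, r s(a, u) = 1 := by
    rw [Finset.sum_eq_single_of_mem z hK.mem, Sym2.eq_swap, huz]
    intro b hb hbz
    by_contra h0
    rcases hK.out b hb u hu hK.u_notMem (Nat.pos_of_ne_zero h0) with e | e
    · exact hK.c_ne e.symm
    · exact hbz e.2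
  have hE : E2 r K = ∑ a ∈ K, wt r K a + ∑ a ∈ K, r s(a, a) := by
    rw [← Finset.sum_add_distrib]; rfl
  have h3 : K.card * 3 ≤ ∑ a ∈ K, wt r U a :=
    Finset.card_nsmul_le_sum K _ 3 fun a ha => h.three_le_wt (hK.sub ha)
  rw [Finset.sum_congr rfl hwt, Finset.sum_add_distrib, Finset.sum_add_distrib, hU] at h3
  have hpos : 0 < K.card := Finset.card_pos.2 ⟨z, hK.mem⟩
  by_cases h1 : K.card = 1
  · obtain ⟨y, rfl⟩ := Finset.card_eq_one.1 h1
    simp only [Finset.sum_singleton, wt, E2_singleton] at *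
    omega
  · omega

theorem Crit.exists_max_pair {U : Finset ℕ} {r : Sym2 ℕ → ℕ} (h : Crit U r) :
    ∃ u ∈ U, ∃ v ∈ U, u ≠ v ∧ E2 r U = 2 * wt r U u + 2 * U.card ∧
      E2 r U = 2 * wt r U v + 2 * U.card := by
  obtain ⟨u, hu, hmax⟩ := h.exists_max
  by_contra! hcon
  have hM : ∀ v ∈ U, v ≠ u → E2 r U ≠ 2 * wt r U v + 2 * U.card :=
    fun v hv hvu => hcon u hu v hv hvu.symm hmax
  obtain ⟨f1, f2, f3⟩ := h.flat hu hM
  obtain ⟨p, hp, q, hq, w, hw, hpq, hpw, hqw, rp, rq, rw'⟩ :=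
    exists_three_nbrs (h.three_le_wt hu) f1
  have ne : ∀ {y}, r s(u, y) = 1 → y ≠ u := by
    rintro y hy rfl
    omega
  have jn : ∀ {y}, r s(u, y) = 1 → Jn r u y := fun hy => by rw [Jn, hy]; exact one_pos
  obtain ⟨cp, Kp, hKp⟩ := f3 p hp (ne rp) (jn rp)
  obtain ⟨cq, Kq, hKq⟩ := f3 q hq (ne rq) (jn rq)
  obtain ⟨cw, Kw, hKw⟩ := f3 w hw (ne rw') (jn rw')
  obtain ⟨dpq, epq, eqp⟩ := hKp.disjoint h.twoC hKq hpq hw hu (ne rw') (jn rw') hpw.symm hqw.symm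
    (jn rp) (jn rq)
  obtain ⟨dpw, epw, ewp⟩ := hKp.disjoint h.twoC hKw hpw hq hu (ne rq) (jn rq) hpq.symm hqw
    (jn rp) (jn rw')
  obtain ⟨dqw, eqw, ewq⟩ := hKq.disjoint h.twoC hKw hqw hp hu (ne rp) (jn rp) hpq hpw
    (jn rq) (jn rw')
  have nm : ∀ {A B : Finset ℕ} {x}, Disjoint A B → x ∈ B → x ∉ A := fun h hx hx' =>
    Finset.disjoint_left.1 h hx' hx
  have xp := h.lobe_excess hKp hq (ne rq) (nm dpq hKq.mem) rp hu
  have xq := h.lobe_excess hKq hw (ne rw') (nm dqw hKw.mem) rq hu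
  have xw := h.lobe_excess hKw hp (ne rp) (nm dpw.symm hKp.mem) rw' hu
  have out : ∀ {z c K} {D : Finset ℕ}, Lobe U r u z c K → D ⊆ U.erase u →
      ∀ a ∈ K, ∀ b ∈ D, b ∉ K → Jn r a b → b = c := by
    intro z c K D hK hD a ha b hb hbK hab
    have := Finset.mem_erase.1 (hD hb)
    rcases hK.out a ha b this.2 hbK hab with e | e
    · exact e
    · exact absurd e.1 this.1
  have sub : ∀ {z c K}, Lobe U r u z c K → K ⊆ U.erase u := fun hK x hx =>
    Finset.mem_erase.2 ⟨fun e => hK.u_notMem (e ▸ hx), hK.sub hx⟩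
  have cm : ∀ {z c K}, Lobe U r u z c K → c ∈ U.erase u := fun hK =>
    Finset.mem_erase.2 ⟨hK.c_ne, hK.c_mem⟩
  obtain ⟨c1, e1⟩ := (h.twoC.2 u hu).remove (sub hKp) (cm hKp) hKp.c_notMem (out hKp subset_rfl)
  have s2 : Kq ⊆ U.erase u \ Kp := Finset.subset_sdiff.2 ⟨sub hKq, dpq.symm⟩
  obtain ⟨c2, e2⟩ := c1.remove s2 (Finset.mem_sdiff.2 ⟨cm hKq, eqp⟩) hKq.c_notMem
    (out hKq Finset.sdiff_subset)
  have s3 : Kw ⊆ (U.erase u \ Kp) \ Kq :=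
    Finset.subset_sdiff.2 ⟨Finset.subset_sdiff.2 ⟨sub hKw, dpw.symm⟩, dqw.symm⟩
  obtain ⟨c3, e3⟩ := c2.remove s3
    (Finset.mem_sdiff.2 ⟨Finset.mem_sdiff.2 ⟨cm hKw, ewp⟩, ewq⟩) hKw.c_notMem
    (out hKw (Finset.sdiff_subset.trans Finset.sdiff_subset))
  have := c3.le_excess
  have k1 := Finset.card_sdiff_add_card_eq_card (sub hKp)
  have k2 := Finset.card_sdiff_add_card_eq_card s2
  have k3 := Finset.card_sdiff_add_card_eq_card s3
  have k0 := Finset.card_erase_add_one hu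
  have := E2_erase (r := r) hu
  omega

/-- The entry at position `(i, j)` of a small symmetric matrix packed into a natural number. -/
def digit (c i j : ℕ) : ℕ := (c >>> (3 * (8 * i + j))) % 8

/-- The multigraph encoded by `c`. -/
def packed (c : ℕ) (e : Sym2 ℕ) : ℕ := digit c e.inf e.sup

instance (r : Sym2 ℕ → ℕ) : DecidableRel (nodeRel r) := fun x y =>
  match x, y with
  | base u, base v => inferInstanceAs (Decidable (0 < r s(u, v)))
  | base u, ext _ e _ => inferInstanceAs (Decidable (u ∈ e))
  | ext _ e n, ext _ e' n' => inferInstanceAs (Decidable (e = e' ∧ n = n'))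
  | ext _ _ _, base _ => inferInstanceAs (Decidable False)

/-- A decidable form of membership in `validNodes (range k) (packed c)`. -/
def SmallNode (k c : ℕ) : Node → Prop
  | base v => v < k
  | ext c' e m => e.inf < k ∧ e.sup < k ∧ m < packed c e ∧
      (e.inf ≠ e.sup → c' = false ∧ m + 1 < packed c e)

instance (k c : ℕ) : DecidablePred (SmallNode k c) := fun x =>
  match x with
  | base v => inferInstanceAs (Decidable (v < k))
  | ext c' e m => inferInstanceAs (Decidable (e.inf < k ∧ e.sup < k ∧ m < packed c e ∧
      (e.inf ≠ e.sup → c' = false ∧ m + 1 < packed c e)))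

theorem hasO_of_nodes {n k c : ℕ} {E : List (ℕ × ℕ)} (hO : (⟨n, mkGraph n E⟩ : (n : ℕ) × SimpleGraph (Fin n)) ∈ OList)
    (L : List Node) (hn : L.Nodup) (hl : L.length = n)
    (hv : ∀ x ∈ L, SmallNode k c x)
    (hE : ∀ p ∈ E, (L.getD p.1 (base 0)) ≠ (L.getD p.2 (base 0)) ∧
      (nodeRel (packed c) (L.getD p.1 (base 0)) (L.getD p.2 (base 0)) ∨
      nodeRel (packed c) (L.getD p.2 (base 0)) (L.getD p.1 (base 0)))) :
    HasO (Finset.range k) (packed c) := by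
  subst hl
  have hg : ∀ w : Fin L.length, L.getD w (base 0) = L.get w := by simp
  refine ⟨_, hO, MinorIn.of_hom L.get (List.nodup_iff_injective_get.1 hn) (fun w => ?_)
    fun w w' h => ?_⟩
  · have := hv (L.get w) (L.get_mem w)
    cases h : L.get w with
    | base v =>
      rw [h] at this
      exact Finset.mem_range.2 this
    | ext c' e m =>
      rw [h] at this
      obtain ⟨h1, h2, h3, h4⟩ := this
      induction e with
      | _ a b =>
      simp only [Sym2.inf_mk, Sym2.sup_mk] at h1 h2
      refine ⟨?_, h3, fun hd => h4 fun e => hd ?_⟩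
      · intro u hu
        rw [Finset.mem_range]
        rcases Sym2.mem_iff.1 hu with rfl | rfl <;> grind
      · simp only [Sym2.inf_mk, Sym2.sup_mk] at e
        simp only [Sym2.mk_isDiag_iff]
        grind
  · rw [mkGraph, SimpleGraph.fromRel_adj] at h
    rw [realize, SimpleGraph.fromRel_adj]
    rcases h.2 with h | h
    · have := hE _ h
      simpa only [hg] using this
    · have := hE _ h
      simp only [hg] at this
      exact ⟨this.1.symm, this.2.symm⟩

/-- The number of vertices and packed multiplicities of the multigraphs obtained from the connected
obstructions by suppressing vertices of degree two. -/
def cores : List (ℕ × ℕ) :=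
  [(4, 2417851783344456088944713),
   (5, 38685627380589647861121097),
   (4, 288230394405322825),
   (5, 324518573001240993538737086399048),
   (4, 288230385815388745),
   (3, 3221225617),
   (4, 288230378299195921),
   (5, 324518573001240128847600041332752),
   (4, 288230377359671817),
   (3, 18014399717441609),
   (4, 288230385815388689),
   (3, 18014400656965713),
   (6, 2596148429267413958381064379470400),
   (5, 19342814410870836787417168),
   (4, 288230378299196432),
   (5, 144115335178494528),
   (4, 144115206329467528),
   (5, 19342815419677094262604360),
   (5, 2449958214469427272),
   (4, 144115198813274768),
   (6, 2596148603352742215065399373856848),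
   (4, 432345572817502864),
   (3, 3221225688),
   (5, 19342815419677145802212368),
   (5, 19342815563792272674783824),
   (6, 5192296877877641030594940350005264),
   (6, 2596148584009920166089732005068816),
   (6, 2596148603352741062143955970294344),
   (6, 10520409356602741248),
   (5, 1297036771065860680)]

theorem hasO_of_mem_cores : ∀ p ∈ cores, HasO (Finset.range p.1) (packed p.2) := by
  simp only [cores, List.forall_mem_cons]
  refine ⟨hasO_of_nodes (E := [(0, 1), (0, 2), (1, 2), (2, 3), (2, 4), (3, 4), (3, 5), (4, 5), (5, 6), (5, 7), (6, 7)])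
      (by simp [OList, O4])
      [ext false s(0, 0) 0, ext true s(0, 0) 0, base 0, base 1, base 2, base 3, ext false s(3, 3) 0, ext true s(3, 3) 0]
      (by decide +kernel) rfl (by decide +kernel) (by decide +kernel),
    hasO_of_nodes (E := [(0, 1), (0, 2), (1, 2), (2, 3), (2, 4), (3, 4), (3, 5), (4, 6), (5, 6), (5, 7), (6, 7)])
      (by simp [OList, O5])
      [ext false s(0, 0) 0, ext true s(0, 0) 0, base 0, base 1, base 2, base 3, base 4, ext false s(3, 4) 0]
      (by decide +kernel) rfl (by decide +kernel) (by decide +kernel),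
    hasO_of_nodes (E := [(0, 1), (0, 2), (1, 2), (2, 3), (2, 4), (3, 4), (3, 5), (4, 5), (3, 6), (5, 6), (4, 7), (5, 7)])
      (by simp [OList, O6])
      [ext false s(0, 0) 0, ext true s(0, 0) 0, base 0, base 1, base 2, base 3, ext false s(1, 3) 0, ext false s(2, 3) 0]
      (by decide +kernel) rfl (by decide +kernel) (by decide +kernel),
    hasO_of_nodes (E := [(0, 1), (0, 6), (1, 6), (2, 3), (2, 4), (2, 5), (3, 4), (3, 5), (4, 6), (5, 6)])
      (by simp [OList, O7])
      [ext false s(4, 4) 0, ext true s(4, 4) 0, base 0, base 1, base 2, base 3, base 4]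
      (by decide +kernel) rfl (by decide +kernel) (by decide +kernel),
    hasO_of_nodes (E := [(0, 1), (0, 2), (1, 2), (2, 3), (2, 4), (2, 5), (3, 4), (3, 5), (4, 5), (4, 6), (5, 6)])
      (by simp [OList, O8])
      [ext false s(0, 0) 0, ext true s(0, 0) 0, base 0, base 1, base 2, base 3, ext false s(2, 3) 0]
      (by decide +kernel) rfl (by decide +kernel) (by decide +kernel),
    hasO_of_nodes (E := [(0, 1), (0, 2), (1, 2), (2, 3), (2, 4), (3, 4), (3, 5), (4, 5), (2, 6), (4, 6), (2, 7), (3, 7), (3, 8), (4, 8)])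
      (by simp [OList, O9])
      [ext false s(0, 0) 0, ext true s(0, 0) 0, base 0, base 1, base 2, ext false s(1, 2) 0, ext false s(0, 2) 0, ext false s(0, 1) 0, ext false s(1, 2) 1]
      (by decide +kernel) rfl (by decide +kernel) (by decide +kernel),
    hasO_of_nodes (E := [(0, 1), (1, 2), (2, 3), (3, 0), (0, 4), (1, 4), (1, 5), (2, 5), (2, 6), (3, 6), (0, 7), (0, 8), (7, 8)])
      (by simp [OList, O10])
      [base 0, base 1, base 2, base 3, ext false s(0, 1) 0, ext false s(1, 2) 0, ext false s(2, 3) 0, ext false s(0, 0) 0, ext true s(0, 0) 0]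
      (by decide +kernel) rfl (by decide +kernel) (by decide +kernel),
    hasO_of_nodes (E := [(0, 1), (0, 2), (1, 2), (3, 4), (3, 5), (4, 5), (6, 7), (6, 8), (7, 8), (2, 3), (1, 8), (4, 8)])
      (by simp [OList, O11])
      [ext false s(0, 1) 0, base 0, base 1, base 2, base 3, ext false s(2, 3) 0, ext false s(4, 4) 0, ext true s(4, 4) 0, base 4]
      (by decide +kernel) rfl (by decide +kernel) (by decide +kernel),
    hasO_of_nodes (E := [(0, 1), (0, 2), (1, 2), (3, 4), (3, 5), (4, 5), (6, 7), (6, 8), (7, 8), (2, 3), (2, 7), (3, 6)])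
      (by simp [OList, O12])
      [ext false s(0, 0) 0, ext true s(0, 0) 0, base 0, base 1, ext false s(1, 1) 0, ext true s(1, 1) 0, base 2, base 3, ext false s(2, 3) 0]
      (by decide +kernel) rfl (by decide +kernel) (by decide +kernel),
    hasO_of_nodes (E := [(0, 1), (0, 2), (1, 2), (3, 4), (3, 5), (4, 5), (6, 7), (6, 8), (7, 8), (2, 3), (2, 8), (3, 8)])
      (by simp [OList, O13])
      [ext false s(0, 0) 0, ext true s(0, 0) 0, base 0, base 1, ext false s(1, 1) 0, ext true s(1, 1) 0, ext false s(2, 2) 0, ext true s(2, 2) 0, base 2]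
      (by decide +kernel) rfl (by decide +kernel) (by decide +kernel),
    hasO_of_nodes (E := [(0, 1), (0, 2), (1, 2), (1, 4), (2, 3), (2, 4), (3, 4), (3, 5), (4, 5), (1, 6), (1, 7), (6, 7)])
      (by simp [OList, O14])
      [ext false s(0, 1) 0, base 0, base 1, base 2, base 3, ext false s(2, 3) 0, ext false s(0, 0) 0, ext true s(0, 0) 0]
      (by decide +kernel) rfl (by decide +kernel) (by decide +kernel),
    hasO_of_nodes (E := [(0, 1), (0, 2), (1, 2), (2, 3), (2, 4), (3, 4), (4, 5), (4, 6), (5, 6), (6, 7), (6, 8), (7, 8), (2, 6)])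
      (by simp [OList, O15])
      [ext false s(0, 0) 0, ext true s(0, 0) 0, base 0, ext false s(0, 1) 0, base 1, ext false s(1, 2) 0, base 2, ext false s(2, 2) 0, ext true s(2, 2) 0]
      (by decide +kernel) rfl (by decide +kernel) (by decide +kernel),
    hasO_of_nodes (E := [(0, 2), (0, 3), (0, 4), (0, 5), (1, 2), (1, 3), (1, 4), (1, 5), (2, 3), (4, 5)])
      (by simp [OList, O16])
      [base 0, base 1, base 2, base 3, base 4, base 5]
      (by decide +kernel) rfl (by decide +kernel) (by decide +kernel),
    hasO_of_nodes (E := [(0, 1), (1, 3), (3, 2), (2, 0), (4, 0), (4, 1), (4, 2), (4, 3), (5, 0), (5, 1)])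
      (by simp [OList, O17])
      [base 0, base 1, base 2, base 3, base 4, ext false s(0, 1) 0]
      (by decide +kernel) rfl (by decide +kernel) (by decide +kernel),
    hasO_of_nodes (E := [(0, 1), (1, 2), (2, 3), (3, 0), (4, 0), (4, 1), (5, 1), (5, 2), (6, 2), (6, 3), (7, 3), (7, 0)])
      (by simp [OList, O18])
      [base 0, base 1, base 2, base 3, ext false s(0, 1) 0, ext false s(1, 2) 0, ext false s(2, 3) 0, ext false s(0, 3) 0]
      (by decide +kernel) rfl (by decide +kernel) (by decide +kernel),
    hasO_of_nodes (E := [(0, 2), (0, 3), (1, 2), (1, 3), (2, 3), (0, 4), (4, 1), (5, 0), (5, 4), (6, 4), (6, 1)])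
      (by simp [OList, O19])
      [base 0, base 1, base 2, base 3, base 4, ext false s(0, 4) 0, ext false s(1, 4) 0]
      (by decide +kernel) rfl (by decide +kernel) (by decide +kernel),
    hasO_of_nodes (E := [(1, 2), (1, 4), (1, 5), (2, 4), (2, 5), (4, 5), (0, 1), (0, 4), (2, 3), (3, 5)])
      (by simp [OList, O20])
      [ext false s(0, 2) 0, base 0, base 1, ext false s(1, 3) 0, base 2, base 3]
      (by decide +kernel) rfl (by decide +kernel) (by decide +kernel),
    hasO_of_nodes (E := [(0, 1), (0, 3), (0, 4), (1, 3), (1, 4), (3, 5), (4, 5), (1, 2), (2, 4), (3, 6), (5, 6)])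
      (by simp [OList, O21])
      [base 0, base 1, ext false s(1, 3) 0, base 2, base 3, base 4, ext false s(2, 4) 0]
      (by decide +kernel) rfl (by decide +kernel) (by decide +kernel),
    hasO_of_nodes (E := [(0, 1), (0, 3), (1, 4), (3, 4), (1, 2), (2, 4), (7, 0), (7, 3), (5, 7), (5, 0), (6, 7), (6, 3)])
      (by simp [OList, O22])
      [base 0, base 1, ext false s(1, 3) 0, base 2, base 3, ext false s(0, 4) 0, ext false s(2, 4) 0, base 4]
      (by decide +kernel) rfl (by decide +kernel) (by decide +kernel),
    hasO_of_nodes (E := [(2, 3), (2, 4), (2, 6), (3, 4), (3, 6), (4, 6), (5, 3), (5, 4), (0, 2), (0, 3), (1, 2), (1, 4)])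
      (by simp [OList, O23])
      [ext false s(0, 1) 0, ext false s(0, 2) 0, base 0, base 1, base 2, ext false s(1, 2) 0, base 3]
      (by decide +kernel) rfl (by decide +kernel) (by decide +kernel),
    hasO_of_nodes (E := [(0, 1), (0, 2), (1, 2), (1, 3), (2, 4), (3, 5), (3, 6), (4, 5), (4, 6), (5, 6)])
      (by simp [OList, O24])
      [ext false s(0, 1) 0, base 0, base 1, base 2, base 3, base 4, base 5]
      (by decide +kernel) rfl (by decide +kernel) (by decide +kernel),
    hasO_of_nodes (E := [(0, 1), (0, 3), (1, 3), (1, 2), (1, 5), (2, 5), (1, 7), (2, 7), (3, 4), (4, 5), (3, 5), (3, 6), (5, 6)])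
      (by simp [OList, O25])
      [ext false s(0, 2) 0, base 0, base 1, base 2, ext false s(2, 3) 0, base 3, ext false s(2, 3) 1, ext false s(0, 1) 0]
      (by decide +kernel) rfl (by decide +kernel) (by decide +kernel),
    hasO_of_nodes (E := [(2, 3), (2, 4), (3, 4), (5, 3), (5, 4), (8, 3), (8, 4), (0, 2), (0, 3), (7, 2), (7, 3), (1, 2), (1, 4), (6, 2), (6, 4)])
      (by simp [OList, O26])
      [ext false s(0, 1) 0, ext false s(0, 2) 0, base 0, base 1, base 2, ext false s(1, 2) 0, ext false s(0, 2) 1, ext false s(0, 1) 1, ext false s(1, 2) 1]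
      (by decide +kernel) rfl (by decide +kernel) (by decide +kernel),
    hasO_of_nodes (E := [(0, 2), (1, 2), (0, 3), (2, 3), (1, 6), (2, 6), (3, 4), (6, 7), (4, 5), (5, 7), (3, 7), (4, 7)])
      (by simp [OList, O27])
      [ext false s(0, 1) 0, ext false s(0, 3) 0, base 0, base 1, base 2, ext false s(2, 4) 0, base 3, base 4]
      (by decide +kernel) rfl (by decide +kernel) (by decide +kernel),
    hasO_of_nodes (E := [(0, 1), (0, 2), (1, 2), (1, 3), (1, 5), (3, 5), (3, 4), (3, 6), (4, 6), (2, 5), (5, 6)])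
      (by simp [OList, O28])
      [ext false s(0, 1) 0, base 0, base 1, base 2, ext false s(2, 4) 0, base 3, base 4]
      (by decide +kernel) rfl (by decide +kernel) (by decide +kernel),
    hasO_of_nodes (E := [(0, 1), (0, 2), (1, 2), (3, 4), (3, 5), (4, 5), (6, 7), (6, 8), (7, 8), (2, 3), (1, 7), (4, 6)])
      (by simp [OList, O29])
      [ext false s(0, 1) 0, base 0, base 1, base 2, base 3, ext false s(2, 3) 0, base 4, base 5, ext false s(4, 5) 0]
      (by decide +kernel) rfl (by decide +kernel) (by decide +kernel),
    hasO_of_nodes (E := [(0, 1), (0, 2), (1, 2), (3, 4), (3, 5), (4, 5), (6, 7), (1, 6), (4, 6), (0, 7), (5, 7)])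
      (by simp [OList, O30])
      [base 0, base 1, ext false s(0, 1) 0, ext false s(2, 3) 0, base 2, base 3, base 4, base 5]
      (by decide +kernel) rfl (by decide +kernel) (by decide +kernel),
    hasO_of_nodes (E := [(0, 1), (0, 2), (1, 2), (3, 4), (3, 5), (4, 5), (0, 3), (1, 4), (2, 5)])
      (by simp [OList, O31])
      [base 0, base 1, base 2, base 3, base 4, base 5]
      (by decide +kernel) rfl (by decide +kernel) (by decide +kernel),
    hasO_of_nodes (E := [(0, 3), (0, 4), (0, 5), (1, 3), (1, 4), (1, 5), (2, 3), (2, 4), (2, 5)])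
      (by simp [OList, O32])
      [base 0, base 1, base 2, base 3, base 4, base 5]
      (by decide +kernel) rfl (by decide +kernel) (by decide +kernel),
    hasO_of_nodes (E := [(0, 1), (0, 2), (0, 3), (0, 4), (1, 2), (1, 3), (1, 4), (2, 3), (2, 4)])
      (by simp [OList, O33])
      [base 0, base 1, base 2, base 3, base 4]
      (by decide +kernel) rfl (by decide +kernel) (by decide +kernel),
    by simp⟩

/-- Twice the number of edges that `f` spans on a list of vertices. -/
def listE2 (f : ℕ → ℕ → ℕ) (C : List ℕ) : ℕ := (C.map fun i => (C.map (f i)).sum + f i i).sum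

theorem listE2_eq {f : ℕ → ℕ → ℕ} {r : Sym2 ℕ → ℕ} {C : List ℕ} (hC : C.Nodup)
    (hf : ∀ i ∈ C, ∀ j ∈ C, f i j = r s(i, j)) : listE2 f C = E2 r C.toFinset := by
  have h1 : ∀ g : ℕ → ℕ, (C.map g).sum = ∑ i ∈ C.toFinset, g i := fun g =>
    (List.sum_toFinset g hC).symm
  rw [listE2, E2, h1]
  refine Finset.sum_congr rfl fun i hi => ?_
  rw [List.mem_toFinset] at hi
  rw [h1, hf i hi i hi]
  congr 1
  exact Finset.sum_congr rfl fun j hj => hf i hi j (List.mem_toFinset.1 hj)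

/-- Grow the list `R` by vertices of `P` along edges of `f`. -/
def comp (f : ℕ → ℕ → ℕ) : ℕ → List ℕ → List ℕ → List ℕ
  | 0, R, _ => R
  | n + 1, R, P =>
    match P.find? fun b => R.any fun a => Nat.blt 0 (f a b) with
    | none => R
    | some b => comp f n (b :: R) (P.erase b)

theorem comp_spec {f : ℕ → ℕ → ℕ} {r : Sym2 ℕ → ℕ} (n : ℕ) (R P : List ℕ)
    (hf : ∀ i ∈ R ++ P, ∀ j ∈ R ++ P, f i j = r s(i, j)) (hn : (R ++ P).Nodup)
    (hR : Conn r R.toFinset) :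
    Conn r (comp f n R P).toFinset ∧ (comp f n R P).Nodup ∧ (∀ x ∈ comp f n R P, x ∈ R ++ P) ∧
      ∀ x ∈ R, x ∈ comp f n R P := by
  induction n generalizing R P with
  | zero => exact ⟨hR, (List.nodup_append.1 hn).1, fun x hx => List.mem_append_left _ hx,
      fun x hx => hx⟩
  | succ n ih =>
    rw [comp]
    split
    · exact ⟨hR, (List.nodup_append.1 hn).1, fun x hx => List.mem_append_left _ hx,
        fun x hx => hx⟩
    · rename_i b hb
      have hbP := List.mem_of_find?_eq_some hb
      have hb' := List.find?_some hb
      simp only [List.any_eq_true, Nat.blt_eq] at hb'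
      obtain ⟨a, ha, hab⟩ := hb'
      have hp : (b :: R ++ P.erase b).Perm (R ++ P) :=
        ((List.perm_middle (a := b) (l₁ := R) (l₂ := P.erase b)).symm).trans
          ((List.perm_cons_erase hbP).symm.append_left R)
      have hm : ∀ x, x ∈ b :: R ++ P.erase b ↔ x ∈ R ++ P := fun x => hp.mem_iff
      rw [hf a (List.mem_append_left _ ha) b (List.mem_append_right _ hbP)] at hab
      obtain ⟨h1, h2, h3, h4⟩ := ih (b :: R) (P.erase b)
        (fun i hi j hj => hf i ((hm i).1 hi) j ((hm j).1 hj)) (hp.nodup_iff.2 hn) (by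
          rw [List.toFinset_cons]
          exact hR.insert_vertex (List.mem_toFinset.2 ha) hab)
      exact ⟨h1, h2, fun x hx => (hm x).1 (h3 x hx), fun x hx => h4 x (List.mem_cons_of_mem _ hx)⟩

theorem comp_start {f : ℕ → ℕ → ℕ} {r : Sym2 ℕ → ℕ} {n s : ℕ} {W : List ℕ} (hW : W.Nodup)
    (hs : s ∈ W) (hf : ∀ i ∈ W, ∀ j ∈ W, f i j = r s(i, j)) :
    Conn r (comp f n [s] (W.erase s)).toFinset ∧ (comp f n [s] (W.erase s)).Nodup ∧
      (∀ x ∈ comp f n [s] (W.erase s), x ∈ W) ∧ s ∈ comp f n [s] (W.erase s) := by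
  have hp : ([s] ++ W.erase s).Perm W := (List.perm_cons_erase hs).symm
  obtain ⟨h1, h2, h3, h4⟩ := comp_spec (f := f) (r := r) n [s] (W.erase s)
    (fun i hi j hj => hf i (hp.mem_iff.1 hi) j (hp.mem_iff.1 hj)) (hp.nodup_iff.2 hW)
    (by simpa using conn_singleton r s)
  exact ⟨h1, h2, fun x hx => hp.mem_iff.1 (h3 x hx), h4 s (by simp)⟩

/-- A sufficient test for `NonP`. -/
def nonPTest (U : List ℕ) (f : ℕ → ℕ → ℕ) : Bool :=
  !U.isEmpty && U.all fun v => (U.erase v).any fun s =>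
    Nat.blt (2 * (comp f U.length [s] ((U.erase v).erase s)).length)
      (listE2 f (comp f U.length [s] ((U.erase v).erase s)))

theorem nonP_of_test {f : ℕ → ℕ → ℕ} {r : Sym2 ℕ → ℕ} {U : List ℕ} (hU : U.Nodup)
    (hf : ∀ i ∈ U, ∀ j ∈ U, f i j = r s(i, j)) (h : nonPTest U f = true) :
    NonP U.toFinset r := by
  simp only [nonPTest, Bool.and_eq_true, Bool.not_eq_true', List.isEmpty_eq_false_iff_exists_mem,
    List.all_eq_true, List.any_eq_true, Nat.blt_eq] at h
  refine ⟨by simpa [Finset.Nonempty] using h.1, fun v hv => ?_⟩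
  obtain ⟨s, hs, hlt⟩ := h.2 v (List.mem_toFinset.1 hv)
  have hsub : ∀ x ∈ U.erase v, x ∈ U := fun x hx => List.mem_of_mem_erase hx
  obtain ⟨h1, h2, h3, -⟩ := comp_start (n := U.length) (hU.erase v) hs
    fun i hi j hj => hf i (hsub i hi) j (hsub j hj)
  refine ⟨_, fun x hx => ?_, fun hx => ?_, h1, ?_⟩
  · exact List.mem_toFinset.2 (hsub x (h3 x (List.mem_toFinset.1 hx)))
  · exact (hU.mem_erase_iff.1 (h3 v (List.mem_toFinset.1 hx))).1 rfl
  · rw [List.toFinset_card_of_nodup h2, ← listE2_eq h2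
      fun i hi j hj => hf i (hsub i (h3 i hi)) j (hsub j (h3 j hj))]
    exact hlt

/-- A sufficient test for the existence of a cut vertex. -/
def cutTest (U : List ℕ) (f : ℕ → ℕ → ℕ) : Bool :=
  U.any fun v => (U.erase v).any fun s =>
    Nat.blt (comp f U.length [s] ((U.erase v).erase s)).length (U.erase v).length &&
      (comp f U.length [s] ((U.erase v).erase s)).all fun a => (U.erase v).all fun b =>
        (comp f U.length [s] ((U.erase v).erase s)).contains b || Nat.beq (f a b) 0

theorem not_twoC_of_test {f : ℕ → ℕ → ℕ} {r : Sym2 ℕ → ℕ} {U : List ℕ} (hU : U.Nodup)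
    (hf : ∀ i ∈ U, ∀ j ∈ U, f i j = r s(i, j)) (h : cutTest U f = true) :
    ¬ TwoC U.toFinset r := by
  simp only [cutTest, Bool.and_eq_true, Bool.or_eq_true, List.contains_iff_mem,
    List.all_eq_true, List.any_eq_true, Nat.blt_eq, Nat.beq_eq] at h
  obtain ⟨v, hv, s, hs, hlt, hcl⟩ := h
  rintro ⟨-, h2⟩
  have hsub : ∀ x ∈ U.erase v, x ∈ U := fun x hx => List.mem_of_mem_erase hx
  obtain ⟨-, h4, h3, h5⟩ := comp_start (n := U.length) (r := r) (hU.erase v) hs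
    fun i hi j hj => hf i (hsub i hi) j (hsub j hj)
  have hW : U.toFinset.erase v = (U.erase v).toFinset := by
    ext x
    simp [hU.mem_erase_iff]
  have hc := h2 v (List.mem_toFinset.2 hv)
  rw [hW] at hc
  obtain ⟨a, ha, b, hb, hbA, hab⟩ := hc.cut
    (A := (comp f U.length [s] ((U.erase v).erase s)).toFinset)
    (fun x hx => List.mem_toFinset.2 (h3 x (List.mem_toFinset.1 hx)))
    ⟨s, List.mem_toFinset.2 h5⟩ (fun e => by
      have := congrArg Finset.card e
      rw [List.toFinset_card_of_nodup h4, List.toFinset_card_of_nodup (hU.erase v)] at this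
      omega)
  rw [List.mem_toFinset] at ha hb hbA
  rcases hcl a ha b hb with h | h
  · exact hbA h
  · rw [hf a (hsub a (h3 a ha)) b (hsub b hb)] at h
    exact absurd h (Nat.pos_iff_ne_zero.1 hab)

/-- Search for an extension of the partial vertex map `g` on `[0, m)` to an embedding of the
multiplicities `d` into `f`, by `n` further vertices. -/
def embed (U : List ℕ) (d f : ℕ → ℕ → ℕ) : ℕ → ℕ → (ℕ → ℕ) → Bool
  | 0, _, _ => true
  | n + 1, m, g => U.any fun x =>
    ((List.range m).all fun i => !Nat.beq (g i) x && Nat.ble (d i m) (f (g i) x)) &&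
      Nat.ble (d m m) (f x x) && embed U d f n (m + 1) fun i => bif Nat.beq i m then x else g i

theorem embed_spec {U : List ℕ} {d f : ℕ → ℕ → ℕ} (n m : ℕ) (g : ℕ → ℕ)
    (hg : ∀ j < m, g j ∈ U ∧ d j j ≤ f (g j) (g j) ∧
      ∀ i < j, g i ≠ g j ∧ d i j ≤ f (g i) (g j)) (h : embed U d f n m g = true) :
    ∃ g' : ℕ → ℕ, ∀ j < m + n, g' j ∈ U ∧ d j j ≤ f (g' j) (g' j) ∧
      ∀ i < j, g' i ≠ g' j ∧ d i j ≤ f (g' i) (g' j) := by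
  induction n generalizing m g with
  | zero => exact ⟨g, hg⟩
  | succ n ih =>
    simp only [embed, List.any_eq_true, Bool.and_eq_true, List.all_eq_true, List.mem_range,
      Bool.not_eq_true', Nat.ble_eq, ← Bool.not_eq_true, Nat.beq_eq] at h
    obtain ⟨x, hx, ⟨h1, h2⟩, h3⟩ := h
    have he : (fun i => bif Nat.beq i m then x else g i) = fun i => if i = m then x else g i := by
      funext i
      simp only [Bool.cond_eq_ite, Nat.beq_eq]
    rw [he] at h3
    have := ih (m + 1) _ ?_ h3
    · rwa [Nat.add_assoc, Nat.add_comm 1] at this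
    intro j hj
    rcases Nat.lt_succ_iff_lt_or_eq.1 hj with hj | rfl
    · rw [if_neg hj.ne]
      refine ⟨(hg j hj).1, (hg j hj).2.1, fun i hi => ?_⟩
      rw [if_neg (hi.trans hj).ne]
      exact (hg j hj).2.2 i hi
    · rw [if_pos rfl]
      refine ⟨hx, h2, fun i hi => ?_⟩
      rw [if_neg hi.ne]
      exact h1 i hi

theorem Has.of_embed {W : Type} {H : SimpleGraph W} {U : List ℕ} {d f : ℕ → ℕ → ℕ}
    {r r' : Sym2 ℕ → ℕ} {k : ℕ} (hf : ∀ i ∈ U, ∀ j ∈ U, f i j = r s(i, j))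
    (hd : ∀ i j, i ≤ j → d i j = r' s(i, j)) (h : embed U d f k 0 id = true)
    (hH : Has H (Finset.range k) r') :
    Has H U.toFinset r := by
  obtain ⟨g, hg⟩ := embed_spec k 0 id (by simp) h
  rw [zero_add] at hg
  have hr : ∀ i < k, ∀ j < k, i < j → g i ≠ g j ∧ r' s(i, j) ≤ r s(g i, g j) := by
    intro i hi j hj hij
    have := (hg j hj).2.2 i hij
    rwa [hd i j hij.le, hf _ (hg i hi).1 _ (hg j hj).1] at this
  have hr' : ∀ i < k, ∀ j < k, i ≠ j → g i ≠ g j ∧ r' s(i, j) ≤ r s(g i, g j) := by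
    intro i hi j hj hij
    rcases lt_or_gt_of_ne hij with h | h
    · exact hr i hi j hj h
    · rw [Sym2.eq_swap, Sym2.eq_swap (a := g i)]
      exact ⟨(hr j hj i hi h).1.symm, (hr j hj i hi h).2⟩
  refine hH.of_bags (fun v => {g v}) (fun _ _ => cn_singleton _ _) ?_ ?_ ?_ ?_
  · simp only [Finset.mem_range, Set.singleton_subset_iff, Finset.mem_coe, List.mem_toFinset]
    exact fun v hv => (hg v hv).1
  · simp only [Finset.mem_range, Set.disjoint_singleton]
    exact fun v hv v' hv' hne => (hr' v hv v' hv' hne).1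
  · simp only [Finset.mem_range]
    exact fun i hi j hj hij _ => ⟨_, rfl, _, rfl, (hr' i hi j hj hij).2⟩
  · simp only [Finset.mem_range]
    intro i hi _
    have := (hg i hi).2.1
    rw [hd i i le_rfl, hf _ (hg i hi).1 _ (hg i hi).1] at this
    exact ⟨_, rfl, this⟩

/-- A multiplicity above one, or a loop, that no vertex of degree `μ` avoids. -/
def multTest (U : List ℕ) (μ : ℕ) (f : ℕ → ℕ → ℕ) : Bool :=
  U.any fun i => U.any fun j => Nat.blt (bif Nat.beq i j then 0 else 1) (f i j) &&
    U.all fun u => Nat.beq u i || Nat.beq u j || !Nat.beq ((U.map (f u)).sum) μ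

/-- Some deletion or contraction of an edge passes `nonPTest`. -/
def reduceTest (U : List ℕ) (f : ℕ → ℕ → ℕ) : Bool :=
  U.any fun x => U.any fun y => Nat.ble x y && Nat.blt 0 (f x y) &&
    (nonPTest U (fun i j => bif Nat.beq i x && Nat.beq j y || Nat.beq i y && Nat.beq j x
      then f i j - 1 else f i j) ||
    (!Nat.beq x y && nonPTest (U.erase y) fun i j =>
      max (f i j) (f (bif Nat.beq i x then y else i) (bif Nat.beq j x then y else j))))

/-- An isomorphism invariant of the multiplicities `f`. -/
def shape (f : ℕ → ℕ → ℕ) (U : List ℕ) : ℕ :=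
  (U.map fun i => Nat.add (Nat.pow (U.map (f i)).sum 3)
    (U.map fun j => Nat.mul (f i j) (f i j)).sum).sum

/-- Some core of the same shape as `f` embeds into `f`. -/
def coreTest (U : List ℕ) (f : ℕ → ℕ → ℕ) : Bool :=
  cores.any fun p => Nat.beq p.1 U.length && Nat.beq
    (shape (fun i j => bif Nat.ble i j then digit p.2 i j else digit p.2 j i) (List.range p.1))
    (shape f U) && embed U (digit p.2) f p.1 0 id

theorem multTest_eq_false {U : List ℕ} {μ : ℕ} {f : ℕ → ℕ → ℕ} {r : Sym2 ℕ → ℕ} (hU : U.Nodup)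
    (hf : ∀ i ∈ U, ∀ j ∈ U, f i j = r s(i, j)) (h : Crit U.toFinset r)
    (hμ : E2 r U.toFinset = 2 * μ + 2 * U.length) : ¬ multTest U μ f = true := by
  intro ht
  simp only [multTest, List.any_eq_true, Bool.and_eq_true, List.all_eq_true, Nat.blt_eq,
    Bool.or_eq_true, Bool.not_eq_true', ← Bool.not_eq_true, Nat.beq_eq, Bool.cond_eq_ite] at ht
  obtain ⟨i, hi, j, hj, h1, h2⟩ := ht
  have hw : ∀ v ∈ U, E2 r U.toFinset = 2 * wt r U.toFinset v + 2 * U.toFinset.card →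
      (U.map (f v)).sum = μ := by
    intro v hv he
    rw [List.toFinset_card_of_nodup hU] at he
    rw [← List.sum_toFinset _ hU, Finset.sum_congr rfl
      fun j hj => hf v hv j (List.mem_toFinset.1 hj)]
    unfold wt at he
    omega
  rw [hf i hi j hj] at h1
  rw [← List.mem_toFinset] at hi hj
  have : ∃ v ∈ U.toFinset, v ≠ i ∧ v ≠ j ∧
      E2 r U.toFinset = 2 * wt r U.toFinset v + 2 * U.toFinset.card := by
    by_cases hij : i = j
    · subst hij
      rw [if_pos rfl] at h1
      obtain ⟨v, hv, hvi, he⟩ := h.exists_max_of_loop hi h1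
      exact ⟨v, hv, hvi, hvi, he⟩
    · rw [if_neg hij] at h1
      exact h.exists_max_of_two_le hi hj h1
  obtain ⟨v, hv, hvi, hvj, he⟩ := this
  rw [List.mem_toFinset] at hv
  have := hw v hv he
  have := h2 v hv
  tauto

theorem Crit.not_nonP_delete {U : Finset ℕ} {r : Sym2 ℕ → ℕ} (h : Crit U r) {x y : ℕ}
    (hx : x ∈ U) (hy : y ∈ U) (hxy : Jn r x y) :
    ¬ NonP U (Function.update r s(x, y) (r s(x, y) - 1)) := by
  intro hn
  have hxy' : 0 < r s(x, y) := hxy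
  refine h.reduce ?_ hn fun n H hH => hH.mono le_rfl fun _ _ _ _ => update_pred_le _ _ _
  by_cases e : x = y
  · subst e
    have := E2_update_loop (r := r) hx (r s(x, x) - 1)
    omega
  · have := E2_update_edge (r := r) hx hy e (r s(x, y) - 1)
    omega

theorem reduceTest_eq_false {U : List ℕ} {f : ℕ → ℕ → ℕ} {r : Sym2 ℕ → ℕ} (hU : U.Nodup)
    (hf : ∀ i ∈ U, ∀ j ∈ U, f i j = r s(i, j)) (h : Crit U.toFinset r) :
    ¬ reduceTest U f = true := by
  intro ht
  simp only [reduceTest, List.any_eq_true, Bool.and_eq_true, Nat.blt_eq,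
    Bool.or_eq_true, Bool.not_eq_true', ← Bool.not_eq_true, Nat.beq_eq, Bool.cond_eq_ite] at ht
  obtain ⟨x, hx, y, hy, ⟨-, h1⟩, h2⟩ := ht
  rw [hf x hx y hy] at h1
  rcases h2 with h2 | ⟨hne, h2⟩
  · refine h.not_nonP_delete (List.mem_toFinset.2 hx) (List.mem_toFinset.2 hy) h1
      (nonP_of_test hU (fun i hi j hj => ?_) h2)
    split_ifs with hc
    · have : s(i, j) = s(x, y) := Sym2.eq_iff.2 hc
      rw [hf i hi j hj, this, Function.update_self]
    · rw [hf i hi j hj, Function.update_of_ne]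
      rwa [Ne, Sym2.eq_iff]
  · have hsub : ∀ x ∈ U.erase y, x ∈ U := fun x hx => List.mem_of_mem_erase hx
    have := nonP_of_test (r := contr r x y) (hU.erase y) (fun i hi j hj => ?_) h2
    · refine h.not_contract (List.mem_toFinset.2 hx) (List.mem_toFinset.2 hy) hne h1 ?_
      convert this using 1
      ext z
      simp [hU.mem_erase_iff]
    · rw [hf i (hsub i hi) j (hsub j hj), contr, Sym2.map_mk, hf]
      · split_ifs
        exacts [hy, hsub i hi]
      · split_ifs
        exacts [hy, hsub j hj]

theorem coreTest_eq_false {U : List ℕ} {f : ℕ → ℕ → ℕ} {r : Sym2 ℕ → ℕ}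
    (hf : ∀ i ∈ U, ∀ j ∈ U, f i j = r s(i, j)) (h : Crit U.toFinset r) :
    ¬ coreTest U f = true := by
  intro ht
  simp only [coreTest, List.any_eq_true, Bool.and_eq_true] at ht
  obtain ⟨p, hp, ⟨-, -⟩, h2⟩ := ht
  obtain ⟨q, hq, hH⟩ := hasO_of_mem_cores p hp
  refine h.not_hasO ⟨q, hq, hH.of_embed hf (fun i j hij => ?_) h2⟩
  rw [packed, Sym2.inf_mk, Sym2.sup_mk, inf_eq_left.2 hij, sup_eq_right.2 hij]

/-- No critical multigraph passes this test. -/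
def leafTest (U : List ℕ) (μ : ℕ) (f : ℕ → ℕ → ℕ) : Bool :=
  multTest U μ f || coreTest U f || cutTest U f || reduceTest U f

theorem leafTest_eq_false {U : List ℕ} {μ : ℕ} {f : ℕ → ℕ → ℕ} {r : Sym2 ℕ → ℕ} (hU : U.Nodup)
    (hf : ∀ i ∈ U, ∀ j ∈ U, f i j = r s(i, j)) (h : Crit U.toFinset r)
    (hμ : E2 r U.toFinset = 2 * μ + 2 * U.length) : ¬ leafTest U μ f = true := by
  simp only [leafTest, Bool.or_eq_true]
  have := multTest_eq_false hU hf h hμ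
  have := reduceTest_eq_false hU hf h
  have := coreTest_eq_false hf h
  have : ¬ cutTest U f = true := fun ht => not_twoC_of_test hU hf ht h.twoC
  tauto

theorem digit_testBit (n i j t : ℕ) :
    (digit n i j).testBit t = (decide (t < 3) && n.testBit (3 * (8 * i + j) + t)) := by
  rw [digit, show 8 = 2 ^ 3 from rfl, Nat.testBit_mod_two_pow, Nat.testBit_shiftRight]

theorem digit_or_shift {n a b c i j : ℕ} (hc : c < 8) (hb : b < 8) (hj : j < 8)
    (h : digit n a b = 0) :
    digit (n ||| c <<< (3 * (8 * a + b))) i j = if a = i ∧ b = j then c else digit n i j := by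
  apply Nat.eq_of_testBit_eq
  intro t
  rw [digit_testBit, Nat.testBit_or, Nat.testBit_shiftLeft]
  have hct : ∀ s, 3 ≤ s → c.testBit s = false := fun s ht =>
    Nat.testBit_lt_two_pow (hc.trans_le ((by norm_num : 8 = 2 ^ 3).le.trans (Nat.pow_le_pow_right (by norm_num) ht)))
  split_ifs with hif
  · obtain ⟨rfl, rfl⟩ := hif
    have := digit_testBit n a b t
    rw [h, Nat.zero_testBit] at this
    by_cases ht : t < 3
    · simp only [ht, decide_true, Bool.true_and] at this ⊢
      rw [← this]
      simp
    · simp [ht, hct t (by omega)]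
  · rw [digit_testBit]
    by_cases ht : t < 3
    · have hne : 8 * a + b ≠ 8 * i + j := fun e => hif (by omega)
      by_cases hle : 3 * (8 * a + b) ≤ 3 * (8 * i + j) + t
      · rw [hct _ (by omega)]
        simp
      · simp [hle]
    · simp [ht]

/-- Add `c` at the (empty) positions `(a, b)` and `(b, a)` of a packed matrix. -/
def put (n a b c : ℕ) : ℕ := n ||| (c <<< (3 * (8 * a + b)) ||| c <<< (3 * (8 * b + a)))

theorem digit_put {n a b c i j : ℕ} (hc : c < 8) (ha : a < 8) (hb : b < 8) (hj : j < 8)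
    (h : digit n a b = 0) (hba : digit n b a = 0) :
    digit (put n a b c) i j = if s(a, b) = s(i, j) then c else digit n i j := by
  rw [put]
  by_cases hab : a = b
  · subst hab
    rw [Nat.or_self, digit_or_shift hc hb hj h]
    simp only [Sym2.eq_iff]
    grind
  · rw [← Nat.or_assoc, digit_or_shift hc ha hj, digit_or_shift hc hb hj h]
    · simp only [Sym2.eq_iff]
      grind
    · rw [digit_or_shift hc hb ha h, if_neg (fun e => hab e.1), hba]

/-- The value `f x`, arranged so that evaluation starts with the argument `x`. -/
def force {α : Type} (x : ℕ) (f : ℕ → α) : α := Nat.rec (f 0) (fun m _ => f (m + 1)) x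

theorem force_eq {α : Type} (x : ℕ) (f : ℕ → α) : force x f = f x := by
  cases x <;> rfl

/-- The sum of `f` over `[0, k)`. -/
def rowSum (f : ℕ → ℕ) : ℕ → ℕ
  | 0 => 0
  | k + 1 => Nat.add (rowSum f k) (f k)

theorem rowSum_eq (f : ℕ → ℕ) (k : ℕ) : rowSum f k = ∑ j ∈ Finset.range k, f j := by
  induction k with
  | zero => rfl
  | succ k ih => rw [Finset.sum_range_succ, ← ih]; rfl

/-- Whether the search can be stopped after the value `c` has been put at `(a, b)`, where `cs` are
the positions still to be filled. -/
def prune (k μ a b c : ℕ) (cs : List (ℕ × ℕ)) (f : ℕ → ℕ → ℕ) : Bool :=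
  (Nat.beq a b && (Nat.blt 1 c || Nat.blt 6 (Nat.add k c))) ||
  (Nat.beq a 0 && Nat.beq b 1 && Nat.blt 9 (Nat.add k μ) && Nat.blt 1 c) ||
  Nat.blt μ (rowSum (f a) k) || Nat.blt μ (rowSum (f b) k) ||
  (Nat.ble 2 a && Nat.blt 9 (Nat.add k (rowSum (f a) k))) ||
  (Nat.ble 2 b && Nat.blt 9 (Nat.add k (rowSum (f b) k))) ||
  (Nat.beq a 0 && Nat.ble 3 b && !cs.contains (0, b - 1) && Nat.blt (f 0 (b - 1)) c) ||
  (Nat.beq a 1 && Nat.ble 3 b && !cs.contains (0, b - 1) && !cs.contains (0, b) &&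
    !cs.contains (1, b - 1) && Nat.beq (f 0 (b - 1)) (f 0 b) && Nat.blt (f 1 (b - 1)) c) ||
  (Nat.beq (Nat.add b 1) k &&
    (List.range k).all (fun j => !cs.contains (a, j) && !cs.contains (j, a)) &&
    (Nat.blt (rowSum (f a) k) 3 || Nat.blt a 2 && Nat.blt (rowSum (f a) k) μ))

/-- Exhaustive search through the multiplicities at the positions `cs`. -/
def search (k μ : ℕ) : List (ℕ × ℕ) → ℕ → ℕ → Bool
  | [], n, l => Nat.blt 0 l || leafTest (List.range k) μ (digit n)
  | (a, b) :: cs, n, l => (List.range (min l 7 + 1)).all fun c =>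
    force (put n a b c) fun n' => prune k μ a b c cs (digit n') || search k μ cs n' (l - c)

/-- The positions on and above the diagonal. -/
def cells (k : ℕ) : List (ℕ × ℕ) :=
  (List.range k).flatMap fun i => (List.range' i (k - i)).map fun j => (i, j)

/-- The normalisation of a critical multigraph that the search relies on. -/
structure Normed (k μ : ℕ) (r : Sym2 ℕ → ℕ) : Prop where
  loop : ∀ a < k, r s(a, a) ≤ 1 ∧ k + r s(a, a) ≤ 6
  edge : 9 < k + μ → r s(0, 1) ≤ 1
  le_seven : μ ≤ 7
  wt_le : ∀ a < k, wt r (Finset.range k) a ≤ μ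
  wt_small : ∀ a < k, 2 ≤ a → k + wt r (Finset.range k) a ≤ 9
  three_le : ∀ a < k, 3 ≤ wt r (Finset.range k) a
  wt_max : ∀ a < k, a < 2 → wt r (Finset.range k) a = μ
  sorted : ∀ b < k, 3 ≤ b → r s(0, b) ≤ r s(0, b - 1) ∧
    (r s(0, b - 1) = r s(0, b) → r s(1, b) ≤ r s(1, b - 1))

theorem Normed.prune_eq_false {k μ a b : ℕ} {r : Sym2 ℕ → ℕ} {cs : List (ℕ × ℕ)}
    {f : ℕ → ℕ → ℕ} (h : Normed k μ r) (ha : a < k) (hb : b < k)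
    (hf : ∀ i < k, ∀ j < k, f i j = if (i, j) ∈ cs ∨ (j, i) ∈ cs then 0 else r s(i, j))
    (hcs : ∀ p ∈ cs, p.1 ≤ p.2) : ¬ prune k μ a b (r s(a, b)) cs f = true := by
  have hsum : ∀ i < k, rowSum (f i) k ≤ wt r (Finset.range k) i := by
    intro i hi
    rw [rowSum_eq]
    refine Finset.sum_le_sum fun j hj => ?_
    rw [hf i hi j (Finset.mem_range.1 hj)]
    split_ifs <;> omega
  have hfull : (∀ j < k, (a, j) ∉ cs ∧ (j, a) ∉ cs) →
      rowSum (f a) k = wt r (Finset.range k) a := by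
    intro hj
    rw [rowSum_eq]
    refine Finset.sum_congr rfl fun j hj' => ?_
    rw [hf a ha j (Finset.mem_range.1 hj'), if_neg]
    have := hj j (Finset.mem_range.1 hj')
    tauto
  have hswap : ∀ i j, i < j → (j, i) ∉ cs := fun i j hij hm => by
    have := hcs _ hm
    simp only at this
    omega
  have h1 := hsum a ha
  have h2 := hsum b hb
  have h3 := h.wt_le a ha
  have h4 := h.wt_le b hb
  simp only [prune, Bool.or_eq_true, Bool.and_eq_true, Nat.beq_eq, Nat.blt_eq, Nat.ble_eq,
    Nat.add_eq, Bool.not_eq_true', ← Bool.not_eq_true, List.contains_iff_mem, List.all_eq_true,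
    List.mem_range]
  rintro ((((((((⟨rfl, h5⟩ | ⟨⟨⟨rfl, rfl⟩, h5⟩, h6⟩) | h5) | h5) | ⟨h5, h6⟩) | ⟨h5, h6⟩) |
    ⟨⟨⟨rfl, h5⟩, h6⟩, h7⟩) | ⟨⟨⟨⟨⟨⟨rfl, h5⟩, h6⟩, h7⟩, h8⟩, h9⟩, h10⟩) | ⟨⟨-, h5⟩, h6⟩)
  · have := h.loop a ha
    omega
  · have := h.edge h5
    omega
  · omega
  · omega
  · have := h.wt_small a ha h5
    omega
  · have := h.wt_small b hb h5
    omega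
  · rw [hf 0 ha (b - 1) (by omega), if_neg (by have := hswap 0 (b - 1) (by omega); tauto)] at h7
    have := (h.sorted b hb h5).1
    omega
  · rw [hf 0 (by omega) (b - 1) (by omega), hf 0 (by omega) b hb,
      if_neg (by have := hswap 0 (b - 1) (by omega); tauto),
      if_neg (by have := hswap 0 b (by omega); tauto)] at h9
    rw [hf 1 ha (b - 1) (by omega), if_neg (by have := hswap 1 (b - 1) (by omega); tauto)] at h10
    have := (h.sorted b hb h5).2 h9
    omega
  · rw [hfull h5] at h6
    have := h.three_le a ha
    have := h.wt_max a ha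
    omega

theorem Normed.search_eq_false {k μ : ℕ} {r : Sym2 ℕ → ℕ} (h : Normed k μ r)
    (hC : Crit (Finset.range k) r) (hE : E2 r (Finset.range k) = 2 * μ + 2 * k)
    (cs : List (ℕ × ℕ)) (n l : ℕ) (hcs : ∀ p ∈ cs, p.1 ≤ p.2 ∧ p.2 < k) (hd : cs.Nodup)
    (hn : ∀ i < k, ∀ j < k, digit n i j = if (i, j) ∈ cs ∨ (j, i) ∈ cs then 0 else r s(i, j))
    (hl : l = (cs.map fun p => r s(p.1, p.2)).sum) : ¬ search k μ cs n l = true := by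
  induction cs generalizing n l with
  | nil =>
    simp only [List.map_nil, List.sum_nil] at hl
    subst hl
    have hU : (List.range k).toFinset = Finset.range k := by ext; simp
    have hb : Nat.blt 0 0 = false := rfl
    rw [search, hb, Bool.false_or]
    rw [← hU] at hC hE
    refine leafTest_eq_false List.nodup_range (fun i hi j hj => ?_) hC (by simpa using hE)
    rw [hn i (List.mem_range.1 hi) j (List.mem_range.1 hj)]
    simp
  | cons p cs ih =>
    obtain ⟨a, b⟩ := p
    obtain ⟨hab, hb⟩ := hcs _ List.mem_cons_self
    simp only at hab hb
    have hk : k ≤ 6 := by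
      have := h.loop b hb
      omega
    rw [List.nodup_cons] at hd
    have hr : r s(a, b) ≤ 7 := ((Finset.single_le_sum (f := fun j => r s(a, j))
      (fun _ _ => Nat.zero_le _) (Finset.mem_range.2 hb)).trans (h.wt_le a (by omega))).trans
      h.le_seven
    simp only [List.map_cons, List.sum_cons] at hl
    have hn' : ∀ i < k, ∀ j < k, digit (put n a b (r s(a, b))) i j =
        if (i, j) ∈ cs ∨ (j, i) ∈ cs then 0 else r s(i, j) := by
      intro i hi j hj
      have h0 : digit n a b = 0 := by rw [hn a (by omega) b hb]; simp
      have h0' : digit n b a = 0 := by rw [hn b hb a (by omega)]; simp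
      rw [digit_put (by omega) (by omega) (by omega) (by omega) h0 h0']
      split_ifs with h1 h2 h2
      · exfalso
        rw [Sym2.eq_iff] at h1
        have hba : (b, a) ∈ cs → (a, b) ∈ cs := fun hm => by
          have := (hcs _ (List.mem_cons_of_mem _ hm)).1
          simp only at this
          obtain rfl : a = b := by omega
          exact hm
        rcases h1 with ⟨rfl, rfl⟩ | ⟨rfl, rfl⟩ <;> tauto
      · rw [h1]
      · rw [hn i hi j hj, if_pos]
        simp only [List.mem_cons]
        tauto
      · rw [hn i hi j hj, if_neg]
        rw [Sym2.eq_iff] at h1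
        simp only [List.mem_cons, Prod.mk.injEq]
        grind
    simp only [search, List.all_eq_true, List.mem_range, force_eq, Bool.or_eq_true]
    intro hall
    rcases hall (r s(a, b)) (by omega) with h1 | h1
    · exact h.prune_eq_false (by omega) hb hn'
        (fun p hp => (hcs p (List.mem_cons_of_mem _ hp)).1) h1
    · exact ih _ _ (fun p hp => hcs p (List.mem_cons_of_mem _ hp)) hd.2 hn' (by omega) h1

theorem nodup_cells (k : ℕ) : (cells k).Nodup := by
  rw [cells, List.nodup_flatMap]
  refine ⟨fun i _ => (List.nodup_range' (s := i) (n := k - i)).map fun x y e => (Prod.mk.inj e).2, ?_⟩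
  refine List.nodup_range.imp fun {i j} hij => ?_
  simp only [Function.onFun, List.disjoint_left, List.mem_map]
  rintro _ ⟨x, -, rfl⟩ ⟨y, -, e⟩
  exact hij (Prod.mk.inj e).1.symm

theorem mem_cells {k : ℕ} {p : ℕ × ℕ} : p ∈ cells k ↔ p.1 ≤ p.2 ∧ p.2 < k := by
  obtain ⟨i, j⟩ := p
  simp only [cells, List.mem_flatMap, List.mem_range, List.mem_map, List.mem_range'_1,
    Prod.mk.injEq]
  constructor
  · rintro ⟨_, h, _, h', rfl, rfl⟩
    omega
  · intro h
    exact ⟨i, by omega, j, by omega, rfl, rfl⟩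

theorem two_mul_sum_cells (r : Sym2 ℕ → ℕ) (k : ℕ) :
    2 * ((cells k).map fun p => r s(p.1, p.2)).sum = E2 r (Finset.range k) := by
  have hs : ((cells k).map fun p => r s(p.1, p.2)).sum =
      ∑ i ∈ Finset.range k, ∑ j ∈ Finset.Ico i k, r s(i, j) := by
    rw [← List.sum_toFinset _ (nodup_cells k), Finset.sum_sigma']
    refine Finset.sum_bij' (fun p _ => ⟨p.1, p.2⟩) (fun p _ => (p.1, p.2)) ?_ ?_ ?_ ?_ ?_
    all_goals simp [mem_cells]
    all_goals omega
  rw [hs]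
  clear hs
  induction k with
  | zero => simp [E2]
  | succ k ih =>
    rw [Finset.sum_range_succ, Finset.range_add_one, E2_insert (by simp), ← ih]
    have : ∀ i ∈ Finset.range k, ∑ j ∈ Finset.Ico i (k + 1), r s(i, j) =
        ∑ j ∈ Finset.Ico i k, r s(i, j) + r s(k, i) := fun i hi => by
      rw [Finset.sum_Ico_succ_top (Finset.mem_range.1 hi).le, Sym2.eq_swap]
    rw [Finset.sum_congr rfl this, Finset.sum_add_distrib, wt]
    simp
    ring

theorem Normed.not_search {k μ : ℕ} {r : Sym2 ℕ → ℕ} (h : Normed k μ r)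
    (hC : Crit (Finset.range k) r) (hE : E2 r (Finset.range k) = 2 * μ + 2 * k) :
    ¬ search k μ (cells k) 0 (μ + k) = true := by
  refine h.search_eq_false hC hE _ _ _ (fun p hp => mem_cells.1 hp) (nodup_cells k) ?_ ?_
  · intro i hi j hj
    rw [if_pos]
    · simp [digit]
    · simp only [mem_cells]
      omega
  · have := two_mul_sum_cells r k
    omega

set_option maxRecDepth 100000 in
theorem search_small : ([(3, 3), (3, 4), (3, 5), (3, 6), (4, 3), (4, 4), (4, 5), (5, 3), (5, 4),
    (5, 5), (5, 6), (6, 3), (6, 4), (6, 5), (6, 6), (6, 7)].all fun p =>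
    search p.1 p.2 (cells p.1) 0 (p.2 + p.1)) = true := by
  decide +kernel

theorem Has.reindex {W : Type} {H : SimpleGraph W} {U : Finset ℕ} {r r' : Sym2 ℕ → ℕ} {f : ℕ → ℕ}
    (h : Has H U r) (hf : Set.InjOn f U)
    (hr : ∀ x ∈ U, ∀ y ∈ U, r s(x, y) = r' s(f x, f y)) : Has H (U.image f) r' := by
  refine h.of_bags (fun v => {f v}) (fun _ _ => cn_singleton _ _) ?_ ?_ ?_ ?_
  · intro v hv
    simpa using ⟨v, hv, rfl⟩
  · intro v hv v' hv' hne
    simpa using fun e => hne (hf hv hv' e)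
  · exact fun i hi j hj _ _ => ⟨_, rfl, _, rfl, (hr i hi j hj).le⟩
  · exact fun i hi _ => ⟨_, rfl, (hr i hi i hi).le⟩

theorem sum_reindex {U : Finset ℕ} {f g : ℕ → ℕ} (hgf : ∀ x ∈ U, g (f x) = x) (F : ℕ → ℕ) :
    ∑ j ∈ U.image f, F (g j) = ∑ j ∈ U, F j := by
  rw [Finset.sum_image fun x hx y hy e => by rw [← hgf x hx, ← hgf y hy, e]]
  exact Finset.sum_congr rfl fun x hx => by rw [hgf x hx]

theorem E2_reindex {U : Finset ℕ} {f g : ℕ → ℕ} (hgf : ∀ x ∈ U, g (f x) = x) (r : Sym2 ℕ → ℕ) :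
    E2 (fun e => r (e.map g)) (U.image f) = E2 r U := by
  unfold E2
  simp only [Sym2.map_mk]
  rw [sum_reindex hgf fun i => ∑ j ∈ U.image f, r s(i, g j) + r s(i, i)]
  exact Finset.sum_congr rfl fun i _ => by rw [sum_reindex hgf fun j => r s(i, j)]

theorem Crit.reindex {U : Finset ℕ} {r : Sym2 ℕ → ℕ} (h : Crit U r) {f g : ℕ → ℕ}
    (hgf : ∀ x ∈ U, g (f x) = x) : Crit (U.image f) (fun e => r (e.map g)) := by
  have hinj : Set.InjOn f U := fun x hx y hy e => by rw [← hgf x hx, ← hgf y hy, e]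
  refine ⟨⟨h.nonP.1.image f, fun v hv => ?_⟩, ?_, ?_⟩
  · obtain ⟨u, hu, rfl⟩ := Finset.mem_image.1 hv
    obtain ⟨S, hS, huS, hc, he⟩ := h.nonP.2 u hu
    have hgS : ∀ x ∈ S, g (f x) = x := fun x hx => hgf x (hS hx)
    refine ⟨S.image f, Finset.image_subset_image hS, fun hm => ?_, ?_, ?_⟩
    · obtain ⟨x, hx, e⟩ := Finset.mem_image.1 hm
      exact huS (hinj (hS hx) hu e ▸ hx)
    · have : (S.image f : Set ℕ) = f '' S := by simp
      rw [Conn, this]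
      refine hc.image f fun x hx y hy hxy => ?_
      rw [Jn, Sym2.map_mk, hgS x hx, hgS y hy]
      exact Or.inr hxy
    · rw [E2_reindex hgS, Finset.card_image_of_injOn (hinj.mono hS)]
      exact he
  · rintro ⟨p, hp, hH⟩
    refine h.not_hasO ⟨p, hp, ?_⟩
    have := hH.reindex (f := g) (r' := r) ?_ fun x _ y _ => by rw [Sym2.map_mk]
    · rwa [Finset.image_image, Finset.image_congr (f := g ∘ f) (g := id) fun x hx => hgf x hx,
        Finset.image_id] at this
    · intro x hx y hy e
      simp only [Finset.coe_image, Set.mem_image] at hx hy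
      obtain ⟨x, hx, rfl⟩ := hx
      obtain ⟨y, hy, rfl⟩ := hy
      rw [hgf x hx, hgf y hy] at e
      rw [e]
  · rw [E2_reindex hgf, Finset.card_image_of_injOn hinj]
    exact h.minimal

/-- A listing of `U` that starts with `a` and `b` and is sorted by `key` from there on. -/
theorem exists_listing {U : Finset ℕ} {a b : ℕ} (ha : a ∈ U) (hb : b ∈ U) (hab : a ≠ b)
    (key : ℕ → ℕ) : ∃ f g : ℕ → ℕ, (∀ x ∈ U, g (f x) = x) ∧ U.image f = Finset.range U.card ∧
      g 0 = a ∧ g 1 = b ∧ (∀ i < U.card, g i ∈ U) ∧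
      ∀ i < U.card, 3 ≤ i → key (g i) ≤ key (g (i - 1)) := by
  have : Std.Total fun x y => key y ≤ key x := ⟨fun x y => le_total _ _⟩
  have : IsTrans ℕ fun x y => key y ≤ key x := ⟨fun x y z h1 h2 => h2.trans h1⟩
  set T := ((U.erase a).erase b).toList.insertionSort fun x y => key y ≤ key x with hT
  have hmem : ∀ x, x ∈ T ↔ x ∈ (U.erase a).erase b := fun x => by simp [hT]
  have hTs : T.Pairwise fun x y => key y ≤ key x := List.pairwise_insertionSort _ _
  have hTd : T.Nodup := (List.perm_insertionSort _ _).nodup_iff.2 (Finset.nodup_toList _)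
  set L := a :: b :: T with hL
  have hLd : L.Nodup := by
    simp only [hL, List.nodup_cons, List.mem_cons, hmem, Finset.mem_erase]
    tauto
  have hLm : ∀ x, x ∈ L ↔ x ∈ U := fun x => by
    simp only [hL, List.mem_cons, hmem, Finset.mem_erase]
    by_cases h1 : x = a <;> by_cases h2 : x = b <;> simp_all
  have hLc : L.length = U.card := by
    rw [← List.toFinset_card_of_nodup hLd]
    congr 1
    ext x
    simp [hLm]
  have hg : ∀ i (h : i < L.length), L.getD i 0 = L[i] := fun i h => by simp [h]
  refine ⟨fun x => L.idxOf x, fun i => L.getD i 0, fun x hx => ?_, ?_, rfl, rfl, fun i hi => ?_,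
    fun i hi h3 => ?_⟩
  · have := List.idxOf_lt_length_iff.2 ((hLm x).2 hx)
    simp only
    rw [hg _ this, List.getElem_idxOf]
  · refine Finset.eq_of_subset_of_card_le (fun i hi => ?_) ?_
    · obtain ⟨x, hx, rfl⟩ := Finset.mem_image.1 hi
      rw [Finset.mem_range, ← hLc]
      exact List.idxOf_lt_length_iff.2 ((hLm x).2 hx)
    · rw [Finset.card_range, Finset.card_image_of_injOn]
      intro x hx y hy e
      exact List.idxOf_inj ((hLm x).2 hx) |>.1 e
  · rw [← hLc] at hi
    simp only
    rw [hg i hi, ← hLm]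
    exact List.getElem_mem hi
  · rw [← hLc] at hi
    simp only
    rw [hg i hi, hg (i - 1) (by omega)]
    obtain ⟨j, rfl⟩ : ∃ j, i = j + 3 := ⟨i - 3, by omega⟩
    have hj : j + 1 < T.length := by simp only [hL, List.length_cons] at hi; omega
    exact List.pairwise_iff_getElem.1 hTs j (j + 1) (by omega) hj (by omega)

theorem E2_eq_sum_wt (r : Sym2 ℕ → ℕ) (U : Finset ℕ) :
    E2 r U = ∑ v ∈ U, wt r U v + ∑ v ∈ U, r s(v, v) := by
  rw [E2, Finset.sum_add_distrib]
  rfl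

theorem Crit.card_add_le {U : Finset ℕ} {r : Sym2 ℕ → ℕ} (h : Crit U r) {a b : ℕ} (ha : a ∈ U)
    (hb : b ∈ U) (hab : a ≠ b) (hae : E2 r U = 2 * wt r U a + 2 * U.card)
    (hbe : E2 r U = 2 * wt r U b + 2 * U.card) :
    (∀ v ∈ U, U.card + r s(v, v) ≤ 6) ∧
      ∀ v ∈ U, v ≠ a → v ≠ b → U.card + wt r U v ≤ 9 := by
  have hb' : b ∈ U.erase a := Finset.mem_erase.2 ⟨hab.symm, hb⟩
  have hs : ∑ v ∈ U, wt r U v = wt r U a + wt r U b + ∑ v ∈ (U.erase a).erase b, wt r U v := by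
    rw [← Finset.add_sum_erase U _ ha, ← Finset.add_sum_erase _ _ hb']
    ring
  have hE := E2_eq_sum_wt r U
  have hc := Finset.card_erase_add_one ha
  have hc' := Finset.card_erase_add_one hb'
  have h3 : ∀ S ⊆ U, 3 * S.card ≤ ∑ v ∈ S, wt r U v := fun S hS => by
    rw [mul_comm, ← smul_eq_mul]
    exact Finset.card_nsmul_le_sum S _ 3 fun v hv => h.three_le_wt (hS hv)
  have hsub : (U.erase a).erase b ⊆ U := (Finset.erase_subset _ _).trans (Finset.erase_subset _ _)
  refine ⟨fun v hv => ?_, fun v hv hva hvb => ?_⟩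
  · have := Finset.single_le_sum (f := fun v => r s(v, v)) (fun _ _ => Nat.zero_le _) hv
    have := h3 _ hsub
    omega
  · have hv' : v ∈ (U.erase a).erase b := by simp [hv, hva, hvb]
    have := Finset.add_sum_erase _ (wt r U) hv'
    have := Finset.card_erase_add_one hv'
    have := h3 _ ((Finset.erase_subset v _).trans hsub)
    omega

theorem not_crit (U : Finset ℕ) (r : Sym2 ℕ → ℕ) : ¬ Crit U r := by
  intro h
  obtain ⟨a, ha, b, hb, hab, hae, hbe⟩ := h.exists_max_pair
  obtain ⟨c1, c2⟩ := h.card_add_le ha hb hab hae hbe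
  set M := wt r U b + 1 with hM
  obtain ⟨f, g, hgf, hfU, rfl, rfl, hgU, hsort⟩ :=
    exists_listing ha hb hab fun v => r s(a, v) * M + r s(b, v)
  set μ := wt r U (g 0) with hμ
  have hk := h.two_lt_card
  set k := U.card with hkdef
  have hinj : ∀ i < k, ∀ j < k, g i = g j → i = j := by
    intro i hi j hj e
    have key : ∀ i < k, f (g i) = i := by
      intro i hi
      rw [← Finset.mem_range, ← hfU] at hi
      obtain ⟨x, hx, rfl⟩ := Finset.mem_image.1 hi
      rw [hgf x hx]
    rw [← key i hi, ← key j hj, e]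
  have hwt : ∀ i, wt (fun e => r (e.map g)) (Finset.range k) i = wt r U (g i) := by
    intro i
    simp only [wt, Sym2.map_mk]
    rw [← hfU, sum_reindex hgf fun j => r s(g i, j)]
  have hC := h.reindex hgf
  have hE := E2_reindex hgf r
  rw [hfU] at hC hE
  have hle : ∀ v ∈ U, wt r U v ≤ μ := fun v hv => by
    have := h.wtBound v hv
    omega
  have h3 : 3 ≤ μ := h.three_le_wt ha
  have hk6 := c1 _ ha
  have htwo : 1 < r s(g 0, g 1) → k + μ ≤ 9 := by
    intro h2
    obtain ⟨v, hv, hv0, hv1, he⟩ := h.exists_max_of_two_le ha hb h2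
    have := c2 v hv hv0 hv1
    omega
  have hone : r s(g 0, g 1) ≤ 1 → μ ≤ k + 1 := by
    intro h1
    have hb' : g 1 ∈ U.erase (g 0) := Finset.mem_erase.2 ⟨hab.symm, hb⟩
    have e1 := E2_erase (r := r) ha
    have e2 := E2_erase (r := r) hb'
    have e3 := wt_erase (r := r) (v := g 1) ha
    rw [Sym2.eq_swap] at e3
    omega
  have hN : Normed k μ fun e => r (e.map g) := by
    refine ⟨fun i hi => ⟨?_, ?_⟩, ?_, by omega, fun i hi => ?_, fun i hi h2 => ?_, fun i hi => ?_,
      fun i hi h2 => ?_, fun i hi h2 => ?_⟩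
    · exact h.loop_le (hgU i hi)
    · exact c1 _ (hgU i hi)
    · rw [Sym2.map_mk]
      omega
    · rw [hwt]
      exact hle _ (hgU i hi)
    · rw [hwt]
      exact c2 _ (hgU i hi) (fun e => by have := hinj _ hi _ (by omega) e; omega)
        fun e => by have := hinj _ hi _ (by omega) e; omega
    · rw [hwt]
      exact h.three_le_wt (hgU i hi)
    · rw [hwt]
      obtain rfl | rfl : i = 0 ∨ i = 1 := by omega
      · rfl
      · omega
    · simp only [Sym2.map_mk]
      have hs := hsort i hi h2
      have h1 : r s(g 1, g i) < M := Nat.lt_succ_of_le (le_wt (hgU i hi))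
      have h1' : r s(g 1, g (i - 1)) < M := Nat.lt_succ_of_le (le_wt (hgU _ (by omega)))
      refine ⟨?_, fun e => ?_⟩
      · by_contra hlt
        have := Nat.mul_le_mul_right M (Nat.succ_le_of_lt (not_le.1 hlt))
        rw [Nat.succ_mul] at this
        omega
      · rw [e] at hs
        omega
  have hmain := hN.not_search hC (by rw [hE]; omega)
  have hs := search_small
  rw [List.all_eq_true] at hs
  refine hmain (hs (k, μ) ?_)
  clear_value μ k
  have hμ : μ ≤ 7 := by omega
  have hk6 : k ≤ 6 := by omega
  interval_cases k <;> interval_cases μ <;> first | (exfalso; omega) | simp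

theorem NonP.hasO {U : Finset ℕ} {r : Sym2 ℕ → ℕ} (h : NonP U r) : HasO U r := by
  by_contra hO
  obtain ⟨U', r', hC⟩ := exists_crit h hO
  exact not_crit U' r' hC

theorem Pseudoforest.of_injective_hom {V W : Type} {H : SimpleGraph W} {G : SimpleGraph V}
    (hG : Pseudoforest G) (f : H →g G) (hf : Function.Injective f) : Pseudoforest H := by
  intro u v c c' hc hc' huv e
  have := hG (c.map f) (c'.map f) ((Walk.isCycle_map_iff_of_injective hf).2 hc)
    ((Walk.isCycle_map_iff_of_injective hf).2 hc') (huv.map f) (e.map f)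
  simpa [Walk.edges_map, (Sym2.map.injective hf).eq_iff] using this

theorem card_edgeSet_deleteEdges {W : Type} [Finite W] {H : SimpleGraph W} {e : Sym2 W}
    (he : e ∈ H.edgeSet) :
    Nat.card (H.deleteEdges {e}).edgeSet + 1 = Nat.card H.edgeSet := by
  rw [edgeSet_deleteEdges, Nat.card_coe_set_eq, Nat.card_coe_set_eq]
  exact Set.ncard_sdiff_singleton_add_one he (Set.toFinite _)

theorem connected_deleteEdges_of_isCycle {W : Type} {H : SimpleGraph W} (hH : H.Connected)
    {u : W} {c : H.Walk u u} (hc : c.IsCycle) {e : Sym2 W} (he : e ∈ c.edges) :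
    (H.deleteEdges {e}).Connected := by
  induction e with
  | h x y =>
    exact hH.connected_delete_edge_of_not_isBridge fun h => h.notMem_edges_of_isCycle hc he

theorem exists_mem_edges_of_isCycle {W : Type} {H : SimpleGraph W} {u : W} {c : H.Walk u u}
    (hc : c.IsCycle) : ∃ e, e ∈ c.edges := by
  have h := hc.three_le_length
  rw [← Walk.length_edges] at h
  exact List.exists_mem_of_length_pos (by omega)

theorem exists_isCycle_of_card_le {W : Type} [Finite W] {H : SimpleGraph W} (hH : H.Connected)
    (h : Nat.card W ≤ Nat.card H.edgeSet) : ∃ (u : W) (c : H.Walk u u), c.IsCycle := by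
  by_contra! hn
  have := (isTree_iff_connected_and_card.1 ⟨hH, fun u c => hn u c⟩).2
  omega

theorem not_pseudoforest_of_card_lt {W : Type} [Finite W] {H : SimpleGraph W}
    (hH : H.Connected) (h : Nat.card W < Nat.card H.edgeSet) : ¬ Pseudoforest H := by
  intro hp
  obtain ⟨u, c, hc⟩ := exists_isCycle_of_card_le hH h.le
  obtain ⟨e, he⟩ := exists_mem_edges_of_isCycle hc
  have hcard := card_edgeSet_deleteEdges (c.edges_subset_edgeSet he)
  obtain ⟨v, c', hc'⟩ := exists_isCycle_of_card_le (connected_deleteEdges_of_isCycle hH hc he)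
    (by omega)
  have hle := H.deleteEdges_le {e}
  have := (hp c (c'.mapLe hle) hc (hc'.mapLe hle) (hH.preconnected _ _) e).1 he
  rw [Walk.edges_mapLe_eq_edges] at this
  have := c'.edges_subset_edgeSet this
  simp at this

theorem card_lt_of_two_cycles {W : Type} [Finite W] {H : SimpleGraph W} (hH : H.Connected)
    {u v : W} {c : H.Walk u u} {c' : H.Walk v v} (hc : c.IsCycle) (hc' : c'.IsCycle)
    {e : Sym2 W} (he : e ∈ c.edges) (he' : e ∉ c'.edges) : Nat.card W < Nat.card H.edgeSet := by
  have h1 := connected_deleteEdges_of_isCycle hH hc he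
  have hcard := card_edgeSet_deleteEdges (c.edges_subset_edgeSet he)
  have hd : ∀ f ∈ c'.edges, f ∈ (H.deleteEdges {e}).edgeSet := by
    intro f hf
    rw [edgeSet_deleteEdges]
    exact ⟨c'.edges_subset_edgeSet hf, fun h => he' (h ▸ hf)⟩
  have hc2 := hc'.transfer hd
  obtain ⟨f, hf⟩ := exists_mem_edges_of_isCycle hc2
  have hcard2 := card_edgeSet_deleteEdges (Walk.edges_subset_edgeSet _ hf)
  have := (connected_deleteEdges_of_isCycle h1 hc2 hf).card_vert_le_card_edgeSet_add_one
  omega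

theorem exists_connected_of_not_pseudoforest {W : Type} [Finite W] {H : SimpleGraph W}
    (h : ¬ Pseudoforest H) : ∃ S : Set W, (H.induce S).Connected ∧
      Nat.card S < Nat.card (H.induce S).edgeSet := by
  classical
  simp only [Pseudoforest, not_forall] at h
  obtain ⟨u, v, c, c', hc, hc', huv, e, he⟩ := h
  have hmem : ∀ {x : W} (p : H.Walk x x), H.Reachable x u →
      ∀ y ∈ p.support, y ∈ (H.connectedComponentMk u).supp := fun p hx y hy =>
    ConnectedComponent.sound ((p.takeUntil y hy).reachable.symm.trans hx)
  have hS : (H.induce (H.connectedComponentMk u).supp).Connected :=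
    (H.connectedComponentMk u).connected_toSimpleGraph
  refine ⟨_, hS, ?_⟩
  have key : ∀ {x : W} (p : H.Walk x x) (hp : p.IsCycle) (hx : H.Reachable x u),
      (p.induce _ (hmem p hx)).IsCycle ∧
        ∀ f, f ∈ p.edges ↔ ∃ g ∈ (p.induce _ (hmem p hx)).edges, g.map Subtype.val = f := by
    intro x p hp hx
    have hm := Walk.map_induce p (hmem p hx)
    constructor
    · rw [← hm] at hp
      exact (Walk.isCycle_map_iff_of_injective Subtype.val_injective).1 hp
    · intro f
      have := congrArg Walk.edges hm
      rw [Walk.edges_map] at this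
      exact (iff_of_eq (congrArg (f ∈ ·) this.symm)).trans List.mem_map
  obtain ⟨h1, h2⟩ := key c hc (Reachable.refl u)
  obtain ⟨h3, h4⟩ := key c' hc' huv.symm
  by_cases hec : e ∈ c.edges
  · have hec' : e ∉ c'.edges := fun h => he ⟨fun _ => h, fun _ => hec⟩
    obtain ⟨g, hg, rfl⟩ := (h2 e).1 hec
    exact card_lt_of_two_cycles hS h1 h3 hg fun h => hec' ((h4 _).2 ⟨g, h, rfl⟩)
  · have hec' : e ∈ c'.edges := by
      by_contra h
      exact he ⟨fun h' => absurd h' hec, fun h' => absurd h' h⟩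
    obtain ⟨g, hg, rfl⟩ := (h4 e).1 hec'
    exact card_lt_of_two_cycles hS h3 h1 hg fun h => hec ((h2 _).2 ⟨g, h, rfl⟩)

/-- The multiplicity function on `ℕ` describing the image of the graph `G` under `φ`. -/
noncomputable def mult {V : Type} (G : SimpleGraph V) (φ : V → ℕ) (e : Sym2 ℕ) : ℕ :=
  open Classical in if ∃ a b, e = s(φ a, φ b) ∧ G.Adj a b then 1 else 0

theorem mult_apply {V : Type} {G : SimpleGraph V} {φ : V → ℕ} (hφ : Function.Injective φ)
    (a b : V) [Decidable (G.Adj a b)] : mult G φ s(φ a, φ b) = if G.Adj a b then 1 else 0 := by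
  unfold mult
  congr 1
  simp only [Sym2.eq_iff, hφ.eq_iff, eq_iff_iff]
  constructor
  · rintro ⟨x, y, ⟨rfl, rfl⟩ | ⟨rfl, rfl⟩, h⟩
    exacts [h, h.symm]
  · exact fun h => ⟨a, b, .inl ⟨rfl, rfl⟩, h⟩

theorem connected_iff_conn {W : Type} [Fintype W] {H : SimpleGraph W} {r : Sym2 ℕ → ℕ}
    {ψ : W → ℕ} (hψ : Function.Injective ψ) (hr : ∀ a b, 0 < r s(ψ a, ψ b) ↔ H.Adj a b) :
    H.Connected ↔ Conn r (Finset.univ.image ψ) := by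
  have h1 : H.Connected ↔ Cn H.Adj Set.univ := by
    rw [← connected_induce_iff_cn, (induceUnivIso H).connected_iff]
  have himg : ((Finset.univ.image ψ : Finset ℕ) : Set ℕ) = ψ '' Set.univ := by simp
  rw [h1, Conn, himg]
  constructor
  · exact fun h => h.image ψ fun a _ b _ hab => .inr ((hr a b).2 hab)
  · intro h
    obtain ⟨_, ⟨w, -, rfl⟩⟩ := h.1
    have : Nonempty W := ⟨w⟩
    have hinv := Function.leftInverse_invFun hψ
    have := h.image (R' := H.Adj) (Function.invFun ψ) (by
      rintro _ ⟨a, -, rfl⟩ _ ⟨b, -, rfl⟩ hab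
      rw [hinv a, hinv b]
      exact .inr ((hr a b).1 hab))
    rwa [← Set.image_comp, hinv.comp_eq_id, Set.image_id] at this

theorem E2_image {W : Type} [Fintype W] {H : SimpleGraph W} [DecidableRel H.Adj]
    {r : Sym2 ℕ → ℕ} {ψ : W → ℕ} (hψ : Function.Injective ψ)
    (hr : ∀ a b, r s(ψ a, ψ b) = if H.Adj a b then 1 else 0) :
    E2 r (Finset.univ.image ψ) = 2 * Nat.card H.edgeSet := by
  classical
  rw [E2, Finset.sum_image fun _ _ _ _ h => hψ h, Nat.card_eq_fintype_card, ← edgeFinset_card,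
    ← H.sum_degrees_eq_twice_card_edges]
  refine Finset.sum_congr rfl fun a _ => ?_
  rw [Finset.sum_image fun _ _ _ _ h => hψ h, hr]
  simp only [hr, SimpleGraph.irrefl, if_false, add_zero, Finset.sum_boole, Nat.cast_id]
  rw [← card_neighborFinset_eq_degree]
  congr 1
  ext b
  simp

theorem bic_iff {W : Type} [Finite W] {H : SimpleGraph W} {V : Type} {G : SimpleGraph V}
    {φ : V → ℕ} (hφ : Function.Injective φ) (i : H ↪g G) {S : Finset ℕ}
    (hS : ∀ n, n ∈ S ↔ ∃ w, φ (i w) = n) :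
    Bic (mult G φ) S ↔ H.Connected ∧ Nat.card W < Nat.card H.edgeSet := by
  classical
  have := Fintype.ofFinite W
  have hψ : Function.Injective (φ ∘ i) := hφ.comp i.injective
  have hr : ∀ a b, mult G φ s((φ ∘ i) a, (φ ∘ i) b) = if H.Adj a b then 1 else 0 := by
    intro a b
    simp only [Function.comp, mult_apply hφ, i.map_adj_iff]
  obtain rfl : S = Finset.univ.image (φ ∘ i) := by
    ext n
    simp [hS]
  rw [Bic, E2_image hψ hr, Finset.card_image_of_injective _ hψ, Finset.card_univ,
    ← connected_iff_conn (H := H) hψ (fun a b => by rw [hr]; split <;> simp [*]),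
    ← Nat.card_eq_fintype_card]
  refine and_congr_right fun _ => ?_
  omega

theorem nonP_iff {V : Type} [Fintype V] {G : SimpleGraph V} {φ : V → ℕ}
    (hφ : Function.Injective φ) :
    NonP (Finset.univ.image φ) (mult G φ) ↔ ¬ ApexPseudoforest G := by
  classical
  constructor
  · rintro ⟨hne, h⟩ ⟨s, hs, hp⟩
    obtain ⟨v, hv⟩ : ∃ v, s ⊆ {v} := by
      obtain rfl | ⟨v, rfl⟩ := hs.eq_empty_or_singleton
      · obtain ⟨_, hx⟩ := hne
        obtain ⟨v, -, -⟩ := Finset.mem_image.1 hx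
        exact ⟨v, Set.empty_subset _⟩
      · exact ⟨v, subset_rfl⟩
    obtain ⟨S, hS, hvS, hb⟩ := h (φ v) (by simp)
    have hT : ∀ n, n ∈ S ↔ ∃ w : {x | φ x ∈ S}, φ (Embedding.induce {x | φ x ∈ S} (G := G) w) = n := by
      intro n
      constructor
      · intro hn
        obtain ⟨x, -, rfl⟩ := Finset.mem_image.1 (hS hn)
        exact ⟨⟨x, hn⟩, rfl⟩
      · rintro ⟨w, rfl⟩
        exact w.2
    obtain ⟨h1, h2⟩ := (bic_iff hφ (Embedding.induce {x | φ x ∈ S}) hT).1 hb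
    refine not_pseudoforest_of_card_lt h1 h2 ?_
    have hsub : {x | φ x ∈ S} ⊆ sᶜ := by
      intro x hx hxs
      obtain rfl := hv hxs
      exact hvS hx
    exact hp.of_injective_hom (induceHomOfLE G hsub).toHom (induceHomOfLE G hsub).injective
  · intro h
    have key : ∀ s : Set V, s.Subsingleton → ∃ T ⊆ sᶜ, T.Nonempty ∧
        Bic (mult G φ) (Finset.univ.filter (· ∈ T) |>.image φ) := by
      intro s hs
      have hp : ¬ Pseudoforest (G.induce sᶜ) := fun hp => h ⟨s, hs, hp⟩
      obtain ⟨S, h1, h2⟩ := exists_connected_of_not_pseudoforest hp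
      refine ⟨Subtype.val '' S, ?_, ?_, ?_⟩
      · rintro _ ⟨x, -, rfl⟩
        exact x.2
      · obtain ⟨x⟩ := h1.nonempty
        exact ⟨_, x, x.2, rfl⟩
      · refine (bic_iff hφ ((Embedding.induce S).trans (Embedding.induce sᶜ)) ?_).2 ⟨h1, h2⟩
        intro n
        simp only [Finset.mem_image, Finset.mem_filter, Finset.mem_univ, true_and]
        constructor
        · rintro ⟨_, ⟨x, hx, rfl⟩, rfl⟩
          exact ⟨⟨x, hx⟩, rfl⟩
        · rintro ⟨w, rfl⟩
          exact ⟨_, ⟨w, w.2, rfl⟩, rfl⟩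
    refine ⟨?_, fun x hx => ?_⟩
    · obtain ⟨T, -, ⟨v, -⟩, -⟩ := key ∅ Set.subsingleton_empty
      exact ⟨φ v, by simp⟩
    · obtain ⟨v, -, rfl⟩ := Finset.mem_image.1 hx
      obtain ⟨T, hT, -, hb⟩ := key {v} Set.subsingleton_singleton
      refine ⟨_, Finset.image_subset_image (Finset.filter_subset _ _), ?_, hb⟩
      simp only [Finset.mem_image, Finset.mem_filter, hφ.eq_iff, not_exists, not_and]
      rintro w ⟨-, hw⟩ rfl
      exact hT hw rfl

theorem Has.isMinorOf {V W : Type} [Fintype V] {G : SimpleGraph V} {H : SimpleGraph W}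
    {φ : V → ℕ} (hφ : Function.Injective φ)
    (h : Has H (Finset.univ.image φ) (mult G φ)) : IsMinorOf H G := by
  classical
  have hle : ∀ e, mult G φ e ≤ 1 := fun e => by unfold mult; split <;> simp
  have hdiag : ∀ e : Sym2 ℕ, e.IsDiag → mult G φ e = 0 := by
    intro e he
    unfold mult
    rw [if_neg]
    rintro ⟨a, b, rfl, hab⟩
    exact hab.ne (hφ (Sym2.mk_isDiag_iff.1 he))
  have hval : ∀ x ∈ validNodes (Finset.univ.image φ) (mult G φ), ∃ v, x = base (φ v) := by
    rintro (n | ⟨c, e, n⟩) hx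
    · obtain ⟨v, -, rfl⟩ := Finset.mem_image.1 hx
      exact ⟨v, rfl⟩
    · obtain ⟨-, h1, h2⟩ := hx
      have := hle e
      by_cases hd : e.IsDiag
      · have := hdiag e hd
        omega
      · have := (h2 hd).2
        omega
  have hg : ∀ v, {w | base (φ w) = base (φ v)} = {v} := by
    intro v
    ext w
    simp [hφ.eq_iff]
  rw [isMinorOf_iff]
  refine MinorIn.trans h (fun x => {w | base (φ w) = x}) ?_ (fun _ _ => Set.subset_univ _) ?_ ?_
  · intro x hx
    obtain ⟨v, rfl⟩ := hval x hx
    rw [hg]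
    exact cn_singleton _ v
  · intro x hx y hy hxy
    refine Set.disjoint_left.2 fun w hw hw' => hxy (hw.symm.trans hw')
  · intro x hx y hy hxy
    obtain ⟨v, rfl⟩ := hval x hx
    obtain ⟨w, rfl⟩ := hval y hy
    refine ⟨v, rfl, w, rfl, ?_⟩
    have := (realize_base_base.1 hxy).2
    rw [mult_apply hφ] at this
    by_contra hn
    simp [hn] at this

theorem not_apexPseudoforest_mkGraph {n : ℕ} {E : List (ℕ × ℕ)}
    (h : nonPTest (List.range n) (fun i j => if i ≠ j ∧ ((i, j) ∈ E ∨ (j, i) ∈ E) then 1 else 0)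
      = true) : ¬ ApexPseudoforest (mkGraph n E) := by
  classical
  rw [← nonP_iff Fin.val_injective]
  convert nonP_of_test (r := mult (mkGraph n E) Fin.val) List.nodup_range ?_ h
  · ext i
    simp only [Finset.mem_image, Finset.mem_univ, true_and, List.mem_toFinset, List.mem_range]
    exact ⟨fun ⟨a, ha⟩ => ha ▸ a.2, fun hi => ⟨⟨i, hi⟩, rfl⟩⟩
  · intro i hi j hj
    have := mult_apply (G := mkGraph n E) Fin.val_injective ⟨i, List.mem_range.1 hi⟩
      ⟨j, List.mem_range.1 hj⟩
    rw [this]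
    congr 1
    simp [mkGraph]

theorem not_apexPseudoforest_of_mem_OList :
    ∀ p ∈ OList, ¬ ApexPseudoforest p.2 := by
  simp only [OList, List.forall_mem_cons]
  refine ⟨?_, ?_, ?_, ?_, ?_, ?_, ?_, ?_, ?_, ?_, ?_, ?_, ?_, ?_, ?_, ?_, ?_, ?_, ?_, ?_, ?_, ?_,
    ?_, ?_, ?_, ?_, ?_, ?_, ?_, ?_, ?_, ?_, ?_, by simp⟩ <;>
  exact not_apexPseudoforest_mkGraph (by decide +kernel)

/-- Every graph outside the class has a minor among the listed obstructions. -/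
theorem exists_isMinorOf_of_not_apexPseudoforest {V : Type} [Finite V] {G : SimpleGraph V}
    (h : ¬ ApexPseudoforest G) : ∃ p ∈ OList, IsMinorOf p.2 G := by
  have := Fintype.ofFinite V
  obtain ⟨n, ⟨e⟩⟩ := Finite.exists_equiv_fin V
  have hφ : Function.Injective fun v => (e v : ℕ) := Fin.val_injective.comp e.injective
  obtain ⟨p, hp, hm⟩ := ((nonP_iff hφ).2 h).hasO
  exact ⟨p, hp, hm.isMinorOf hφ⟩

theorem ObsApexPseudoforest.inO {V : Type} [Finite V] {G : SimpleGraph V}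
    (h : ObsApexPseudoforest G) : InO G := by
  obtain ⟨p, hp, hm⟩ := exists_isMinorOf_of_not_apexPseudoforest h.1
  refine ⟨p, hp, ?_⟩
  by_contra hn
  refine not_apexPseudoforest_of_mem_OList p hp (h.2 _ p.2 hm ⟨fun e => hn ⟨e.symm⟩⟩)

/-- Every obstruction for apex-pseudoforests not isomorphic to a member of `O`
is `K₂,₃`-minor-free or triconnected. -/
theorem obstruction_K23_or_triconnected {V : Type} [Finite V] (G : SimpleGraph V)
    (h1 : ObsApexPseudoforest G) (h2 : ¬ InO G) :
    ¬ IsMinorOf (completeBipartiteGraph (Fin 2) (Fin 3)) G ∨ KConnected 3 G :=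
  absurd h1.inO h2
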